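/- arXiv:2306.07359 — 2 statements merged into one kernel-verified Lean document; each statement's English description precedes it below -/
import Mathlib

section
/- Let B₂ = {4, 4i} ⊂ ℂ. The fundamental group π₁(U_{B₂}) of the complement in ℂ² of the curve F_{B₂} = f⁻¹({4, 4i}) is isomorphic to the free group F₂ on two generators. -/
open Complex

/-- The polynomial map `f(x,y) = x⁶ + y⁶ + 6xy` on `ℂ²`. -/
noncomputable def f : ℂ × ℂ → ℂ := fun p => p.1 ^ 6 + p.2 ^ 6 + 6 * p.1 * p.2

/-- `U B = ℂ² \ f⁻¹(B)`, the complement of the union of fibers of `f` over `B`. -/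
def U (B : Set ℂ) : Set (ℂ × ℂ) := {p | f p ∉ B}

namespace FG
open Topology Filter ComplexConjugate

local notation "𝕀" => unitInterval
local notation "UU" => U ({4, 4 * Complex.I} : Set ℂ)

section framework
variable {X : Type*} [TopologicalSpace X]

abbrev PQ (x y : X) := Path.Homotopic.Quotient x y
abbrev mk {x y : X} (p : Path x y) : PQ x y := Path.Homotopic.Quotient.mk p

theorem mk_trans {x y z : X} (p : Path x y) (q : Path y z) : mk (p.trans q) = (mk p).trans (mk q) :=
  Path.Homotopic.Quotient.mk_trans p q
theorem mk_symm {x y : X} (p : Path x y) : mk p.symm = (mk p).symm := Path.Homotopic.Quotient.mk_symm p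

/-- view a loop class as element of the fundamental group -/
def lp {x : X} (p : PQ x x) : FundamentalGroup X x := p

theorem lp_trans {x : X} (p q : PQ x x) : lp (p.trans q) = lp q * lp p := rfl
theorem lp_symm {x : X} (p : PQ x x) : lp p.symm = (lp p)⁻¹ := rfl
theorem lp_refl {x : X} : lp (Path.Homotopic.Quotient.refl x) = 1 := rfl

theorem symm_trans' {x y z : X} (p : PQ x y) (q : PQ y z) : (p.trans q).symm = q.symm.trans p.symm := by
  induction p using Path.Homotopic.Quotient.ind with | _ p
  induction q using Path.Homotopic.Quotient.ind with | _ q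
  rw [← Path.Homotopic.Quotient.mk_trans, ← Path.Homotopic.Quotient.mk_symm, ← Path.Homotopic.Quotient.mk_symm,
    ← Path.Homotopic.Quotient.mk_symm, ← Path.Homotopic.Quotient.mk_trans, Path.trans_symm]

theorem symm_symm' {x y : X} (p : PQ x y) : p.symm.symm = p := by
  induction p using Path.Homotopic.Quotient.ind with | _ p
  rw [← Path.Homotopic.Quotient.mk_symm, ← Path.Homotopic.Quotient.mk_symm, Path.symm_symm]

theorem cancel_right {x y z : X} (p : PQ x y) (q : PQ y z) : (p.trans q).trans q.symm = p := by
  rw [Path.Homotopic.Quotient.trans_assoc, Path.Homotopic.Quotient.trans_symm, Path.Homotopic.Quotient.trans_refl]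
theorem cancel_right' {x y z : X} (p : PQ x y) (q : PQ z y) : (p.trans q.symm).trans q = p := by
  rw [Path.Homotopic.Quotient.trans_assoc, Path.Homotopic.Quotient.symm_trans, Path.Homotopic.Quotient.trans_refl]

def Eqv {x y : X} (H : Subgroup (FundamentalGroup X x)) (a b : PQ x y) : Prop := lp (a.trans b.symm) ∈ H

variable {x y z : X} {H : Subgroup (FundamentalGroup X x)}

theorem Eqv.refl (a : PQ x y) : Eqv H a a := by
  unfold Eqv; rw [Path.Homotopic.Quotient.trans_symm]; exact H.one_mem
theorem Eqv.symm {a b : PQ x y} (h : Eqv H a b) : Eqv H b a := by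
  unfold Eqv at *
  have := H.inv_mem h
  rw [← lp_symm, symm_trans', symm_symm'] at this
  exact this
theorem Eqv.trans {a b c : PQ x y} (h : Eqv H a b) (h' : Eqv H b c) : Eqv H a c := by
  unfold Eqv at *
  have := H.mul_mem h' h
  rw [← lp_trans, ← Path.Homotopic.Quotient.trans_assoc, cancel_right'] at this
  exact this
theorem eqv_mul (a b : PQ x y) (c : PQ y z) : Eqv H (a.trans c) (b.trans c) ↔ Eqv H a b := by
  unfold Eqv
  rw [symm_trans', ← Path.Homotopic.Quotient.trans_assoc, cancel_right]
theorem Eqv.mul {a b : PQ x y} (h : Eqv H a b) (c : PQ y z) : Eqv H (a.trans c) (b.trans c) :=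
  (eqv_mul a b c).2 h
theorem eqv_refl_iff (a : PQ x x) : Eqv H a (Path.Homotopic.Quotient.refl x) ↔ lp a ∈ H := by
  unfold Eqv
  have : (Path.Homotopic.Quotient.refl x).symm = Path.Homotopic.Quotient.refl x := by
    show Path.Homotopic.Quotient.symm (mk (Path.refl x)) = mk (Path.refl x)
    rw [← Path.Homotopic.Quotient.mk_symm, Path.refl_symm]
  rw [this, Path.Homotopic.Quotient.trans_refl]

/-- partial path class -/
noncomputable def pp {x y : X} (γ : Path x y) (t : 𝕀) : PQ x (γ t) :=
  mk ((γ.subpath 0 t).cast γ.source.symm rfl)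

theorem pp_step {x y : X} (γ : Path x y) (t s : 𝕀) : (pp γ t).trans (mk (γ.subpath t s)) = pp γ s := by
  obtain ⟨⟨g, hg⟩, h0, h1⟩ := γ
  subst h0 h1
  exact Path.Homotopic.Quotient.eq.2 ⟨Path.Homotopy.subpathTransSubpath _ 0 t s⟩

theorem pp_zero {x y : X} (γ : Path x y) : pp γ 0 = mk ((Path.refl x).cast rfl γ.source) := by
  obtain ⟨⟨g, hg⟩, h0, h1⟩ := γ
  subst h0 h1
  unfold pp
  congr 1
  rw [Path.subpath_self]; rfl

theorem pp_one {x y : X} (γ : Path x y) : pp γ 1 = mk (γ.cast rfl γ.target) := by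
  obtain ⟨⟨g, hg⟩, h0, h1⟩ := γ
  subst h0 h1
  unfold pp
  congr 1
  rw [Path.subpath_zero_one]; rfl

theorem subpath_near {x y : X} (γ : Path x y) (t : 𝕀) {V : Set X} (hV : V ∈ 𝓝 (γ t)) :
    ∀ᶠ s in 𝓝 t, ∀ u, γ.subpath t s u ∈ V := by
  have h1 : γ ⁻¹' V ∈ 𝓝 t := γ.continuous.continuousAt hV
  obtain ⟨ε, hε, hb⟩ := Metric.mem_nhds_iff.1 h1
  filter_upwards [Metric.ball_mem_nhds t hε] with s hs u
  have : γ.subpath t s u ∈ Set.range (γ.subpath t s) := ⟨u, rfl⟩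
  rw [Path.range_subpath] at this
  obtain ⟨r, hr, e⟩ := this
  rw [← e]
  apply hb
  rw [Metric.mem_ball, Subtype.dist_eq, Real.dist_eq] at *
  have h2 : (r : ℝ) ∈ Set.uIcc (t : ℝ) (s : ℝ) := by
    rw [Set.mem_uIcc] at hr ⊢
    exact hr
  have := Set.abs_sub_left_of_mem_uIcc h2
  linarith

theorem I_ind (P : 𝕀 → Prop) (h : ∀ t, ∀ᶠ s in 𝓝 t, (P t ↔ P s)) (s t : 𝕀) (hs : P s) : P t := by
  have := PreconnectedSpace.induction₂' (α := 𝕀) (fun a b => P a → P b)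
    (fun t => (h t).mono fun s hs => ⟨hs.1, hs.2⟩) ⟨fun a b c h1 h2 h3 => h2 (h1 h3)⟩ s t
  exact this hs

theorem exists_join [LocallyPathConnectedSpace X] {U0 : Set X} (hU0 : Dense U0) {x : X} {W : Set X} (hW : W ∈ 𝓝 x) :
    ∃ q ∈ U0, ∃ σ : Path x q, ∀ t, σ t ∈ W := by
  obtain ⟨W', ⟨hW', hpc⟩, hsub⟩ := (path_connected_basis x).mem_iff.1 hW
  obtain ⟨q, hqU, hq⟩ := hU0.inter_nhds_nonempty hW'
  have := hpc.joinedIn x (mem_of_mem_nhds hW') q hq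
  exact ⟨q, hqU, this.somePath, fun t => hsub (this.somePath_mem t)⟩

theorem lemG [LocallyPathConnectedSpace X] {U0 : Set X} (hU0 : Dense U0) (d : ∀ q, PQ x q)
    (hbase : ∃ V ∈ 𝓝 x, ∀ q ∈ U0, ∀ σ : Path x q, (∀ t, σ t ∈ V) → Eqv H (mk σ) (d q))
    (hloc : ∀ p, ∃ V ∈ 𝓝 p, ∀ q ∈ U0, ∀ q' ∈ U0, ∀ σ : Path q q', (∀ t, σ t ∈ V) →
      Eqv H ((d q).trans (mk σ)) (d q')) (g : PQ x x) : lp g ∈ H := by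
  induction g using Path.Homotopic.Quotient.ind with | _ γ
  let Good : ∀ z : X, PQ x z → Prop := fun z c => ∃ W ∈ 𝓝 z, ∀ q ∈ U0, ∀ σ : Path z q, (∀ t, σ t ∈ W) →
    Eqv H (c.trans (mk σ)) (d q)
  have key : ∀ p, ∃ V ∈ 𝓝 p, ∀ z z', V ∈ 𝓝 z → V ∈ 𝓝 z' → ∀ τ : Path z z', (∀ t, τ t ∈ V) → ∀ c, Good z c →
      Good z' (c.trans (mk τ)) := by
    intro p
    obtain ⟨V, hV, h⟩ := hloc p
    refine ⟨V, hV, fun z z' hz hz' τ hτ c ⟨W, hW, hc⟩ => ⟨V, hz', fun q hq σ hσ => ?_⟩⟩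
    obtain ⟨q0, hq0, σ0, hσ0⟩ := exists_join hU0 (Filter.inter_mem hW hz)
    have h1 := hc q0 hq0 σ0 fun t => (hσ0 t).1
    have h2 := h q0 hq0 q hq (σ0.symm.trans (τ.trans σ)) (by
      intro t
      have : (σ0.symm.trans (τ.trans σ)) t ∈ Set.range (σ0.symm.trans (τ.trans σ)) := ⟨t, rfl⟩
      rw [Path.trans_range, Path.trans_range, Path.symm_range] at this
      rcases this with ⟨u, hu⟩ | ⟨u, hu⟩ | ⟨u, hu⟩
      · rw [← hu]; exact (hσ0 u).2
      · rw [← hu]; exact hτ u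
      · rw [← hu]; exact hσ u)
    have h3 := (h1.mul (mk (σ0.symm.trans (τ.trans σ)))).trans h2
    rw [mk_trans, mk_symm, ← Path.Homotopic.Quotient.trans_assoc,
      cancel_right, mk_trans, ← Path.Homotopic.Quotient.trans_assoc] at h3
    exact h3
  have hP := I_ind (fun t => Good (γ t) (pp γ t)) (by
    intro t
    obtain ⟨V, hV, h⟩ := key (γ t)
    have hV' := eventually_mem_nhds_iff.2 hV
    filter_upwards [subpath_near γ t hV, γ.continuous.continuousAt.eventually hV'] with s hs hs'
    constructor
    · intro hg
      have := h (γ t) (γ s) hV hs' (γ.subpath t s) hs _ hg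
      rwa [pp_step] at this
    · intro hg
      have := h (γ s) (γ t) hs' hV (γ.subpath s t) (by
        intro u; rw [← Path.symm_subpath]; exact hs _) _ hg
      rwa [pp_step] at this) 0 1
  have h0 : Good x (Path.Homotopic.Quotient.refl x) := by
    obtain ⟨V, hV, h⟩ := hbase
    refine ⟨V, hV, fun q hq σ hσ => ?_⟩
    rw [Path.Homotopic.Quotient.refl_trans]
    exact h q hq σ hσ
  have e0 : ∀ z (hz : z = x), Good x (Path.Homotopic.Quotient.refl x) → Good z (mk ((Path.refl x).cast rfl hz)) := by
    intro z hz h; subst hz; exact h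
  have e1 : ∀ z (hz : z = x), Good z (mk (γ.cast rfl hz)) → Good x (mk γ) := by
    intro z hz h; subst hz; exact h
  simp only [pp_zero, pp_one] at hP
  obtain ⟨W, hW, h⟩ := e1 _ γ.target (hP (e0 _ γ.source h0))
  obtain ⟨V, hV, h'⟩ := hbase
  obtain ⟨q0, hq0, σ0, hσ0⟩ := exists_join hU0 (Filter.inter_mem hW hV)
  have h1 := (h q0 hq0 σ0 fun t => (hσ0 t).1).trans (h' q0 hq0 σ0 fun t => (hσ0 t).2).symm
  rw [← Path.Homotopic.Quotient.refl_trans (mk σ0), ← Path.Homotopic.Quotient.trans_assoc, eqv_mul, Path.Homotopic.Quotient.trans_refl, eqv_refl_iff] at h1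
  exact h1

theorem path_rel {y z : X} (γ : Path y z) (P : ∀ w, PQ x w → Prop)
    (hP : ∀ t, ∀ᶠ s in 𝓝 t, ∀ c c' , P (γ t) c → P (γ s) c' → (Eqv H (c.trans (mk (γ.subpath t s))) c'))
    (hex : ∀ t, ∃ c, P (γ t) c) {c : PQ x y} {c' : PQ x z} (hc : P y c) (hc' : P z c') :
    Eqv H (c.trans (mk γ)) c' := by
  obtain ⟨⟨g, hg⟩, h0, h1⟩ := γ
  subst h0 h1
  set γ : Path (g 0) (g 1) := ⟨⟨g, hg⟩, rfl, rfl⟩ with hγ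
  have := I_ind (fun t => ∀ c', P (γ t) c' → Eqv H (c.trans (mk (γ.subpath 0 t))) c') (by
    intro t
    have hst : ∀ s, mk (γ.subpath 0 s) = (mk (γ.subpath 0 t)).trans (mk (γ.subpath t s)) := fun s =>
      (Path.Homotopic.Quotient.eq.2 ⟨Path.Homotopy.subpathTransSubpath _ 0 t s⟩).symm
    filter_upwards [hP t] with s hs
    constructor
    · intro h c1 hc1
      obtain ⟨c2, hc2⟩ := hex t
      have := ((h c2 hc2).mul (mk (γ.subpath t s))).trans (hs c2 c1 hc2 hc1)
      rw [Path.Homotopic.Quotient.trans_assoc] at this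
      rw [hst]; exact this
    · intro h c1 hc1
      obtain ⟨c2, hc2⟩ := hex s
      have := (h c2 hc2).trans (hs c1 c2 hc1 hc2).symm
      rw [hst, ← Path.Homotopic.Quotient.trans_assoc, eqv_mul] at this
      exact this) 0 1 (by
    intro c1 hc1
    -- base
    obtain h := (hP 0).self_of_nhds c c1 hc hc1
    exact h) c' hc'
  have e : γ.subpath 0 1 = γ := by rw [Path.subpath_zero_one]; rfl
  rw [e] at this
  exact this

end framework

section helpers
variable {X : Type*} [TopologicalSpace X]

theorem square (h : 𝕀 × 𝕀 → X) (hc : Continuous h) {a b c d : X} (p : Path a b) (q : Path b d) (r : Path a c) (s : Path c d)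
    (hp : ∀ t, p t = h (t, 0)) (hq : ∀ t, q t = h (1, t)) (hr : ∀ t, r t = h (0, t)) (hs : ∀ t, s t = h (t, 1)) :
    (mk p).trans (mk q) = (mk r).trans (mk s) := by
  have ha : a = h (0, 0) := by rw [← hp]; simp
  have hb : b = h (1, 0) := by rw [← hp]; simp
  have hc' : c = h (0, 1) := by rw [← hr]; simp
  have hd : d = h (1, 1) := by rw [← hq]; simp
  subst ha hb hc' hd
  let P : Path ((0, 0) : 𝕀 × 𝕀) (1, 0) := ⟨⟨fun t => (t, 0), by fun_prop⟩, rfl, rfl⟩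
  let Q : Path ((1, 0) : 𝕀 × 𝕀) (1, 1) := ⟨⟨fun t => (1, t), by fun_prop⟩, rfl, rfl⟩
  let R : Path ((0, 0) : 𝕀 × 𝕀) (0, 1) := ⟨⟨fun t => (0, t), by fun_prop⟩, rfl, rfl⟩
  let S : Path ((0, 1) : 𝕀 × 𝕀) (1, 1) := ⟨⟨fun t => (t, 1), by fun_prop⟩, rfl, rfl⟩
  have e1 : p = P.map hc := by ext t; exact hp t
  have e2 : q = Q.map hc := by ext t; exact hq t
  have e3 : r = R.map hc := by ext t; exact hr t
  have e4 : s = S.map hc := by ext t; exact hs t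
  have : ContractibleSpace 𝕀 := (convex_Icc (0:ℝ) 1).contractibleSpace ⟨0, by simp⟩
  rw [e1, e2, e3, e4, ← mk_trans, ← mk_trans, ← Path.map_trans, ← Path.map_trans]
  apply Path.Homotopic.Quotient.eq.2
  exact (SimplyConnectedSpace.paths_homotopic (P.trans Q) (R.trans S)).map ⟨h, hc⟩

theorem hom_fix (h : 𝕀 × 𝕀 → X) (hc : Continuous h) {a b : X} (p q : Path a b)
    (hp : ∀ t, p t = h (t, 0)) (hq : ∀ t, q t = h (t, 1)) (h0 : ∀ t, h (0, t) = a) (h1 : ∀ t, h (1, t) = b) :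
    mk p = mk q := by
  have := square h hc p (Path.refl b) (Path.refl a) q hp (fun t => (h1 t).symm) (fun t => (h0 t).symm) hq
  have e : ∀ z : X, mk (Path.refl z) = Path.Homotopic.Quotient.refl z := fun _ => rfl
  rwa [e, e, Path.Homotopic.Quotient.trans_refl, Path.Homotopic.Quotient.refl_trans] at this

/-- lift of a path into a subtype -/
def lft {E : Type*} [TopologicalSpace E] {S : Set E} {x y : S} (γ : Path (x : E) (y : E)) (h : ∀ t, γ t ∈ S) : Path x y :=
  ⟨⟨fun t => ⟨γ t, h t⟩, by fun_prop⟩, Subtype.ext γ.source, Subtype.ext γ.target⟩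

@[simp] theorem lft_coe {E : Type*} [TopologicalSpace E] {S : Set E} {x y : S} (γ : Path (x : E) (y : E)) (h : ∀ t, γ t ∈ S) (t : 𝕀) :
   ((lft γ h t : S) : E) = γ t := rfl

theorem sc_hom {V : Set X} [SimplyConnectedSpace V] {x y : X} (p q : Path x y) (hp : ∀ t, p t ∈ V) (hq : ∀ t, q t ∈ V) :
    mk p = mk q := by
  have hx : x ∈ V := by simpa using hp 0
  have hy : y ∈ V := by simpa using hp 1
  have := SimplyConnectedSpace.paths_homotopic (lft (x := ⟨x, hx⟩) (y := ⟨y, hy⟩) p hp) (lft (x := ⟨x, hx⟩) (y := ⟨y, hy⟩) q hq)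
  exact Path.Homotopic.Quotient.eq.2 (this.map ⟨Subtype.val, continuous_subtype_val⟩)

theorem sc_hom' {S V : Set X} [SimplyConnectedSpace V] (hVS : V ⊆ S) {x y : S} (p q : Path x y)
    (hp : ∀ t, (p t : X) ∈ V) (hq : ∀ t, (q t : X) ∈ V) : mk p = mk q := by
  have hx : (x : X) ∈ V := by simpa using hp 0
  have hy : (y : X) ∈ V := by simpa using hp 1
  have := SimplyConnectedSpace.paths_homotopic (lft (S := V) (x := ⟨(x : X), hx⟩) (y := ⟨(y : X), hy⟩) (p.map continuous_subtype_val) hp)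
    (lft (S := V) (x := ⟨(x : X), hx⟩) (y := ⟨(y : X), hy⟩) (q.map continuous_subtype_val) hq)
  exact Path.Homotopic.Quotient.eq.2 (this.map ⟨Set.inclusion hVS, continuous_inclusion hVS⟩)

theorem trans_mem {x y z : X} (p : Path x y) (q : Path y z) {V : Set X} (hp : ∀ t, p t ∈ V) (hq : ∀ t, q t ∈ V) (t : 𝕀) :
    p.trans q t ∈ V := by
  have : p.trans q t ∈ Set.range (p.trans q) := ⟨t, rfl⟩
  rw [Path.trans_range] at this
  rcases this with ⟨u, hu⟩ | ⟨u, hu⟩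
  · rw [← hu]; exact hp u
  · rw [← hu]; exact hq u

variable {E : Type*} [NormedAddCommGroup E] [NormedSpace ℝ E] {S : Set E}

theorem sc_convex {V : Set E} (h : Convex ℝ V) (hne : V.Nonempty) : SimplyConnectedSpace V := by
  have := h.contractibleSpace hne
  infer_instance

theorem sc_star {V : Set E} {x : E} (h : StarConvex ℝ x V) (hne : V.Nonempty) : SimplyConnectedSpace V := by
  have := h.contractibleSpace hne
  infer_instance

theorem seg_mem {V : Set E} (h : Convex ℝ V) {a b : E} (ha : a ∈ V) (hb : b ∈ V) (t : 𝕀) : Path.segment a b t ∈ V := by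
  have : Path.segment a b t ∈ Set.range (Path.segment a b) := ⟨t, rfl⟩
  rw [Path.range_segment] at this
  exact h.segment_subset ha hb this

theorem seg_mem_star {V : Set E} {a b : E} (h : StarConvex ℝ a V) (hb : b ∈ V) (t : 𝕀) : Path.segment a b t ∈ V := by
  have : Path.segment a b t ∈ Set.range (Path.segment a b) := ⟨t, rfl⟩
  rw [Path.range_segment] at this
  exact h.segment_subset hb this

theorem seg_apply (a b : E) (t : 𝕀) : Path.segment a b t = (1 - (t:ℝ)) • a + (t:ℝ) • b := by
  rw [Path.segment_apply, AffineMap.lineMap_apply_module]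

end helpers

section cover

/-- base -/
def D : Set ℂ := {z | z ∉ ({4, 4 * Complex.I} : Set ℂ)}

/-- slits -/
def R : Set ℂ := {z | (4 ≤ z.re ∧ z.im = 0) ∨ (z.re = 0 ∧ 4 ≤ z.im)}

theorem isClosed_R : IsClosed R := by
  apply IsClosed.union
  · exact (isClosed_le continuous_const Complex.continuous_re).inter (isClosed_eq Complex.continuous_im continuous_const)
  · exact (isClosed_eq Complex.continuous_re continuous_const).inter (isClosed_le continuous_const Complex.continuous_im)

/-- the fibre -/
def Fib : Type := FreeGroup (Fin 2)
instance : Group Fib := inferInstanceAs (Group (FreeGroup (Fin 2)))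
instance : TopologicalSpace Fib := ⊥
instance : DiscreteTopology Fib := ⟨rfl⟩

noncomputable def gg (i : Fin 2) : Fib := FreeGroup.of i

noncomputable def cc : Fin 3 → D → Fib
  | 0, _ => 1
  | 1, z => if (z : ℂ).im < 0 then gg 0 else 1
  | 2, z => if (z : ℂ).re < 0 then gg 1 else 1

def bs : Fin 3 → Set D
  | 0 => {z | (z : ℂ) ∉ R}
  | 1 => {z | 4 < (z : ℂ).re}
  | 2 => {z | 4 < (z : ℂ).im}

theorem cc1 : ContinuousOn (cc 1) (bs 0 ∩ bs 1) := by
  intro z hz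
  apply ContinuousAt.continuousWithinAt
  have h0 : (z : ℂ).im ≠ 0 := fun h => hz.1 (Or.inl ⟨le_of_lt hz.2, h⟩)
  have hc : Continuous (fun z : D => (z : ℂ).im) := Complex.continuous_im.comp continuous_subtype_val
  rcases lt_or_gt_of_ne h0 with h | h
  · apply ContinuousAt.congr (f := fun _ => gg 0) continuousAt_const
    filter_upwards [hc.continuousAt.eventually_lt continuousAt_const h] with w hw
    simp [cc, hw]
  · apply ContinuousAt.congr (f := fun _ => 1) continuousAt_const
    filter_upwards [continuousAt_const.eventually_lt hc.continuousAt h] with w hw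
    simp [cc, not_lt.2 (le_of_lt hw)]

theorem cc2 : ContinuousOn (cc 2) (bs 0 ∩ bs 2) := by
  intro z hz
  apply ContinuousAt.continuousWithinAt
  have h0 : (z : ℂ).re ≠ 0 := fun h => hz.1 (Or.inr ⟨h, le_of_lt hz.2⟩)
  have hc : Continuous (fun z : D => (z : ℂ).re) := Complex.continuous_re.comp continuous_subtype_val
  rcases lt_or_gt_of_ne h0 with h | h
  · apply ContinuousAt.congr (f := fun _ => gg 1) continuousAt_const
    filter_upwards [hc.continuousAt.eventually_lt continuousAt_const h] with w hw
    simp [cc, hw]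
  · apply ContinuousAt.congr (f := fun _ => 1) continuousAt_const
    filter_upwards [continuousAt_const.eventually_lt hc.continuousAt h] with w hw
    simp [cc, not_lt.2 (le_of_lt hw)]

theorem cinv {X : Type*} [TopologicalSpace X] {s : Set X} {h : X → Fib} (hh : ContinuousOn h s) : ContinuousOn (fun x => (h x)⁻¹) s :=
  (continuous_of_discreteTopology (f := fun w : Fib => w⁻¹)).comp_continuousOn hh

theorem cK (i j : Fin 3) : ContinuousOn (fun z => cc j z * (cc i z)⁻¹) (bs i ∩ bs j) := by
  have c12 : ∀ z ∈ bs 1 ∩ bs 2, cc 1 z = 1 ∧ cc 2 z = 1 := by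
    intro z hz
    have h1 : 4 < (z : ℂ).re := hz.1
    have h2 : 4 < (z : ℂ).im := hz.2
    constructor
    · simp only [cc]; rw [if_neg]; linarith
    · simp only [cc]; rw [if_neg]; linarith
  have same : ∀ i, ContinuousOn (fun z => cc i z * (cc i z)⁻¹) (bs i ∩ bs i) := by
    intro i; simp only [mul_inv_cancel]; exact continuousOn_const
  have e0 : ∀ z, cc 0 z = 1 := fun _ => rfl
  fin_cases i <;> fin_cases j
  · exact same 0
  · simpa [e0] using cc1
  · simpa [e0] using cc2
  · simp only [Fin.mk_one, Fin.zero_eta, e0, one_mul]; rw [Set.inter_comm]; exact cinv cc1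
  · exact same 1
  · refine (continuousOn_const (c := (1 : Fib))).congr fun z hz => ?_
    show cc 2 z * (cc 1 z)⁻¹ = 1
    rw [(c12 z hz).1, (c12 z hz).2]; simp
  · simp only [Fin.zero_eta, e0, one_mul]; rw [Set.inter_comm]; exact cinv cc2
  · refine (continuousOn_const (c := (1 : Fib))).congr fun z hz => ?_
    show cc 1 z * (cc 2 z)⁻¹ = 1
    rw [Set.inter_comm] at hz
    rw [(c12 z hz).1, (c12 z hz).2]; simp
  · exact same 2

theorem cover_D (z : D) : ∃ i, z ∈ bs i := by
  by_cases h : (z : ℂ) ∈ R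
  · rcases h with ⟨h1, h2⟩ | ⟨h1, h2⟩
    · refine ⟨1, lt_of_le_of_ne h1 fun h3 => z.2 (Or.inl ?_)⟩
      apply Complex.ext <;> simp [← h3, h2]
    · refine ⟨2, lt_of_le_of_ne h2 fun h3 => z.2 (Or.inr ?_)⟩
      apply Complex.ext <;> simp [← h3, h1]
  · exact ⟨0, h⟩

theorem isOpen_bs (i : Fin 3) : IsOpen (bs i) := by
  fin_cases i
  · exact isClosed_R.isOpen_compl.preimage continuous_subtype_val
  · exact isOpen_lt continuous_const (Complex.continuous_re.comp continuous_subtype_val)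
  · exact isOpen_lt continuous_const (Complex.continuous_im.comp continuous_subtype_val)

noncomputable def core : FiberBundleCore (Fin 3) D Fib where
  baseSet := bs
  isOpen_baseSet := isOpen_bs
  indexAt z := (cover_D z).choose
  mem_baseSet_at z := (cover_D z).choose_spec
  coordChange i j z w := cc j z * (cc i z)⁻¹ * w
  coordChange_self i z _ v := by simp
  continuousOn_coordChange i j := by
    have h1 : ContinuousOn (fun p : D × Fib => ((cc j p.1 * (cc i p.1)⁻¹, p.2) : Fib × Fib)) ((bs i ∩ bs j) ×ˢ Set.univ) := by
      apply ContinuousOn.prodMk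
      · exact (cK i j).comp continuousOn_fst (fun p hp => hp.1)
      · exact continuousOn_snd
    exact (continuous_of_discreteTopology (f := fun w : Fib × Fib => w.1 * w.2)).comp_continuousOn h1
  coordChange_comp i j k z _ v := by group

noncomputable def pr : core.TotalSpace → D := core.proj

theorem cov : IsCoveringMap pr := IsFiberBundle.isCoveringMap (F := Fib) fun x =>
  ⟨core.localTriv (core.indexAt x), core.mem_baseSet_at x⟩

/-- point of the fibre over z with coordinate w in chart i -/
noncomputable def pt (i : Fin 3) (z : D) (w : Fib) : pr ⁻¹' {z} :=
  ⟨(core.localTriv i).toPartialEquiv.symm (z, w), rfl⟩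

theorem pt_change (i j : Fin 3) (z : D) (w : Fib) : pt i z w = pt j z (cc j z * (cc i z)⁻¹ * w) := by
  apply Subtype.ext
  have : ∀ i w, ((pt i z w : pr ⁻¹' {z}) : core.TotalSpace) = ⟨z, cc (core.indexAt z) z * (cc i z)⁻¹ * w⟩ := fun _ _ => rfl
  rw [this, this]
  have h2 : (cc (core.indexAt z) z * (cc i z)⁻¹ * w : Fib) = cc (core.indexAt z) z * (cc j z)⁻¹ * (cc j z * (cc i z)⁻¹ * w) := by
    group
  exact congrArg (fun v : Fib => (⟨z, v⟩ : core.TotalSpace)) h2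

theorem pt_inj (i : Fin 3) (z : D) : Function.Injective (pt i z) := by
  intro w w' h
  have h1 := congrArg Subtype.val h
  have : ∀ i w, ((pt i z w : pr ⁻¹' {z}) : core.TotalSpace) = ⟨z, cc (core.indexAt z) z * (cc i z)⁻¹ * w⟩ := fun _ _ => rfl
  rw [this, this] at h1
  have h2 : cc (core.indexAt z) z * (cc i z)⁻¹ * w = cc (core.indexAt z) z * (cc i z)⁻¹ * w' := by
    injection h1
  exact mul_left_cancel h2

theorem mono_chart (i : Fin 3) {x y : D} (γ : Path x y) (h : ∀ t, γ t ∈ bs i) (w : Fib) :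
    cov.monodromy (mk γ) (pt i x w) = pt i y w := by
  let g : 𝕀 → core.TotalSpace := fun t => (core.localTriv i).toPartialEquiv.symm (γ t, w)
  have hg : Continuous g := by
    have h1 := (core.localTriv i).continuousOn_invFun
    have := h1.comp_continuous (f := fun t : 𝕀 => (γ t, w)) (by fun_prop) (by
      intro t
      exact ⟨h t, trivial⟩)
    exact this
  apply Subtype.ext
  let Γ : C(𝕀, core.TotalSpace) := ⟨g, hg⟩
  have e1 := (cov.eq_liftPath_iff' (γ := (γ : C(𝕀, D))) (e := (pt i x w : core.TotalSpace)) (γ_0 := by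
    rw [(pt i x w).2]; exact γ.source) (Γ := Γ)).2 ⟨rfl, by
      show (core.localTriv i).toPartialEquiv.symm (γ 0, w) = (core.localTriv i).toPartialEquiv.symm (x, w)
      rw [γ.source]⟩
  have e2 : Γ 1 = (pt i y w : core.TotalSpace) := by
    show (core.localTriv i).toPartialEquiv.symm (γ 1, w) = (core.localTriv i).toPartialEquiv.symm (y, w)
    rw [γ.target]
  rw [← e2, e1]
  rfl

end cover

section loops

noncomputable def kv (ε : ℝ) : ℂ := ⟨1 + ε, (1 + ε) * ε⟩
noncomputable def kw (ε : ℝ) : ℂ := ⟨1 + ε, -((1 + ε) * ε)⟩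

noncomputable def kap (ε : ℝ) : Path (0 : ℂ) 0 :=
  ((Path.segment 0 (kv ε)).trans (Path.segment (kv ε) (kw ε))).trans (Path.segment (kw ε) 0)

def o : UU := ⟨(0, 0), by
  show f (0, 0) ∉ _
  simp [f]⟩

theorem f_cont : Continuous f := by unfold f; fun_prop

theorem kap_cases (ε : ℝ) (t : 𝕀) : (∃ s, kap ε t = Path.segment 0 (kv ε) s) ∨ (∃ s, kap ε t = Path.segment (kv ε) (kw ε) s) ∨
    (∃ s, kap ε t = Path.segment (kw ε) 0 s) := by
  have : kap ε t ∈ Set.range (kap ε) := ⟨t, rfl⟩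
  unfold kap at *
  rw [Path.trans_range, Path.trans_range] at this
  rcases this with (⟨u, hu⟩ | ⟨u, hu⟩) | ⟨u, hu⟩
  · exact Or.inl ⟨u, hu.symm⟩
  · exact Or.inr (Or.inl ⟨u, hu.symm⟩)
  · exact Or.inr (Or.inr ⟨u, hu.symm⟩)

theorem kap_surj (ε : ℝ) : (∀ s, ∃ t, kap ε t = Path.segment 0 (kv ε) s) ∧ (∀ s, ∃ t, kap ε t = Path.segment (kv ε) (kw ε) s) ∧
    (∀ s, ∃ t, kap ε t = Path.segment (kw ε) 0 s) := by
  have : Set.range (kap ε) = (Set.range (Path.segment 0 (kv ε)) ∪ Set.range (Path.segment (kv ε) (kw ε))) ∪ Set.range (Path.segment (kw ε) 0) := by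
    unfold kap
    rw [Path.trans_range, Path.trans_range]
  refine ⟨fun s => ?_, fun s => ?_, fun s => ?_⟩
  · have h : Path.segment 0 (kv ε) s ∈ Set.range (kap ε) := by rw [this]; exact Or.inl (Or.inl ⟨s, rfl⟩)
    exact h
  · have h : Path.segment (kv ε) (kw ε) s ∈ Set.range (kap ε) := by rw [this]; exact Or.inl (Or.inr ⟨s, rfl⟩)
    exact h
  · have h : Path.segment (kw ε) 0 s ∈ Set.range (kap ε) := by rw [this]; exact (Or.inr ⟨s, rfl⟩)
    exact h

/-- the loop attached to a point -/
noncomputable def kl (ε : ℝ) (p : ℂ × ℂ) (h : ∀ t, kap ε t • p ∈ UU) : Path o o :=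
  ⟨⟨fun t => ⟨kap ε t • p, h t⟩, by fun_prop⟩, Subtype.ext (by simp [o]; rfl), Subtype.ext (by simp [o]; rfl)⟩

theorem lft_trans {E : Type*} [TopologicalSpace E] {S : Set E} {x y z : S} (p : Path (x : E) y) (q : Path (y : E) z)
    (h : ∀ t, p.trans q t ∈ S) (hp : ∀ t, p t ∈ S) (hq : ∀ t, q t ∈ S) : lft (p.trans q) h = (lft p hp).trans (lft q hq) := by
  ext t
  rw [lft_coe, Path.trans_apply, Path.trans_apply]
  split_ifs <;> rfl

theorem decomp {E S : Type*} [TopologicalSpace E] [TopologicalSpace S] {v : S → E} (hv : IsEmbedding v) (ε : ℝ) (φ : ℂ → E) (hφ : Continuous φ)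
    (hD : ∀ t, φ (kap ε t) ∈ Set.range v)
    {o' : S} (γ : Path o' o') (hγ : ∀ t, v (γ t) = φ (kap ε t)) :
    ∃ (x y : S) (p1 : Path o' x) (p2 : Path x y) (p3 : Path y o'), v x = φ (kv ε) ∧ v y = φ (kw ε) ∧
      (∀ t, v (p1 t) = φ (Path.segment 0 (kv ε) t)) ∧
      (∀ t, v (p2 t) = φ (Path.segment (kv ε) (kw ε) t)) ∧
      (∀ t, v (p3 t) = φ (Path.segment (kw ε) 0 t)) ∧ γ = (p1.trans p2).trans p3 := by
  obtain ⟨s1, s2, s3⟩ := kap_surj ε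
  have h1 : ∀ s, φ (Path.segment 0 (kv ε) s) ∈ Set.range v := fun s => by
    obtain ⟨t, ht⟩ := s1 s; rw [← ht]; exact hD t
  have h2 : ∀ s, φ (Path.segment (kv ε) (kw ε) s) ∈ Set.range v := fun s => by
    obtain ⟨t, ht⟩ := s2 s; rw [← ht]; exact hD t
  have h3 : ∀ s, φ (Path.segment (kw ε) 0 s) ∈ Set.range v := fun s => by
    obtain ⟨t, ht⟩ := s3 s; rw [← ht]; exact hD t
  have ho : v o' = φ 0 := by rw [← (kap ε).source, ← hγ 0, γ.source]
  choose g1 hg1 using h1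
  choose g2 hg2 using h2
  choose g3 hg3 using h3
  have i := hv.injective
  have c1 : Continuous g1 := by
    rw [hv.continuous_iff]
    have : v ∘ g1 = fun s => φ (Path.segment 0 (kv ε) s) := funext hg1
    rw [this]; fun_prop
  have c2 : Continuous g2 := by
    rw [hv.continuous_iff]
    have : v ∘ g2 = fun s => φ (Path.segment (kv ε) (kw ε) s) := funext hg2
    rw [this]; fun_prop
  have c3 : Continuous g3 := by
    rw [hv.continuous_iff]
    have : v ∘ g3 = fun s => φ (Path.segment (kw ε) 0 s) := funext hg3
    rw [this]; fun_prop
  refine ⟨g1 1, g2 1, ⟨⟨g1, c1⟩, ?_, rfl⟩, ⟨⟨g2, c2⟩, ?_, rfl⟩, ⟨⟨g3, c3⟩, ?_, ?_⟩, ?_, ?_, hg1, hg2, hg3, ?_⟩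
  · apply i; rw [ho]; show v (g1 0) = _; rw [hg1, Path.source]
  · apply i; show v (g2 0) = _; rw [hg2, hg1, Path.source, Path.target]
  · apply i; show v (g3 0) = _; rw [hg3, hg2, Path.source, Path.target]
  · apply i; show v (g3 1) = _; rw [ho, hg3, Path.target]
  · rw [hg1, Path.target]
  · rw [hg2, Path.target]
  · ext t
    apply i
    rw [hγ, kap, Path.trans_apply, Path.trans_apply]
    split_ifs with h
    · rw [Path.trans_apply, Path.trans_apply]
      split_ifs with h'
      · exact (hg1 _).symm
      · exact (hg2 _).symm
    · exact (hg3 _).symm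

theorem pow6 (x y : ℝ) : ((⟨x, y⟩ : ℂ) ^ 6).re = x ^ 6 - 15 * x ^ 4 * y ^ 2 + 15 * x ^ 2 * y ^ 4 - y ^ 6 ∧
    ((⟨x, y⟩ : ℂ) ^ 6).im = 6 * x ^ 5 * y - 20 * x ^ 3 * y ^ 3 + 6 * x * y ^ 5 := by
  have h : ∀ a : ℂ, a ^ 6 = a * a * a * a * a * a := fun a => by ring
  rw [h]
  simp only [Complex.mul_re, Complex.mul_im]
  constructor <;> ring

theorem wedge {z : ℂ} (h : |z.im| < 0.1 * z.re) : 0 < (z ^ 6).re ∧ (0 < z.im → 0 < (z ^ 6).im) ∧ (z.im < 0 → (z ^ 6).im < 0) := by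
  obtain ⟨x, y⟩ := z
  simp only at h
  obtain ⟨e1, e2⟩ := pow6 x y
  rw [e1, e2]
  have hx : 0 < x := by have := abs_nonneg y; linarith
  have hy2 : y ^ 2 < 0.01 * x ^ 2 := by
    have := sq_lt_sq' (by have := abs_nonneg y; linarith : -(0.1 * x) < |y|) h
    rw [sq_abs] at this; nlinarith
  have hx4 : 0 < x ^ 4 := by positivity
  have hpos : 0 < 6 * x ^ 5 - 20 * x ^ 3 * y ^ 2 + 6 * x * y ^ 4 := by
    have : 0 < x ^ 3 * (6 * x ^ 2 - 20 * y ^ 2) := by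
      apply mul_pos (by positivity); nlinarith
    have h3 : 0 ≤ 6 * x * y ^ 4 := by positivity
    nlinarith
  refine ⟨?_, ?_, ?_⟩
  · have h1 : 0 < x ^ 4 * (x ^ 2 - 15 * y ^ 2) := mul_pos hx4 (by nlinarith)
    have h2 : 0 ≤ y ^ 4 * (15 * x ^ 2 - y ^ 2) := mul_nonneg (by positivity) (by nlinarith)
    nlinarith
  · intro hy
    have := mul_pos hy hpos
    nlinarith
  · intro hy
    have := mul_neg_of_neg_of_pos hy hpos
    nlinarith

theorem edge {ε δ : ℝ} (h0 : 0 < ε) (h1 : ε < 0.01) (hδ : |δ| ≤ (1 + ε) * ε) : 1 < ((⟨1 + ε, δ⟩ : ℂ) ^ 6).re := by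
  rw [(pow6 _ _).1]
  set x := 1 + ε with hx
  have hy2 : δ ^ 2 ≤ x ^ 2 * ε ^ 2 := by
    have := sq_le_sq' (by have := abs_nonneg δ; nlinarith : -(x * ε) ≤ |δ|) hδ
    rw [sq_abs] at this; nlinarith
  have hx1 : 1 < x := by linarith
  have h3 : δ ^ 2 ≤ 0.01 * x ^ 2 * ε := by nlinarith [sq_nonneg x]
  have h4 : 0 ≤ δ ^ 4 * (15 * x ^ 2 - δ ^ 2) := mul_nonneg (by positivity) (by nlinarith)
  have h5 : 0 < x ^ 4 := by positivity
  have h6 : 0 ≤ x ^ 4 * (0.01 * x ^ 2 * ε - δ ^ 2) := mul_nonneg h5.le (by linarith)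
  have h7 : 1 ≤ x ^ 4 := one_le_pow₀ hx1.le
  have h8 : 1 < x ^ 6 * (1 - 0.15 * ε) := by
    have : x ^ 6 = x ^ 4 * x ^ 2 := by ring
    have h9 : 1 < x ^ 2 * (1 - 0.15 * ε) := by rw [hx]; nlinarith
    rw [this, mul_assoc]
    nlinarith
  nlinarith

theorem seg1 {ε : ℝ} (h0 : 0 < ε) (h1 : ε < 0.01) (s : 𝕀) :
    Path.segment 0 (kv ε) s = 0 ∨ (|(Path.segment 0 (kv ε) s).im| < 0.1 * (Path.segment 0 (kv ε) s).re ∧ 0 < (Path.segment 0 (kv ε) s).im) := by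
  by_cases h : (s : ℝ) = 0
  · left; rw [seg_apply, h]; simp
  · right
    have hs : 0 < (s : ℝ) := lt_of_le_of_ne s.2.1 (Ne.symm h)
    rw [seg_apply]
    simp only [kv, smul_zero, zero_add, Complex.real_smul, Complex.mul_re, Complex.ofReal_re, Complex.ofReal_im, zero_mul, sub_zero, Complex.mul_im, add_zero]
    have : 0 < s * ((1 + ε) * ε) := by positivity
    rw [abs_of_pos this]
    refine ⟨?_, this⟩
    have h2 : 0 < s * ((1 + ε)) := by positivity
    nlinarith

theorem seg3 {ε : ℝ} (h0 : 0 < ε) (h1 : ε < 0.01) (s : 𝕀) :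
    Path.segment (kw ε) 0 s = 0 ∨ (|(Path.segment (kw ε) 0 s).im| < 0.1 * (Path.segment (kw ε) 0 s).re ∧ (Path.segment (kw ε) 0 s).im < 0) := by
  by_cases h : (1 - s : ℝ) = 0
  · left; rw [seg_apply, h]; simp
  · right
    have hs : 0 < (1 - s : ℝ) := lt_of_le_of_ne (by linarith [s.2.2]) (Ne.symm h)
    rw [seg_apply]
    set r : ℝ := 1 - s
    simp only [kw, smul_zero, add_zero, Complex.real_smul, Complex.mul_re, Complex.ofReal_re, Complex.ofReal_im, zero_mul, sub_zero, Complex.mul_im, add_zero]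
    have : 0 < r * ((1 + ε) * ε) := by positivity
    rw [mul_neg, abs_neg, abs_of_pos this]
    refine ⟨?_, by linarith⟩
    have h2 : 0 < r * ((1 + ε)) := by positivity
    nlinarith

theorem seg2 {ε : ℝ} (h0 : 0 < ε) (s : 𝕀) : (Path.segment (kv ε) (kw ε) s).re = 1 + ε ∧ |(Path.segment (kv ε) (kw ε) s).im| ≤ (1 + ε) * ε := by
  rw [seg_apply]
  simp only [kv, kw, Complex.add_re, Complex.add_im, Complex.real_smul, Complex.mul_re, Complex.ofReal_re, Complex.ofReal_im, zero_mul, sub_zero, Complex.mul_im, add_zero]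
  have h1 := s.2.1
  have h2 := s.2.2
  refine ⟨by ring, ?_⟩
  have h3 : 0 < (1 + ε) * ε := by positivity
  rw [abs_le]
  constructor <;> nlinarith

theorem seg2' {ε : ℝ} (h0 : 0 < ε) (h1 : ε < 0.01) (s : 𝕀) : 1 < ((Path.segment (kv ε) (kw ε) s) ^ 6).re := by
  obtain ⟨e1, e2⟩ := seg2 h0 s
  have := edge h0 h1 e2
  rw [← e1] at this
  exact this

end loops

section free

def oD : D := ⟨0, by simp [D]⟩

/-- f as a map U to D -/
noncomputable def fD : C(UU, D) := ⟨fun p => ⟨f p, p.2⟩, by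
  have := f_cont
  fun_prop⟩

theorem fD_o : fD o = oD := Subtype.ext (by simp [fD, oD, o, f])

theorem R4 {z : ℂ} (h : 0 < z.re) (h' : z.im ≠ 0) : 4 * z ∉ R ∧ 4 * Complex.I * z ∉ R := by
  simp only [R, Set.mem_ofPred_eq, Complex.mul_re, Complex.mul_im, Complex.I_re, Complex.I_im, Complex.re_ofNat, Complex.im_ofNat]
  constructor
  · rintro (⟨h1, h2⟩ | ⟨h1, h2⟩)
    · apply h'; linarith
    · linarith
  · rintro (⟨h1, h2⟩ | ⟨h1, h2⟩)
    · linarith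
    · apply h'; linarith

theorem R0 : (0 : ℂ) ∉ R := by simp [R]

theorem mono_kl {ε : ℝ} (h0 : 0 < ε) (h1 : ε < 0.01) {p : ℂ × ℂ} (h : ∀ t, kap ε t • p ∈ UU) {b : ℂ}
    (hb : ∀ z : ℂ, f (z • p) = b * z ^ 6) (hb' : b = 4 ∨ b = 4 * Complex.I) (w : Fib) {γ : Path oD oD}
    (hγ : γ = ((kl ε p h).map fD.continuous).cast fD_o.symm fD_o.symm) :
    cov.monodromy (mk γ) (pt 0 oD w) = pt 0 oD ((if b = 4 then (gg 0)⁻¹ else gg 1) * w) := by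
  have hh : ∀ t, (γ t : ℂ) = f (kap ε t • p) := by intro t; rw [hγ]; rfl
  obtain ⟨x, y, p1, p2, p3, hx, hy, e1, e2, e3, e⟩ := decomp (v := (Subtype.val : D → ℂ)) IsEmbedding.subtypeVal ε (fun z => f (z • p))
    (f_cont.comp (by fun_prop)) (fun t => ⟨⟨_, h t⟩, rfl⟩) γ hh
  simp only [hb] at hx hy e1 e2 e3
  have b1 : ∀ t, p1 t ∈ bs 0 := by
    intro t
    show (p1 t : ℂ) ∉ R
    rw [e1]
    rcases seg1 h0 h1 t with h | ⟨h, h'⟩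
    · rw [h]; simpa using R0
    · obtain ⟨w1, w2, _⟩ := wedge h
      rcases hb' with rfl | rfl
      · exact (R4 w1 (w2 h').ne').1
      · exact (R4 w1 (w2 h').ne').2
  have b3 : ∀ t, p3 t ∈ bs 0 := by
    intro t
    show (p3 t : ℂ) ∉ R
    rw [e3]
    rcases seg3 h0 h1 t with h | ⟨h, h'⟩
    · rw [h]; simpa using R0
    · obtain ⟨w1, _, w2⟩ := wedge h
      rcases hb' with rfl | rfl
      · exact (R4 w1 (w2 h').ne).1
      · exact (R4 w1 (w2 h').ne).2
  have hv : 0 < (kv ε ^ 6).im := by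
    have : |(kv ε).im| < 0.1 * (kv ε).re := by
      simp only [kv]; rw [abs_of_pos (by positivity)]; nlinarith
    exact (wedge this).2.1 (by simp only [kv]; positivity)
  have hw : (kw ε ^ 6).im < 0 := by
    have : |(kw ε).im| < 0.1 * (kw ε).re := by
      simp only [kw]; rw [abs_neg, abs_of_pos (by positivity)]; nlinarith
    exact (wedge this).2.2 (by simp only [kw]; have : 0 < (1 + ε) * ε := by positivity
                               linarith)
  rw [e, mk_trans, mk_trans, cov.monodromy_trans_apply, cov.monodromy_trans_apply, mono_chart 0 p1 b1]
  have c0 : ∀ z, cc 0 z = 1 := fun _ => rfl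
  rcases hb' with rfl | rfl
  · have b2 : ∀ t, p2 t ∈ bs 1 := by
      intro t
      show 4 < (p2 t : ℂ).re
      rw [e2]
      have := seg2' h0 h1 t
      simp only [Complex.mul_re, Complex.re_ofNat, Complex.im_ofNat]
      linarith
    have cx : cc 1 x = 1 := by
      simp only [cc]; rw [if_neg]; rw [hx]
      simp only [Complex.mul_im, Complex.re_ofNat, Complex.im_ofNat]
      linarith
    have cy : cc 1 y = gg 0 := by
      simp only [cc]; rw [if_pos]; rw [hy]
      simp only [Complex.mul_im, Complex.re_ofNat, Complex.im_ofNat]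
      linarith
    rw [pt_change 0 1 x, mono_chart 1 p2 b2, pt_change 1 0 y, mono_chart 0 p3 b3]
    congr 1
    simp [c0, cx, cy]
  · have b2 : ∀ t, p2 t ∈ bs 2 := by
      intro t
      show 4 < (p2 t : ℂ).im
      rw [e2]
      have := seg2' h0 h1 t
      simp only [Complex.mul_re, Complex.mul_im, Complex.I_re, Complex.I_im, Complex.re_ofNat, Complex.im_ofNat]
      linarith
    have cx : cc 2 x = gg 1 := by
      simp only [cc]; rw [if_pos]; rw [hx]
      simp only [Complex.mul_re, Complex.mul_im, Complex.I_re, Complex.I_im, Complex.re_ofNat, Complex.im_ofNat]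
      linarith
    have cy : cc 2 y = 1 := by
      simp only [cc]; rw [if_neg]; rw [hy]
      simp only [Complex.mul_re, Complex.mul_im, Complex.I_re, Complex.I_im, Complex.re_ofNat, Complex.im_ofNat]
      linarith
    rw [pt_change 0 2 x, mono_chart 2 p2 b2, pt_change 2 0 y, mono_chart 0 p3 b3]
    have hne : ¬ (4 * Complex.I = 4) := by
      intro h; have := congrArg Complex.im h; simp at this
    congr 1
    simp [c0, cx, cy, hne]

/-- the action of the fundamental group of U on the fibre -/
noncomputable def act : FundamentalGroup UU o →* Equiv.Perm (pr ⁻¹' {oD}) :=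
  (cov.monodromyPerm oD).comp (FundamentalGroup.mapOfEq fD fD_o)

theorem act_kl {ε : ℝ} (h0 : 0 < ε) (h1 : ε < 0.01) {p : ℂ × ℂ} (h : ∀ t, kap ε t • p ∈ UU) {b : ℂ}
    (hb : ∀ z : ℂ, f (z • p) = b * z ^ 6) (hb' : b = 4 ∨ b = 4 * Complex.I) (w : Fib) :
    act (lp (mk (kl ε p h))) (pt 0 oD w) = pt 0 oD ((if b = 4 then (gg 0)⁻¹ else gg 1) * w) := by
  rw [← mono_kl h0 h1 h hb hb' w rfl]
  unfold act
  rw [MonoidHom.comp_apply, IsCoveringMap.coe_monodromyPerm]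
  congr 1
  rw [FundamentalGroup.mapOfEq_apply]
  rfl

theorem free_of_gen (a b : FundamentalGroup UU o) (ha : ∀ w, act a (pt 0 oD w) = pt 0 oD ((gg 0)⁻¹ * w))
    (hb : ∀ w, act b (pt 0 oD w) = pt 0 oD (gg 1 * w)) (hgen : ∀ g, g ∈ Subgroup.closure {a, b}) :
    Nonempty (FundamentalGroup UU o ≃* FreeGroup (Fin 2)) := by
  let Φ : FreeGroup (Fin 2) →* FundamentalGroup UU o := FreeGroup.lift ![a, b]
  let ψ : FreeGroup (Fin 2) →* Fib := FreeGroup.lift ![(gg 0)⁻¹, gg 1]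
  let ψ' : Fib →* Fib := (FreeGroup.lift ![(gg 0)⁻¹, gg 1] : FreeGroup (Fin 2) →* Fib)
  have hψ : Function.Injective ψ := by
    have this' : ψ'.comp ψ = MonoidHom.id (FreeGroup (Fin 2)) := by
      apply FreeGroup.ext_hom
      intro i
      have g0 : ψ' (gg 0) = (gg 0)⁻¹ := by
        show FreeGroup.lift _ (FreeGroup.of 0) = _
        simp
      have g1 : ψ' (gg 1) = (gg 1) := by
        show FreeGroup.lift _ (FreeGroup.of 1) = _
        simp
      show ψ' (FreeGroup.lift _ (FreeGroup.of i)) = FreeGroup.of i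
      rw [FreeGroup.lift_apply_of]
      fin_cases i
      · show ψ' ((gg 0)⁻¹) = gg 0
        rw [map_inv, g0, inv_inv]
      · exact g1
    intro u v h
    have := congrArg ψ' h
    rw [← MonoidHom.comp_apply, ← MonoidHom.comp_apply] at this
    rw [this'] at this
    exact this
  have key : ∀ u w, act (Φ u) (pt 0 oD w) = pt 0 oD (ψ u * w) := by
    have kg : ∀ i w, act (Φ (FreeGroup.of i)) (pt 0 oD w) = pt 0 oD (ψ (FreeGroup.of i) * w) := by
      intro i w
      simp only [Φ, ψ, FreeGroup.lift_apply_of]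
      fin_cases i
      · exact ha w
      · exact hb w
    intro u
    induction u using FreeGroup.induction_on with
    | C1 => intro w; rw [map_one, map_one, map_one, one_mul]; rfl
    | of i => exact kg i
    | inv_of i _ =>
      intro w
      rw [map_inv, map_inv, map_inv, Equiv.Perm.inv_eq_iff_eq, kg]
      simp
    | mul x y hx hy =>
      intro w
      rw [map_mul, map_mul, map_mul, Equiv.Perm.mul_apply, hy, hx, mul_assoc]
  have hinj : Function.Injective Φ := by
    intro u v h
    have h1 := key u 1
    rw [h, key v 1] at h1
    have := pt_inj _ _ h1
    simp only [mul_one] at this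
    exact (hψ this).symm
  have hsurj : Function.Surjective Φ := by
    intro g
    have h1 : Subgroup.closure {a, b} ≤ Φ.range := by
      rw [Subgroup.closure_le]
      rintro x (rfl | rfl)
      · exact ⟨FreeGroup.of 0, by simp [Φ]⟩
      · exact ⟨FreeGroup.of 1, by simp [Φ]⟩
    exact h1 (hgen g)
  exact ⟨(MulEquiv.ofBijective Φ ⟨hinj, hsurj⟩).symm⟩

end free

section rel

def CM : Set (ℂ × ℂ) := {p | f p = 4 ∧ 0 < (p.1 ^ 6 + p.2 ^ 6).re ∧ 0 ≤ (p.1 ^ 6 + p.2 ^ 6).im}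

noncomputable def om : ℂ := Complex.exp (Real.pi / 12 * Complex.I)

theorem om6 : om ^ 6 = Complex.I := by
  unfold om
  rw [← Complex.exp_nat_mul]
  rw [show ((6 : ℕ) : ℂ) * (Real.pi / 12 * Complex.I) = Real.pi / 2 * Complex.I by push_cast; ring]
  exact Complex.exp_pi_div_two_mul_I

noncomputable def Th (p : ℂ × ℂ) : ℂ × ℂ := (om * conj p.1, om ^ 5 * conj p.2)

theorem Th_cont : Continuous Th := by
  unfold Th
  have := Complex.continuous_conj
  fun_prop

theorem f_Th (k : ℂ) (p : ℂ × ℂ) : f (k • Th p) = Complex.I * conj (f (conj k • p)) := by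
  simp only [f, Th, Prod.smul_mk, smul_eq_mul, map_add, map_mul, map_pow, Complex.conj_conj, Prod.smul_fst, Prod.smul_snd]
  have h30 : (om ^ 5) ^ 6 = Complex.I := by
    rw [← pow_mul, mul_comm, pow_mul, om6]
    have := Complex.I_sq
    calc Complex.I ^ 5 = (Complex.I ^ 2) ^ 2 * Complex.I := by ring
      _ = _ := by rw [this]; ring
  have e : (starRingEnd ℂ) 6 = 6 := Complex.conj_ofNat 6
  rw [e]
  calc _ = om ^ 6 * (k ^ 6 * conj p.1 ^ 6) + (om ^ 5) ^ 6 * (k ^ 6 * conj p.2 ^ 6) + om ^ 6 * (6 * (k * conj p.1) * (k * conj p.2)) := by ring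
    _ = _ := by rw [om6, h30]; ring

theorem Th_mem {k : ℂ} {p : ℂ × ℂ} (h : conj k • p ∈ UU) : k • Th p ∈ UU := by
  have h' : f (conj k • p) ∉ ({4, 4 * Complex.I} : Set ℂ) := h
  show f (k • Th p) ∉ ({4, 4 * Complex.I} : Set ℂ)
  rw [f_Th]
  simp only [Set.mem_insert_iff, Set.mem_singleton_iff, not_or] at h' ⊢
  set w := f (conj k • p)
  constructor
  · intro hh
    apply h'.2
    have h1 := congrArg Complex.re hh
    have h2 := congrArg Complex.im hh
    simp at h1 h2
    apply Complex.ext <;> simp [h1, h2]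
  · intro hh
    apply h'.1
    have h1 := congrArg Complex.re hh
    have h2 := congrArg Complex.im hh
    simp at h1 h2
    apply Complex.ext <;> simp [h1, h2]

theorem f_smul (k : ℂ) {p : ℂ × ℂ} (hp : f p = 4) : f (k • p) = (p.1 ^ 6 + p.2 ^ 6) * k ^ 6 + (4 - (p.1 ^ 6 + p.2 ^ 6)) * k ^ 2 := by
  have : p.1 ^ 6 + p.2 ^ 6 + 6 * p.1 * p.2 = 4 := hp
  simp only [f, Prod.smul_fst, Prod.smul_snd, smul_eq_mul]
  linear_combination (-k ^ 2) * this + 2 * k ^ 2 * this - 2 * k ^ 2 * this + 2 * k ^ 2 * this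

def Kset (ε : ℝ) : Set ℂ := {k | 0 ≤ k.re ∧ k.re ≤ 1 + ε ∧ |k.im| ≤ 2 * ε ∧ k ≠ 1}

theorem kap_K {ε : ℝ} (h0 : 0 < ε) (h1 : ε < 0.01) (t : 𝕀) : kap ε t ∈ Kset ε ∧ conj (kap ε t) ∈ Kset ε := by
  have key : kap ε t ∈ Kset ε := by
    rcases kap_cases ε t with ⟨s, h⟩ | ⟨s, h⟩ | ⟨s, h⟩
    · have hh := h
      rw [seg_apply] at h
      have e1 := congrArg Complex.re h
      have e2 := congrArg Complex.im h
      simp [kv] at e1 e2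
      have s1 := s.2.1
      have s2 := s.2.2
      refine ⟨by rw [e1]; positivity, by rw [e1]; nlinarith, ?_, ?_⟩
      · rw [e2, abs_of_nonneg (by positivity)]
        have : (1 + ε) * ε ≤ 2 * ε := by nlinarith
        nlinarith [mul_nonneg s1 h0.le]
      · intro h3
        rw [h3] at hh
        rcases seg1 h0 h1 s with h4 | ⟨_, h4⟩
        · rw [h4] at hh; simp at hh
        · rw [← hh] at h4; simp at h4
    · obtain ⟨e1, e2⟩ := seg2 h0 s
      rw [← h] at e1 e2
      refine ⟨by linarith, by linarith, by nlinarith, ?_⟩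
      intro h3
      rw [h3] at e1
      simp at e1
      linarith
    · have hh := h
      rw [seg_apply] at h
      have e1 := congrArg Complex.re h
      have e2 := congrArg Complex.im h
      simp [kw] at e1 e2
      have s1 := s.2.1
      have s2 : 0 ≤ 1 - (s : ℝ) := by linarith [s.2.2]
      refine ⟨by rw [e1]; positivity, by rw [e1]; nlinarith, ?_, ?_⟩
      · rw [e2, abs_neg, abs_of_nonneg (by positivity)]
        have : (1 + ε) * ε ≤ 2 * ε := by nlinarith
        nlinarith [mul_nonneg s1 h0.le]
      · intro h3
        rw [h3] at hh
        rcases seg3 h0 h1 s with h4 | ⟨_, h4⟩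
        · rw [h4] at hh; simp at hh
        · rw [← hh] at h4; simp at h4
  refine ⟨key, ?_⟩
  obtain ⟨a, b, c, d⟩ := key
  refine ⟨by simpa using a, by simpa using b, by simpa using c, ?_⟩
  intro h
  apply d
  have := congrArg conj h
  simpa using this

theorem tube {p p' : ℂ × ℂ} (P : Path p p') (hP : ∀ s, P s ∈ CM) :
    ∀ᶠ ε in 𝓝[>] (0 : ℝ), ∀ k ∈ Kset ε, ∀ s, k • P s ∈ UU := by
  let N : Set (ℂ × 𝕀) := {z | ((P z.2).1 ^ 6 + (P z.2).2 ^ 6) * z.1 ^ 4 + ((P z.2).1 ^ 6 + (P z.2).2 ^ 6) * z.1 ^ 2 + 4 ≠ 0 ∧ f (z.1 • P z.2) ≠ 4 * Complex.I}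
  have hN : IsOpen N := by
    apply IsOpen.inter
    · exact isOpen_ne_fun (by fun_prop) (by fun_prop)
    · exact isOpen_ne_fun (f_cont.comp (by fun_prop)) (by fun_prop)
  have hsub : ((fun r : ℝ => (r : ℂ)) '' Set.Icc 0 1) ×ˢ (Set.univ : Set 𝕀) ⊆ N := by
    rintro ⟨_, s⟩ ⟨⟨r, ⟨hr0, hr1⟩, rfl⟩, -⟩
    obtain ⟨h1, h2, h3⟩ := hP s
    set A := (P s).1 ^ 6 + (P s).2 ^ 6 with hA
    constructor
    · intro h
      have := congrArg Complex.re h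
      simp only [← hA, Complex.add_re, Complex.mul_re, Complex.re_ofNat, Complex.zero_re, ← Complex.ofReal_pow, Complex.ofReal_re, Complex.ofReal_im] at this
      have : 0 ≤ A.re * r ^ 4 := by positivity
      have : 0 ≤ A.re * r ^ 2 := by positivity
      linarith
    · intro h
      rw [f_smul _ h1, ← hA] at h
      have := congrArg Complex.im h
      simp only [Complex.add_im, Complex.mul_im, Complex.re_ofNat, Complex.im_ofNat, ← Complex.ofReal_pow, Complex.ofReal_re, Complex.ofReal_im, Complex.I_im, Complex.I_re, Complex.sub_im] at this
      have h6 : r ^ 6 ≤ r ^ 2 := pow_le_pow_of_le_one hr0 hr1 (by norm_num)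
      nlinarith
  obtain ⟨u, v, hu, hv, hu1, hv1, huv⟩ := generalized_tube_lemma
    (isCompact_Icc.image Complex.continuous_ofReal) isCompact_univ hN hsub
  obtain ⟨δ, hδ, hth⟩ := (isCompact_Icc.image Complex.continuous_ofReal).exists_thickening_subset_open hu hu1
  have hmem : Set.Ioo (0:ℝ) (δ / 4) ∈ 𝓝[>] (0 : ℝ) := Ioo_mem_nhdsGT (by positivity)
  filter_upwards [hmem] with ε hε k ⟨k1, k2, k3, k4⟩ s
  have hk : k ∈ u := by
    apply hth
    rw [Metric.mem_thickening_iff]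
    refine ⟨_, ⟨min k.re 1, ⟨le_min k1 zero_le_one, min_le_right _ _⟩, rfl⟩, ?_⟩
    rw [Complex.dist_eq]
    have h1 := Complex.norm_le_abs_re_add_abs_im (k - ((min k.re 1 : ℝ) : ℂ))
    simp only [Complex.sub_re, Complex.sub_im, Complex.ofReal_re, Complex.ofReal_im, sub_zero] at h1
    have h2 : |k.re - min k.re 1| ≤ ε := by
      rw [abs_le]
      rcases min_cases k.re 1 with ⟨h, h'⟩ | ⟨h, h'⟩ <;> rw [h] <;> constructor <;> linarith [hε.1]
    linarith [hε.2, hε.1]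
  obtain ⟨n1, n2⟩ := huv (Set.mk_mem_prod hk (hv1 (Set.mem_univ s)))
  have h1 := (hP s).1
  show f (k • P s) ∉ ({4, 4 * Complex.I} : Set ℂ)
  simp only [Set.mem_insert_iff, Set.mem_singleton_iff, not_or]
  refine ⟨?_, n2⟩
  intro h
  rw [f_smul _ h1] at h
  have h3 : (k - 1) * (k + 1) * (((P s).1 ^ 6 + (P s).2 ^ 6) * k ^ 4 + ((P s).1 ^ 6 + (P s).2 ^ 6) * k ^ 2 + 4) = 0 := by
    linear_combination h
  rcases mul_eq_zero.1 h3 with h4 | h4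
  · rcases mul_eq_zero.1 h4 with h5 | h5
    · exact k4 (sub_eq_zero.1 h5)
    · have := congrArg Complex.re h5
      simp at this
      linarith
  · exact n1 h4

theorem rel {p p' : ℂ × ℂ} (h : JoinedIn CM p p') : ∀ᶠ ε in 𝓝[>] (0 : ℝ),
    ∃ h1 h2 h3 h4, mk (kl ε p h1) = mk (kl ε p' h2) ∧ mk (kl ε (Th p) h3) = mk (kl ε (Th p') h4) := by
  have hmem : Set.Ioo (0:ℝ) 0.01 ∈ 𝓝[>] (0 : ℝ) := Ioo_mem_nhdsGT (by norm_num)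
  filter_upwards [tube h.somePath h.somePath_mem, hmem] with ε hε he
  set P := h.somePath
  have hk := kap_K he.1 he.2
  have m1 : ∀ t s, kap ε t • P s ∈ UU := fun t s => hε _ (hk t).1 s
  have m2 : ∀ t s, kap ε t • Th (P s) ∈ UU := fun t s => Th_mem (hε _ (hk t).2 s)
  have cT := Th_cont
  refine ⟨fun t => by simpa using m1 t 0, fun t => by simpa using m1 t 1, fun t => by simpa using m2 t 0, fun t => by simpa using m2 t 1, ?_, ?_⟩
  · refine hom_fix (fun z : 𝕀 × 𝕀 => (⟨kap ε z.1 • P z.2, m1 _ _⟩ : UU)) ?_ _ _ ?_ ?_ ?_ ?_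
    · apply Continuous.subtype_mk; fun_prop
    · intro t; apply Subtype.ext; simp [kl]
    · intro t; apply Subtype.ext; simp [kl]
    · intro t; apply Subtype.ext; simp [o]; rfl
    · intro t; apply Subtype.ext; simp [o]; rfl
  · refine hom_fix (fun z : 𝕀 × 𝕀 => (⟨kap ε z.1 • Th (P z.2), m2 _ _⟩ : UU)) ?_ _ _ ?_ ?_ ?_ ?_
    · apply Continuous.subtype_mk; fun_prop
    · intro t; apply Subtype.ext; simp [kl]
    · intro t; apply Subtype.ext; simp [kl]
    · intro t; apply Subtype.ext; simp [o]; rfl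
    · intro t; apply Subtype.ext; simp [o]; rfl

end rel

section joins

theorem re_cpow_half (z : ℂ) : 0 ≤ (z ^ (1 / 2 : ℂ)).re := by
  by_cases h : z = 0
  · rw [h, Complex.zero_cpow (by norm_num)]; simp
  · rw [Complex.cpow_def_of_ne_zero h, Complex.exp_re]
    apply mul_nonneg (Real.exp_pos _).le
    have e : (Complex.log z * (1 / 2)).im = Complex.arg z / 2 := by
      rw [show (1 / 2 : ℂ) = ((1 / 2 : ℝ) : ℂ) by push_cast; rfl, Complex.im_mul_ofReal, Complex.log_im]; ring
    rw [e]
    have h1 := Complex.neg_pi_lt_arg z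
    have h2 := Complex.arg_le_pi z
    exact Real.cos_nonneg_of_mem_Icc ⟨by linarith, by linarith⟩

theorem slit_mul {a b : ℂ} (ha : 0 < a.re) (hb : 0 < b.re) : a * b ∈ Complex.slitPlane := by
  rw [Complex.mem_slitPlane_iff]
  by_contra hh
  push Not at hh
  simp only [Complex.mul_re, Complex.mul_im] at hh
  obtain ⟨h1, h2⟩ := hh
  have h3 : a.re * (a.re * b.re - a.im * b.im) ≤ 0 := mul_nonpos_of_nonneg_of_nonpos ha.le h1
  have h4 : 0 < a.re ^ 2 * b.re := by positivity
  have h5 : 0 ≤ a.im ^ 2 * b.re := by positivity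
  have h6 : a.im * (a.re * b.im + a.im * b.re) = 0 := by rw [h2]; ring
  nlinarith

noncomputable def r6 : ℂ := (4 : ℂ) ^ (1 / 6 : ℂ)

theorem pow6_cpow {S : ℂ} : (S ^ (1 / 6 : ℂ)) ^ 6 = S := by
  rw [← Complex.cpow_nat_mul]
  norm_num

theorem joinT (T : ℂ) (hT : 4 * T ^ 6 = (4 - 6 * T) ^ 2) (hre : 0 < (4 - 6 * T).re) (him : T.im ≤ 0) (ξ : ℂ) (hξ : ξ ^ 6 = 1) :
    JoinedIn CM (ξ * r6, 0) (ξ * (2 - 3 * T) ^ (1 / 6 : ℂ), T / (ξ * (2 - 3 * T) ^ (1 / 6 : ℂ))) := by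
  let A : 𝕀 → ℂ := fun s => 4 - 6 * ((s : ℝ) : ℂ) * T
  let E : 𝕀 → ℂ := fun s => 1 - 4 * (((s : ℝ) : ℂ) * T) ^ 6 / (A s) ^ 2
  let S : 𝕀 → ℂ := fun s => A s * (1 / 2 * (1 + (E s) ^ (1 / 2 : ℂ)))
  let x : 𝕀 → ℂ := fun s => ξ * (S s) ^ (1 / 6 : ℂ)
  have hAre : ∀ s, 0 < (A s).re := by
    intro s
    have s1 := s.2.1
    have s2 := s.2.2
    simp only [Complex.sub_re, Complex.mul_re, Complex.re_ofNat, Complex.im_ofNat] at hre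
    simp only [A, Complex.sub_re, Complex.mul_re, Complex.mul_im, Complex.re_ofNat, Complex.im_ofNat, Complex.ofReal_re, Complex.ofReal_im]
    by_cases h : (s : ℝ) = 1
    · rw [h]; linarith
    · have : (s : ℝ) < 1 := lt_of_le_of_ne s2 h
      nlinarith
  have hAim : ∀ s, 0 ≤ (A s).im := by
    intro s
    have s1 := s.2.1
    simp only [A, Complex.sub_im, Complex.mul_re, Complex.mul_im, Complex.re_ofNat, Complex.im_ofNat, Complex.ofReal_re, Complex.ofReal_im]
    nlinarith
  have hA0 : ∀ s, A s ≠ 0 := by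
    intro s h; have := hAre s; rw [h] at this; simp at this
  have hA : Continuous A := by fun_prop
  have hE : Continuous E := by
    have : ∀ s, A s ^ 2 ≠ 0 := fun s => pow_ne_zero 2 (hA0 s)
    fun_prop (disch := exact this _)
  have hEs : ∀ s, E s = 0 ∨ 0 < (E s).re := by
    intro s
    have s1 := s.2.1
    have s2 := s.2.2
    by_cases h : (s : ℝ) = 1
    · left
      have h1 : 4 - 6 * T ≠ 0 := by simpa [A, h] using hA0 s
      simp only [E, A, h, Complex.ofReal_one, one_mul, mul_one]
      rw [hT]; field_simp; ring
    · right
      have h3 : (s : ℝ) < 1 := lt_of_le_of_ne s2 h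
      have e : 4 * (((s : ℝ) : ℂ) * T) ^ 6 / (A s) ^ 2 = ((s : ℝ) ^ 3 * (4 - 6 * T) / A s) ^ 2 := by
        rw [mul_pow, div_pow, mul_pow, ← hT]; ring
      have h4 : ‖(((s : ℝ) ^ 3 * (4 - 6 * T) / A s) ^ 2 : ℂ)‖ < 1 := by
        rw [norm_pow]
        apply pow_lt_one₀ (norm_nonneg _) _ (by norm_num)
        rw [norm_div, div_lt_one (norm_pos_iff.2 (hA0 s)), norm_mul, norm_pow, Complex.norm_real, Real.norm_of_nonneg s1]
        have h5 : (s : ℝ) * ‖4 - 6 * T‖ ≤ ‖A s‖ := by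
          rw [← Real.norm_of_nonneg s1, ← Complex.norm_real, ← norm_mul]
          rw [← sq_le_sq₀ (norm_nonneg _) (norm_nonneg _), Complex.sq_norm, Complex.sq_norm, Complex.normSq_apply, Complex.normSq_apply]
          have e2 : A s = (4 * (1 - (s : ℝ)) : ℝ) + ((s : ℝ) : ℂ) * (4 - 6 * T) := by
            simp only [A]; push_cast; ring
          rw [e2]
          simp only [Complex.add_re, Complex.add_im, Complex.ofReal_re, Complex.ofReal_im, Complex.mul_re, Complex.mul_im, zero_mul, sub_zero, zero_add, add_zero]
          have : 0 ≤ (s : ℝ) * (4 - 6 * T).re := mul_nonneg s1 hre.le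
          nlinarith
        have h6 : 0 < ‖4 - 6 * T‖ := by
          apply norm_pos_iff.2; intro h; rw [h] at hre; simp at hre
        have h7 : 0 < ‖A s‖ := norm_pos_iff.2 (hA0 s)
        by_cases h8 : (s : ℝ) = 0
        · rw [h8]; simpa using h7
        · have : 0 < (s : ℝ) := lt_of_le_of_ne s1 (Ne.symm h8)
          have h9 : (s : ℝ) ^ 3 < s := by nlinarith [mul_pos this this]
          calc (s : ℝ) ^ 3 * ‖4 - 6 * T‖ < s * ‖4 - 6 * T‖ := by gcongr
            _ ≤ _ := h5
      simp only [E]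
      rw [e, Complex.sub_re, Complex.one_re]
      have := Complex.re_le_norm (((s : ℝ) ^ 3 * (4 - 6 * T) / A s) ^ 2 : ℂ)
      linarith
  have hEc : Continuous fun s => (E s) ^ (1 / 2 : ℂ) := by
    rw [continuous_iff_continuousAt]
    intro s
    rcases hEs s with h | h
    · have h1 := Complex.continuousAt_cpow_zero_of_re_pos (z := 1 / 2) (by norm_num)
      rw [← h] at h1
      exact ContinuousAt.comp (g := fun x : ℂ × ℂ => x.1 ^ x.2) (f := fun s => (E s, (1 / 2 : ℂ))) h1
        (hE.continuousAt.prodMk continuousAt_const)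
    · exact ContinuousAt.cpow hE.continuousAt continuousAt_const (Or.inl h)
  have hS : ∀ s, S s ∈ Complex.slitPlane := by
    intro s
    apply slit_mul (hAre s)
    have := re_cpow_half (E s)
    have e : (1 / 2 * (1 + (E s) ^ (1 / 2 : ℂ))).re = 1 / 2 * (1 + ((E s) ^ (1 / 2 : ℂ)).re) := by
      rw [show (1 / 2 : ℂ) = ((1 / 2 : ℝ) : ℂ) by push_cast; rfl, Complex.re_ofReal_mul]
      simp
    rw [e]; positivity
  have hSc : Continuous S := by fun_prop
  have hS0 : ∀ s, S s ≠ 0 := fun s => Complex.slitPlane_ne_zero (hS s)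
  have hxc : Continuous x := by
    apply continuous_const.mul
    rw [continuous_iff_continuousAt]
    exact fun s => ContinuousAt.cpow hSc.continuousAt continuousAt_const (hS s)
  have hx6 : ∀ s, x s ^ 6 = S s := by
    intro s; simp only [x]; rw [mul_pow, hξ, pow6_cpow, one_mul]
  have hx0 : ∀ s, x s ≠ 0 := by
    intro s h; apply hS0 s; rw [← hx6, h]; norm_num
  have hq : ∀ s, S s ^ 2 - A s * S s + (((s : ℝ) : ℂ) * T) ^ 6 = 0 := by
    intro s
    have h1 : ((E s) ^ (1 / 2 : ℂ)) ^ 2 = E s := by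
      rw [← Complex.cpow_nat_mul]; norm_num
    have h2 : E s * (A s) ^ 2 = (A s) ^ 2 - 4 * (((s : ℝ) : ℂ) * T) ^ 6 := by
      simp only [E]
      rw [sub_mul, div_mul_cancel₀ _ (pow_ne_zero 2 (hA0 s))]; ring
    simp only [S]
    linear_combination (A s) ^ 2 / 4 * h1 + h2 / 4
  have hsum : ∀ s, x s ^ 6 + (((s : ℝ) : ℂ) * T / x s) ^ 6 = A s := by
    intro s
    rw [div_pow, hx6]
    have := hS0 s
    field_simp
    linear_combination hq s
  refine ⟨⟨⟨fun s => (x s, ((s : ℝ) : ℂ) * T / x s), ?_⟩, ?_, ?_⟩, ?_⟩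
  · fun_prop (disch := exact hx0 _)
  · simp only [x, S, E, A]
    norm_num [r6]
  · have hE1 : E 1 = 0 := by
      rcases hEs 1 with h | h
      · exact h
      · exfalso
        have h1 : 4 - 6 * T ≠ 0 := by simpa [A] using hA0 1
        have : E 1 = 0 := by
          simp only [E, A, Set.Icc.coe_one, Complex.ofReal_one, one_mul, mul_one]
          rw [hT]; field_simp; ring
        rw [this] at h; simp at h
    have hS1 : S 1 = 2 - 3 * T := by
      simp only [S]
      rw [hE1, Complex.zero_cpow (by norm_num)]
      simp only [A, Set.Icc.coe_one, Complex.ofReal_one]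
      ring
    simp only [x]
    rw [hS1]
    simp
  · intro s
    refine ⟨?_, ?_, ?_⟩
    · show (x s) ^ 6 + (((s : ℝ) : ℂ) * T / x s) ^ 6 + 6 * (x s) * (((s : ℝ) : ℂ) * T / x s) = 4
      rw [hsum, mul_assoc, mul_div_cancel₀ _ (hx0 s)]
      simp only [A]; ring
    · show 0 < ((x s) ^ 6 + (((s : ℝ) : ℂ) * T / x s) ^ 6).re
      rw [hsum]; exact hAre s
    · show 0 ≤ ((x s) ^ 6 + (((s : ℝ) : ℂ) * T / x s) ^ 6).im
      rw [hsum]; exact hAim s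

theorem third_sq {S T : ℂ} (hT : T ≠ 0) (hS : S = T ^ 3) (h1 : -Real.pi < 3 * T.arg) (h2 : 3 * T.arg ≤ Real.pi) :
    (S ^ (1 / 6 : ℂ)) ^ 2 = T := by
  have hS0 : S ≠ 0 := by rw [hS]; exact pow_ne_zero 3 hT
  have hl : Complex.log S = 3 * Complex.log T := by
    have e : S = Complex.exp (3 * Complex.log T) := by
      rw [hS]
      have := Complex.exp_nat_mul (Complex.log T) 3
      push_cast at this
      rw [this, Complex.exp_log hT]
    have e2 : (3 * Complex.log T).im = 3 * T.arg := by simp [Complex.log_im]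
    rw [e, Complex.log_exp (by rw [e2]; exact h1) (by rw [e2]; exact h2)]
  rw [Complex.cpow_def_of_ne_zero hS0, hl, ← Complex.exp_nat_mul]
  rw [show ((2 : ℕ) : ℂ) * (3 * Complex.log T * (1 / 6)) = Complex.log T by push_cast; ring, Complex.exp_log hT]

noncomputable def ze : ℂ := Complex.exp (Real.pi / 3 * Complex.I)

theorem ze3 : ze ^ 3 = -1 := by
  unfold ze
  rw [← Complex.exp_nat_mul]
  rw [show ((3 : ℕ) : ℂ) * (Real.pi / 3 * Complex.I) = Real.pi * Complex.I by push_cast; ring]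
  exact Complex.exp_pi_mul_I

theorem third_sq' {S T : ℂ} (hT : T ≠ 0) (hS : S = T ^ 3) (h1 : -Real.pi < T.arg) (h2 : 3 * T.arg ≤ -Real.pi) :
    (S ^ (1 / 6 : ℂ)) ^ 2 = T * ze ^ 2 := by
  have hS0 : S ≠ 0 := by rw [hS]; exact pow_ne_zero 3 hT
  have hl : Complex.log S = 3 * Complex.log T + 2 * Real.pi * Complex.I := by
    have e : S = Complex.exp (3 * Complex.log T + 2 * Real.pi * Complex.I) := by
      rw [hS, Complex.exp_periodic]
      have := Complex.exp_nat_mul (Complex.log T) 3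
      push_cast at this
      rw [this, Complex.exp_log hT]
    have e2 : (3 * Complex.log T + 2 * Real.pi * Complex.I).im = 3 * T.arg + 2 * Real.pi := by simp [Complex.log_im]
    rw [e, Complex.log_exp (by rw [e2]; linarith) (by rw [e2]; linarith)]
  rw [Complex.cpow_def_of_ne_zero hS0, hl, ← Complex.exp_nat_mul]
  unfold ze
  rw [show ((2 : ℕ) : ℂ) * ((3 * Complex.log T + 2 * Real.pi * Complex.I) * (1 / 6)) = Complex.log T + (2 : ℕ) * (Real.pi / 3 * Complex.I) by push_cast; ring,
    Complex.exp_add, Complex.exp_log hT, Complex.exp_nat_mul]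

theorem swap_join {p q : ℂ × ℂ} (h : JoinedIn CM p q) : JoinedIn CM (p.2, p.1) (q.2, q.1) := by
  refine ⟨h.somePath.map (f := fun p : ℂ × ℂ => (p.2, p.1)) (by fun_prop), fun t => ?_⟩
  obtain ⟨h1, h2, h3⟩ := h.somePath_mem t
  set P := h.somePath t
  refine ⟨?_, ?_, ?_⟩
  · show P.2 ^ 6 + P.1 ^ 6 + 6 * P.2 * P.1 = 4
    rw [← h1]; simp only [f]; ring
  · show 0 < (P.2 ^ 6 + P.1 ^ 6).re
    rw [add_comm]; exact h2
  · show 0 ≤ (P.2 ^ 6 + P.1 ^ 6).im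
    rw [add_comm]; exact h3

theorem rot_join {u : ℂ} (hu : u ^ 6 = 1) {a b c d : ℂ} (h : JoinedIn CM (a, b) (c, d)) : JoinedIn CM (u * a, u⁻¹ * b) (u * c, u⁻¹ * d) := by
  have hu0 : u ≠ 0 := by rintro rfl; norm_num at hu
  have hu' : u⁻¹ ^ 6 = 1 := by rw [inv_pow, hu, inv_one]
  refine ⟨h.somePath.map (f := fun p : ℂ × ℂ => (u * p.1, u⁻¹ * p.2)) (by fun_prop), fun t => ?_⟩
  obtain ⟨h1, h2, h3⟩ := h.somePath_mem t
  set P := h.somePath t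
  have e : (u * P.1) ^ 6 + (u⁻¹ * P.2) ^ 6 = P.1 ^ 6 + P.2 ^ 6 := by
    rw [mul_pow, mul_pow, hu, hu']; ring
  refine ⟨?_, ?_, ?_⟩
  · show (u * P.1) ^ 6 + (u⁻¹ * P.2) ^ 6 + 6 * (u * P.1) * (u⁻¹ * P.2) = 4
    rw [e, ← h1]; simp only [f]; field_simp
  · show 0 < ((u * P.1) ^ 6 + (u⁻¹ * P.2) ^ 6).re
    rw [e]; exact h2
  · show 0 ≤ ((u * P.1) ^ 6 + (u⁻¹ * P.2) ^ 6).im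
    rw [e]; exact h3

theorem exists_t0 : ∃ t : ℝ, 0 < t ∧ t < 2 / 3 ∧ t ^ 3 + 3 * t = 2 := by
  have h := intermediate_value_Icc (f := fun t : ℝ => t ^ 3 + 3 * t) (a := 0) (b := 2 / 3) (by norm_num) (by fun_prop)
  obtain ⟨t, ⟨h1, h2⟩, h3⟩ := h (show (2 : ℝ) ∈ _ by norm_num)
  simp only at h3
  refine ⟨t, lt_of_le_of_ne h1 ?_, lt_of_le_of_ne h2 ?_, h3⟩
  · rintro rfl; norm_num at h3
  · rintro rfl; norm_num at h3

theorem j0 : JoinedIn CM (r6, 0) (0, r6) := by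
  obtain ⟨t, h1, h2, h3⟩ := exists_t0
  have h3' : ((t : ℝ) : ℂ) ^ 3 + 3 * t = 2 := by exact_mod_cast h3
  have ht : ((t : ℝ) : ℂ) ≠ 0 := by exact_mod_cast h1.ne'
  have hS : 2 - 3 * (t : ℂ) = (t : ℂ) ^ 3 := by linear_combination -h3'
  have h := joinT t (by linear_combination (4 - 6 * (t : ℂ) + 2 * (t : ℂ) ^ 3) * 2 * h3') (by simp; linarith) (by simp) 1 (by norm_num)
  have hx := third_sq ht hS (by rw [Complex.arg_ofReal_of_nonneg h1.le]; linarith [Real.pi_pos]) (by rw [Complex.arg_ofReal_of_nonneg h1.le]; linarith [Real.pi_pos])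
  set x := (2 - 3 * (t : ℂ)) ^ (1 / 6 : ℂ)
  have hx0 : x ≠ 0 := by intro h; rw [h] at hx; apply ht; rw [← hx]; norm_num
  have e : (t : ℂ) / (1 * x) = x := by rw [← hx]; field_simp
  rw [e] at h
  simp only [one_mul] at h
  exact h.trans (swap_join h).symm

theorem j3 : JoinedIn CM (r6, 0) (-r6, 0) := by
  have h := joinT (-2) (by norm_num) (by norm_num) (by norm_num) 1 (by norm_num)
  have hx := third_sq (S := 2 - 3 * (-2 : ℂ)) (T := 2) (by norm_num) (by norm_num) (by rw [show (2 : ℂ) = ((2 : ℝ) : ℂ) by norm_num, Complex.arg_ofReal_of_nonneg (by norm_num)]; linarith [Real.pi_pos])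
    (by rw [show (2 : ℂ) = ((2 : ℝ) : ℂ) by norm_num, Complex.arg_ofReal_of_nonneg (by norm_num)]; linarith [Real.pi_pos])
  set x := (2 - 3 * (-2 : ℂ)) ^ (1 / 6 : ℂ)
  have hx0 : x ≠ 0 := by intro h; rw [h] at hx; norm_num at hx
  have e : (-2 : ℂ) / (1 * x) = -x := by rw [← hx]; field_simp
  rw [e] at h
  simp only [one_mul] at h
  have h1 := rot_join (u := -1) (by norm_num) h
  have h2 := swap_join h
  norm_num at h1 h2
  exact (j0.trans h2).trans h1.symm

theorem j2 : JoinedIn CM (ze⁻¹ * r6, 0) (ze * r6, 0) := by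
  obtain ⟨t, h1, h2, h3⟩ := exists_t0
  have ze0 : ze ≠ 0 := Complex.exp_ne_zero _
  have ze6 : ze ^ 6 = 1 := by rw [show (6 : ℕ) = 3 * 2 by norm_num, pow_mul, ze3]; norm_num
  have ze6' : ze⁻¹ ^ 6 = 1 := by rw [inv_pow, ze6, inv_one]
  set a := t / 2 with ha
  set b := Real.sqrt (3 + 3 * a ^ 2) with hb
  have hbp : 0 < b := Real.sqrt_pos.2 (by positivity)
  have hb2 : b ^ 2 = 3 + 3 * a ^ 2 := Real.sq_sqrt (by positivity)
  let T : ℂ := ⟨-a, -b⟩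
  have hT3 : T ^ 3 + 3 * T = 2 := by
    have e : T ^ 3 = T * T * T := by ring
    rw [e]
    have h3' : 8 * a ^ 3 + 6 * a = 2 := by rw [ha]; linear_combination h3
    apply Complex.ext
    · simp [T]; linear_combination 3 * a * hb2 + h3'
    · simp [T]; linear_combination b * hb2
  have hTre : T.re < 0 := by simp [T, ha]; linarith
  have hTim : T.im < 0 := by simp [T]; exact hbp
  have hT0 : T ≠ 0 := by intro h; rw [h] at hTre; simp at hTre
  have harg : T.arg < -(Real.pi / 2) := by
    have g1 : T.arg < 0 := Complex.arg_neg_iff.2 hTim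
    have g2 : ¬ |T.arg| ≤ Real.pi / 2 := by
      rw [Complex.abs_arg_le_pi_div_two_iff]; linarith
    rw [abs_of_neg g1] at g2
    linarith
  have hS : 2 - 3 * T = T ^ 3 := by linear_combination -hT3
  have h := joinT T (by linear_combination (4 - 6 * T + 2 * T ^ 3) * 2 * hT3) (by simp; linarith) hTim.le ze⁻¹ ze6'
  have hx := third_sq' hT0 hS (Complex.neg_pi_lt_arg T) (by linarith [Real.pi_pos])
  set x := (2 - 3 * T) ^ (1 / 6 : ℂ)
  have hx0 : x ≠ 0 := by
    intro h; rw [h] at hx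
    have : T * ze ^ 2 ≠ 0 := mul_ne_zero hT0 (pow_ne_zero 2 ze0)
    apply this; rw [← hx]; norm_num
  have e : T / (ze⁻¹ * x) = ze⁻¹ * x := by
    field_simp
    rw [hx]
  rw [e] at h
  have h1 := h.trans (swap_join h).symm
  have h2 := rot_join ze6 j0
  simp only [mul_zero] at h2
  exact h1.trans h2.symm

theorem jall (ξ : ℂ) (hξ : ξ ^ 6 = 1) : JoinedIn CM (r6, 0) (ξ * r6, 0) := by
  have ze0 : ze ≠ 0 := Complex.exp_ne_zero _
  have ze6 : ze ^ 6 = 1 := by rw [show (6 : ℕ) = 3 * 2 by norm_num, pow_mul, ze3]; norm_num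
  have a2 : ∀ u : ℂ, u ^ 6 = 1 → JoinedIn CM (u * r6, 0) (u * ze ^ 2 * r6, 0) := by
    intro u hu
    have := rot_join (u := u * ze) (by rw [mul_pow, hu, ze6, one_mul]) j2
    simp only [mul_zero] at this
    convert this using 2
    · field_simp
    · ring
  have a3 : ∀ u : ℂ, u ^ 6 = 1 → JoinedIn CM (u * r6, 0) (-u * r6, 0) := by
    intro u hu
    have := rot_join hu j3
    simp only [mul_zero] at this
    convert this using 2
    ring
  have cube : ∀ u : ℂ, u ^ 3 = 1 → JoinedIn CM (r6, 0) (u * r6, 0) := by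
    intro u hu
    have hu6 : u ^ 6 = 1 := by rw [show (6 : ℕ) = 3 * 2 by norm_num, pow_mul, hu]; norm_num
    have hz : (ze ^ 2) ^ 2 + ze ^ 2 + 1 = 0 := by
      have h0 : (ze + 1) * (ze ^ 2 - ze + 1) = 0 := by linear_combination ze3
      have h1 : ze + 1 ≠ 0 := by
        intro h
        have h2 := congrArg Complex.re h
        unfold ze at h2
        rw [show (Real.pi / 3 * Complex.I : ℂ) = ((Real.pi / 3 : ℝ) : ℂ) * Complex.I by push_cast; rfl, Complex.add_re, Complex.exp_ofReal_mul_I_re, Real.cos_pi_div_three] at h2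
        norm_num at h2
      have h3 := (mul_eq_zero.1 h0).resolve_left h1
      linear_combination (ze ^ 2 + ze + 1) * h3
    have hfac : (u - 1) * ((u - ze ^ 2) * (u - ze ^ 4)) = 0 := by
      have : ze ^ 4 = -1 - ze ^ 2 := by linear_combination hz
      rw [this]
      linear_combination hu + (u - 1) * (-hz)
    have s1 := a2 1 (by norm_num)
    simp only [one_mul] at s1
    have s2 := a2 (ze ^ 2) (by rw [← pow_mul, mul_comm, pow_mul, ze6, one_pow])
    rcases mul_eq_zero.1 hfac with h | h
    · rw [sub_eq_zero.1 h, one_mul]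
      refine JoinedIn.refl ?_
      exact s1.source_mem
    rcases mul_eq_zero.1 h with h | h
    · rw [sub_eq_zero.1 h]; exact s1
    · rw [sub_eq_zero.1 h]
      have := s1.trans s2
      rw [show ze ^ 2 * ze ^ 2 = ze ^ 4 by ring] at this
      exact this
  have h1 : (ξ ^ 3 - 1) * (ξ ^ 3 + 1) = 0 := by linear_combination hξ
  rcases mul_eq_zero.1 h1 with h | h
  · exact cube ξ (sub_eq_zero.1 h)
  · have h2 := cube (-ξ) (by linear_combination -h)
    have h3 := a3 (-ξ) (by rw [neg_pow, hξ]; norm_num)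
    rw [neg_neg] at h3
    exact h2.trans h3

theorem r66 : r6 ^ 6 = 4 := pow6_cpow

end joins

section line0

theorem pc_poly (P : Polynomial ℂ) (hP : P ≠ 0) : IsPathConnected {x : ℂ | P.eval x ≠ 0} := by
  have h : {x : ℂ | P.eval x = 0}.Finite := by
    refine (P.roots.toFinset.finite_toSet).subset fun x hx => ?_
    simp only [Finset.mem_coe, Multiset.mem_toFinset, Polynomial.mem_roots hP]
    exact hx
  exact h.countable.isPathConnected_compl_of_one_lt_rank (by rw [Complex.rank_real_complex]; norm_num)

def YQ : Set ℂ := {x | x ^ 6 ≠ 4 ∧ x ^ 6 ≠ 4 * Complex.I}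

def oY : YQ := ⟨0, by constructor <;> simp⟩

theorem isOpen_YQ : IsOpen YQ :=
  (isOpen_ne_fun (by fun_prop) (by fun_prop)).inter (isOpen_ne_fun (by fun_prop) (by fun_prop))

theorem pc_YQ : IsPathConnected YQ := by
  have := pc_poly ((Polynomial.X ^ 6 - Polynomial.C 4) * (Polynomial.X ^ 6 - Polynomial.C (4 * Complex.I)))
    (mul_ne_zero (Polynomial.X_pow_sub_C_ne_zero (by norm_num) _) (Polynomial.X_pow_sub_C_ne_zero (by norm_num) _))
  convert this using 1
  ext x
  simp [YQ, sub_eq_zero]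

def U0 : Set ℂ := {x | x ^ 6 ∉ R}

theorem U0_YQ : U0 ⊆ YQ := by
  intro x hx
  constructor
  · intro h; apply hx; rw [h]; left; simp
  · intro h; apply hx; rw [h]; right; simp

theorem mem_R_iff {z : ℂ} : z ∈ R ↔ ∃ ρ : ℝ, 1 ≤ ρ ∧ (z = 4 * ρ ∨ z = 4 * Complex.I * ρ) := by
  constructor
  · rintro (⟨h1, h2⟩ | ⟨h1, h2⟩)
    · refine ⟨z.re / 4, by linarith, Or.inl ?_⟩
      apply Complex.ext <;> simp [h2]; ring
    · refine ⟨z.im / 4, by linarith, Or.inr ?_⟩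
      apply Complex.ext <;> simp [h1]; ring
  · rintro ⟨ρ, h, rfl | rfl⟩
    · left; simp; linarith
    · right; simp; linarith

theorem U0_star : StarConvex ℝ 0 U0 := by
  rw [starConvex_zero_iff]
  intro x hx a ha ha1 h
  rw [mem_R_iff] at h
  obtain ⟨ρ, hρ, h⟩ := h
  have ha0 : a ≠ 0 := by
    rintro rfl
    simp only [zero_smul] at h
    have : ρ ≠ 0 := by positivity
    rcases h with h | h <;> simp [this] at h
  have hap : 0 < a := lt_of_le_of_ne ha ha0.symm
  apply hx
  rw [mem_R_iff]
  refine ⟨ρ / a ^ 6, ?_, ?_⟩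
  · rw [le_div_iff₀ (by positivity), one_mul]
    exact (pow_le_one₀ ha ha1).trans hρ
  · have hac : (a : ℂ) ≠ 0 := by exact_mod_cast ha0
    rw [Complex.real_smul, mul_pow] at h
    rcases h with h | h
    · left; push_cast; field_simp; linear_combination h
    · right; push_cast; field_simp; linear_combination h

theorem U0_dense : Dense U0 := by
  intro p
  by_cases hp : p ∈ U0
  · exact subset_closure hp
  have hp' : p ^ 6 ∈ R := not_not.1 hp
  rw [mem_R_iff] at hp'
  obtain ⟨ρ, hρ, h⟩ := hp'
  have ht : Tendsto (fun δ : ℝ => p * (1 + δ * Complex.I)) (𝓝[>] 0) (𝓝 p) := by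
    have : Continuous (fun δ : ℝ => p * (1 + δ * Complex.I)) := by fun_prop
    have := this.tendsto 0
    simp only [Complex.ofReal_zero, zero_mul, add_zero, mul_one] at this
    exact this.mono_left nhdsWithin_le_nhds
  refine mem_closure_of_tendsto ht ?_
  have hmem : Set.Ioo (0:ℝ) 0.01 ∈ 𝓝[>] (0 : ℝ) := Ioo_mem_nhdsGT (by norm_num)
  filter_upwards [hmem] with δ hδ
  obtain ⟨w1, w2, -⟩ := wedge (z := 1 + δ * Complex.I) (by simp; rw [abs_of_pos hδ.1]; linarith [hδ.2])
  have w2 := w2 (by simp; exact hδ.1)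
  show _ ∉ R
  rw [mul_pow]
  set z := (1 + δ * Complex.I) ^ 6
  have := R4 (z := ρ * z) (by simp; positivity) (by simp; exact ⟨by positivity, w2.ne'⟩)
  rcases h with h | h
  · rw [h, mul_assoc]; exact this.1
  · rw [h, mul_assoc]; exact this.2

noncomputable def dY (q : YQ) : PQ oY q := by
  classical
  exact if h : (q : ℂ) ∈ U0 then mk (lft (x := oY) (y := q) (Path.segment 0 (q : ℂ)) fun t => U0_YQ (seg_mem_star U0_star h t))
  else mk (lft (x := oY) (y := q) (pc_YQ.joinedIn 0 oY.2 q q.2).somePath (JoinedIn.somePath_mem _))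

theorem dY_eq {q : YQ} (h : (q : ℂ) ∈ U0) (p : Path oY q) (hp : ∀ t, (p t : ℂ) ∈ U0) : mk p = dY q := by
  unfold dY
  rw [dif_pos h]
  have := sc_star U0_star ⟨_, h⟩
  exact sc_hom' U0_YQ _ _ hp (fun t => seg_mem_star U0_star h t)

theorem trans_mem' {S : Set ℂ} {x y z : S} (p : Path x y) (q : Path y z) {V : Set ℂ} (hp : ∀ t, (p t : ℂ) ∈ V) (hq : ∀ t, (q t : ℂ) ∈ V) (t : 𝕀) :
    (p.trans q t : ℂ) ∈ V := by
  have := trans_mem p q (V := Subtype.val ⁻¹' V) hp hq t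
  exact this

theorem dY_ex {q : YQ} (h : (q : ℂ) ∈ U0) : ∃ p : Path oY q, ∀ t, (p t : ℂ) ∈ U0 :=
  ⟨lft (x := oY) (y := q) (Path.segment 0 (q : ℂ)) fun t => U0_YQ (seg_mem_star U0_star h t), fun t => seg_mem_star U0_star h t⟩

theorem dY_trans {q q' : YQ} (h : (q : ℂ) ∈ U0) (p : Path q q') (hp : ∀ t, (p t : ℂ) ∈ U0) :
    (dY q).trans (mk p) = dY q' := by
  have h' : (q' : ℂ) ∈ U0 := by simpa using hp 1
  obtain ⟨r, hr⟩ := dY_ex h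
  rw [← dY_eq h r hr, ← mk_trans]
  exact dY_eq h' _ (trans_mem' _ _ hr hp)

def Wd : Set ℂ := {z | 1 < z.re ∧ |z.im| < 0.1 * z.re}
def Wp : Set ℂ := {z | 0 < z.im} ∩ Wd
def Wm : Set ℂ := {z | z.im < 0} ∩ Wd

theorem Wd_conv : Convex ℝ Wd := by
  have e : Wd = {z : ℂ | 1 < Complex.reLm z} ∩ ({z | 0 < ((0.1:ℝ) • Complex.reLm - Complex.imLm) z} ∩ {z | 0 < ((0.1:ℝ) • Complex.reLm + Complex.imLm) z}) := by
    ext z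
    simp only [Wd, Set.mem_ofPred_eq, Set.mem_inter_iff, abs_lt, LinearMap.sub_apply, LinearMap.add_apply, LinearMap.smul_apply, Complex.reLm_coe, Complex.imLm_coe, smul_eq_mul]
    constructor
    · rintro ⟨h1, h2, h3⟩; refine ⟨h1, ?_, ?_⟩ <;> linarith
    · rintro ⟨h1, h2, h3⟩; refine ⟨h1, ?_, ?_⟩ <;> linarith
  rw [e]
  exact (convex_halfSpace_gt (LinearMap.isLinear _) _).inter ((convex_halfSpace_gt (LinearMap.isLinear _) _).inter (convex_halfSpace_gt (LinearMap.isLinear _) _))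

theorem Wp_conv : Convex ℝ Wp := (convex_halfSpace_gt (LinearMap.isLinear Complex.imLm) 0).inter Wd_conv
theorem Wm_conv : Convex ℝ Wm := (convex_halfSpace_lt (LinearMap.isLinear Complex.imLm) 0).inter Wd_conv

theorem Wd_open : IsOpen Wd :=
  (isOpen_lt continuous_const Complex.continuous_re).inter
    (isOpen_lt (Complex.continuous_im.abs) (Complex.continuous_re.const_mul _ ))

variable {x0 : ℂ}

theorem Q_ne (h : x0 ^ 6 = 4 ∨ x0 ^ 6 = 4 * Complex.I) : x0 ≠ 0 := by
  rintro rfl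
  rcases h with h | h <;> norm_num at h

theorem b_mul (h : x0 ^ 6 = 4 ∨ x0 ^ 6 = 4 * Complex.I) {z : ℂ} (hz : 0 < (z ^ 6).re) (hz' : z ^ 6 ≠ 1) : z * x0 ∈ YQ := by
  constructor
  · intro hh
    rw [mul_pow] at hh
    rcases h with h | h <;> rw [h] at hh
    · apply hz'; linear_combination hh / 4
    · have h2 := congrArg Complex.im hh
      simp at h2
      linarith
  · intro hh
    rw [mul_pow] at hh
    rcases h with h | h <;> rw [h] at hh
    · have h2 := congrArg Complex.re hh
      simp at h2
      linarith
    · apply hz'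
      have : 4 * Complex.I ≠ 0 := by simp
      exact mul_right_cancel₀ this (by linear_combination hh)

theorem Wd_YQ (h : x0 ^ 6 = 4 ∨ x0 ^ 6 = 4 * Complex.I) {z : ℂ} (hz : z ∈ Wd) : z * x0 ∈ YQ := by
  obtain ⟨w1, w2, w3⟩ := wedge hz.2
  apply b_mul h w1
  intro hh
  rw [hh] at w2 w3
  simp at w2 w3
  have him : z.im = 0 := le_antisymm w2 w3
  have hz' : z = (z.re : ℂ) := Complex.ext (by simp) (by simp [him])
  rw [hz'] at hh
  have : z.re ^ 6 = 1 := by exact_mod_cast hh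
  have h1 : 1 < z.re ^ 6 := one_lt_pow₀ hz.1 (by norm_num)
  linarith

theorem Wd_U0 (h : x0 ^ 6 = 4 ∨ x0 ^ 6 = 4 * Complex.I) {z : ℂ} (hz : z ∈ Wd) : z * x0 ∈ U0 ↔ z.im ≠ 0 := by
  constructor
  · intro h' him
    have hz' : z = (z.re : ℂ) := Complex.ext (by simp) (by simp [him])
    apply h'
    rw [mem_R_iff]
    refine ⟨z.re ^ 6, one_le_pow₀ hz.1.le, ?_⟩
    rw [mul_pow, hz']
    push_cast
    rcases h with h | h <;> rw [h]
    · left; simp; ring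
    · right; simp; ring
  · intro him
    obtain ⟨w1, w2, w3⟩ := wedge hz.2
    have : (z ^ 6).im ≠ 0 := by
      rcases lt_or_gt_of_ne him with hh | hh
      · exact (w3 hh).ne
      · exact (w2 hh).ne'
    have h4 := R4 w1 this
    show _ ∉ R
    rw [mul_pow, mul_comm]
    rcases h with h | h <;> rw [h]
    · exact h4.1
    · exact h4.2

theorem kap_YQ (h : x0 ^ 6 = 4 ∨ x0 ^ 6 = 4 * Complex.I) {ε : ℝ} (h0 : 0 < ε) (h1 : ε < 0.01) (t : 𝕀) : kap ε t * x0 ∈ YQ := by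
  rcases kap_cases ε t with ⟨s, e⟩ | ⟨s, e⟩ | ⟨s, e⟩
  · rw [e]
    rcases seg1 h0 h1 s with e | ⟨e1, e2⟩
    · rw [e, zero_mul]; exact oY.2
    · obtain ⟨w1, w2, w3⟩ := wedge e1
      apply b_mul h w1
      intro hh
      have := w2 e2
      rw [hh] at this
      simp at this
  · rw [e]
    have := seg2' h0 h1 s
    apply b_mul h (by linarith)
    intro hh
    rw [hh] at this
    simp at this
  · rw [e]
    rcases seg3 h0 h1 s with e | ⟨e1, e2⟩
    · rw [e, zero_mul]; exact oY.2
    · obtain ⟨w1, w2, w3⟩ := wedge e1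
      apply b_mul h w1
      intro hh
      have := w3 e2
      rw [hh] at this
      simp at this

/-- path in YQ from path in Wd -/
theorem exW (h : x0 ^ 6 = 4 ∨ x0 ^ 6 = 4 * Complex.I) {V : Set ℂ} (hV : Convex ℝ V) (hVW : V ⊆ Wd) {q q' : YQ} {z z' : ℂ} (hz : z ∈ V) (hz' : z' ∈ V)
    (e : (q : ℂ) = z * x0) (e' : (q' : ℂ) = z' * x0) : ∃ p : Path q q', ∀ t, (p t : ℂ) = Path.segment z z' t * x0 ∧ Path.segment z z' t ∈ V := by
  refine ⟨lft (((Path.segment z z').map (continuous_mul_const x0)).cast e e') ?_, fun t => ⟨rfl, seg_mem hV hz hz' t⟩⟩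
  intro t
  exact Wd_YQ h (hVW (seg_mem hV hz hz' t))

theorem homW (h : x0 ^ 6 = 4 ∨ x0 ^ 6 = 4 * Complex.I) {q q' : YQ} (p p' : Path q q') (hp : ∀ t, (p t : ℂ) / x0 ∈ Wd) (hp' : ∀ t, (p' t : ℂ) / x0 ∈ Wd) :
    mk p = mk p' := by
  have hx := Q_ne h
  let V : Set ℂ := {z | z / x0 ∈ Wd}
  have hV : Convex ℝ V := by
    have : V = (LinearMap.mulRight ℝ (x0⁻¹)) ⁻¹' Wd := by ext z; simp [V, div_eq_mul_inv]
    rw [this]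
    exact Wd_conv.linear_preimage _
  have := sc_convex hV ⟨_, hp 0⟩
  refine sc_hom' (V := V) ?_ p p' hp hp'
  intro z hz
  have := Wd_YQ h hz
  rwa [div_mul_cancel₀ _ hx] at this

theorem same_sign (h : x0 ^ 6 = 4 ∨ x0 ^ 6 = 4 * Complex.I) {V : Set ℂ} (hV : V = Wp ∨ V = Wm) {q q' : YQ}
    (hq : (q : ℂ) / x0 ∈ V) (hq' : (q' : ℂ) / x0 ∈ V) (σ : Path q q') (hσ : ∀ t, (σ t : ℂ) / x0 ∈ Wd) :
    (dY q).trans (mk σ) = dY q' := by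
  have hx := Q_ne h
  have hVc : Convex ℝ V := by
    rcases hV with rfl | rfl
    · exact Wp_conv
    · exact Wm_conv
  have hVW : V ⊆ Wd := by rcases hV with rfl | rfl <;> exact Set.inter_subset_right
  have hV0 : ∀ z ∈ V, z * x0 ∈ U0 := by
    intro z hz
    rw [Wd_U0 h (hVW hz)]
    rcases hV with rfl | rfl
    · exact ne_of_gt hz.1
    · exact ne_of_lt hz.1
  obtain ⟨p, hp⟩ := exW h hVc hVW (q := q) (q' := q') hq hq' (by rw [div_mul_cancel₀ _ hx]) (by rw [div_mul_cancel₀ _ hx])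
  rw [homW h σ p hσ (by
    intro t
    rw [(hp t).1, mul_div_cancel_right₀ _ hx]
    exact hVW (hp t).2)]
  apply dY_trans
  · rw [← div_mul_cancel₀ (q : ℂ) hx]; exact hV0 _ hq
  · intro t
    rw [(hp t).1]
    exact hV0 _ (hp t).2

theorem kv_mem {ε : ℝ} (h0 : 0 < ε) (h1 : ε < 0.01) : kv ε ∈ Wp := by
  refine ⟨?_, ?_, ?_⟩
  · simp only [kv, Set.mem_ofPred_eq]; positivity
  · simp only [kv]; linarith
  · simp only [kv]; rw [abs_of_pos (by positivity)]; nlinarith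

theorem kw_mem {ε : ℝ} (h0 : 0 < ε) (h1 : ε < 0.01) : kw ε ∈ Wm := by
  have : 0 < (1 + ε) * ε := by positivity
  refine ⟨?_, ?_, ?_⟩
  · simp only [kw, Set.mem_ofPred_eq]; linarith
  · simp only [kw]; linarith
  · simp only [kw]; rw [abs_neg, abs_of_pos (by positivity)]; nlinarith

theorem seg1_U0 (h : x0 ^ 6 = 4 ∨ x0 ^ 6 = 4 * Complex.I) {ε : ℝ} (h0 : 0 < ε) (h1 : ε < 0.01) (s : 𝕀) :
    Path.segment 0 (kv ε) s * x0 ∈ U0 ∧ Path.segment (kw ε) 0 s * x0 ∈ U0 := by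
  have hv : kv ε * x0 ∈ U0 := by
    rw [Wd_U0 h (kv_mem h0 h1).2]; exact ne_of_gt (kv_mem h0 h1).1
  have hw : kw ε * x0 ∈ U0 := by
    rw [Wd_U0 h (kw_mem h0 h1).2]; exact ne_of_lt (kw_mem h0 h1).1
  have hs := starConvex_zero_iff.1 U0_star
  constructor
  · rw [seg_apply, smul_zero, zero_add, smul_mul_assoc]
    exact hs hv s.2.1 s.2.2
  · rw [seg_apply, smul_zero, add_zero, smul_mul_assoc]
    exact hs hw (by linarith [s.2.2]) (by linarith [s.2.1])

theorem opp_sign (h : x0 ^ 6 = 4 ∨ x0 ^ 6 = 4 * Complex.I) {ε : ℝ} (h0 : 0 < ε) (h1 : ε < 0.01)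
    {H : Subgroup (FundamentalGroup YQ oY)}
    (hH : ∀ γ : Path oY oY, (∀ t, (γ t : ℂ) = kap ε t * x0) → lp (mk γ) ∈ H) {q q' : YQ}
    (hq : (q : ℂ) / x0 ∈ Wp) (hq' : (q' : ℂ) / x0 ∈ Wm) (σ : Path q q') (hσ : ∀ t, (σ t : ℂ) / x0 ∈ Wd) :
    Eqv H ((dY q).trans (mk σ)) (dY q') := by
  have hx := Q_ne h
  let γ : Path oY oY := ⟨⟨fun t => ⟨kap ε t * x0, kap_YQ h h0 h1 t⟩, by fun_prop⟩, Subtype.ext (by simp [oY]), Subtype.ext (by simp [oY])⟩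
  have hγ : ∀ t, (γ t : ℂ) = kap ε t * x0 := fun t => rfl
  have hmem := hH γ hγ
  obtain ⟨v, w, p1, p2, p3, e1, e2, hp1, hp2, hp3, e⟩ := decomp (v := (Subtype.val : YQ → ℂ)) IsEmbedding.subtypeVal ε (fun z => z * x0) (by fun_prop)
    (by intro t; rw [Subtype.range_coe]; exact kap_YQ h h0 h1 t) γ hγ
  have hv : (v : ℂ) / x0 = kv ε := by rw [e1, mul_div_cancel_right₀ _ hx]
  have hw : (w : ℂ) / x0 = kw ε := by rw [e2, mul_div_cancel_right₀ _ hx]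
  have hv0 : (v : ℂ) ∈ U0 := by have := (seg1_U0 h h0 h1 1).1; rw [Path.target] at this; rw [e1]; exact this
  have hw0 : (w : ℂ) ∈ U0 := by have := (seg1_U0 h h0 h1 0).2; rw [Path.source] at this; rw [e2]; exact this
  have d1 : mk p1 = dY v := dY_eq hv0 p1 (fun t => by rw [hp1]; exact (seg1_U0 h h0 h1 t).1)
  have d3 : mk p3.symm = dY w := dY_eq hw0 p3.symm (fun t => by rw [Path.symm_apply, Function.comp_apply, hp3]; exact (seg1_U0 h h0 h1 _).2)
  have key : Eqv H ((dY v).trans (mk p2)) (dY w) := by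
    unfold Eqv
    rw [← d1, ← d3, mk_symm, symm_symm', ← mk_trans, ← mk_trans, ← e]
    exact hmem
  have hcan : ∀ y : YQ, (y : ℂ) = (y : ℂ) / x0 * x0 := fun y => by rw [div_mul_cancel₀ _ hx]
  obtain ⟨s1, hs1⟩ := exW h Wd_conv subset_rfl (q := q) (q' := v) hq.2 (kv_mem h0 h1).2 (hcan _) e1
  obtain ⟨s3, hs3⟩ := exW h Wd_conv subset_rfl (q := w) (q' := q') (kw_mem h0 h1).2 hq'.2 e2 (hcan _)
  have m1 : ∀ t, (s1 t : ℂ) ∈ {y : ℂ | y / x0 ∈ Wd} := fun t => by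
    show _ ∈ Wd
    rw [(hs1 t).1, mul_div_cancel_right₀ _ hx]; exact (hs1 t).2
  have m3 : ∀ t, (s3 t : ℂ) ∈ {y : ℂ | y / x0 ∈ Wd} := fun t => by
    show _ ∈ Wd
    rw [(hs3 t).1, mul_div_cancel_right₀ _ hx]; exact (hs3 t).2
  have m2 : ∀ t, (p2 t : ℂ) ∈ {y : ℂ | y / x0 ∈ Wd} := fun t => by
    show _ ∈ Wd
    rw [hp2, mul_div_cancel_right₀ _ hx]; exact seg_mem Wd_conv (kv_mem h0 h1).2 (kw_mem h0 h1).2 t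
  have eσ : mk σ = mk ((s1.trans p2).trans s3) :=
    homW h _ _ hσ (trans_mem' _ _ (trans_mem' _ _ m1 m2) m3)
  have f1 := same_sign h (Or.inl rfl) hq (by rw [hv]; exact kv_mem h0 h1) s1 m1
  have f3 := same_sign h (Or.inr rfl) (by rw [hw]; exact kw_mem h0 h1) hq' s3 m3
  rw [eσ, mk_trans, mk_trans, ← Path.Homotopic.Quotient.trans_assoc, ← Path.Homotopic.Quotient.trans_assoc, f1, ← f3]
  exact key.mul _

theorem line_gen {ε : ℝ} (h0 : 0 < ε) (h1 : ε < 0.01)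
    {H : Subgroup (FundamentalGroup YQ oY)}
    (hH : ∀ x0 : ℂ, (x0 ^ 6 = 4 ∨ x0 ^ 6 = 4 * Complex.I) → ∀ γ : Path oY oY, (∀ t, (γ t : ℂ) = kap ε t * x0) → lp (mk γ) ∈ H) (g : PQ oY oY) : lp g ∈ H := by
  have : LocallyPathConnectedSpace YQ := isOpen_YQ.locallyPathConnectedSpace
  have hU0o : IsOpen U0 := isClosed_R.isOpen_compl.preimage (continuous_pow 6)
  have hbig : ∀ q : YQ, (q : ℂ) ∈ U0 → (Subtype.val ⁻¹' U0 : Set YQ) ∈ 𝓝 q := fun q hq =>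
    (hU0o.preimage continuous_subtype_val).mem_nhds hq
  refine lemG (U0 := Subtype.val ⁻¹' U0) (U0_dense.preimage isOpen_YQ.isOpenMap_subtype_val) dY ?_ ?_ g
  · refine ⟨_, hbig oY (by show (0:ℂ) ^ 6 ∉ R; simpa using R0), fun q hq σ hσ => ?_⟩
    rw [dY_eq hq σ hσ]
    exact Eqv.refl _
  · intro p
    by_cases hp : (p : ℂ) ∈ U0
    · refine ⟨_, hbig p hp, fun q hq q' hq' σ hσ => ?_⟩
      rw [dY_trans hq σ hσ]
      exact Eqv.refl _
    have hp' : (p : ℂ) ^ 6 ∈ R := not_not.1 hp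
    rw [mem_R_iff] at hp'
    obtain ⟨ρ, hρ, e⟩ := hp'
    have hρ1 : 1 < ρ := by
      refine lt_of_le_of_ne hρ ?_
      rintro rfl
      rcases e with e | e
      · exact p.2.1 (by rw [e]; simp)
      · exact p.2.2 (by rw [e]; simp)
    set r : ℝ := ρ ^ (1 / 6 : ℝ) with hr
    have hr6 : r ^ 6 = ρ := by
      rw [hr, ← Real.rpow_natCast, ← Real.rpow_mul (by linarith)]; norm_num
    have hr1 : 1 < r := Real.one_lt_rpow hρ1 (by norm_num)
    have hrc : (r : ℂ) ≠ 0 := by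
      have : r ≠ 0 := by positivity
      exact_mod_cast this
    have hr6c : (r : ℂ) ^ 6 = ρ := by exact_mod_cast hr6
    obtain ⟨x0, hx0⟩ : ∃ x0 : ℂ, x0 = p / r := ⟨_, rfl⟩
    have hρc : (ρ : ℂ) ≠ 0 := by rw [← hr6c]; exact pow_ne_zero _ hrc
    have hQ : x0 ^ 6 = 4 ∨ x0 ^ 6 = 4 * Complex.I := by
      rw [hx0, div_pow, hr6c]
      rcases e with e | e <;> rw [e]
      · left; field_simp
      · right; field_simp
    have hx := Q_ne hQ
    have hpx : (p : ℂ) / x0 = r := by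
      have hp0 : (p : ℂ) ≠ 0 := by
        intro hh; rw [hh] at hx0; simp at hx0; exact hx hx0
      rw [hx0]; field_simp
    refine ⟨{q | (q : ℂ) / x0 ∈ Wd}, ?_, ?_⟩
    · refine IsOpen.mem_nhds (Wd_open.preimage (f := fun q : YQ => (q : ℂ) / x0) (by fun_prop)) ?_
      show (p : ℂ) / x0 ∈ Wd
      rw [hpx]
      refine ⟨by simpa using hr1, ?_⟩
      simp; linarith
    intro q hq q' hq' σ hσ
    have hqW : (q : ℂ) / x0 ∈ Wd := by have := hσ 0; rwa [σ.source] at this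
    have hqW' : (q' : ℂ) / x0 ∈ Wd := by have := hσ 1; rwa [σ.target] at this
    have hcan : ∀ y : YQ, (y : ℂ) / x0 * x0 = y := fun y => by rw [div_mul_cancel₀ _ hx]
    have i1 := (Wd_U0 hQ hqW).1 (by rw [hcan]; exact hq)
    have i2 := (Wd_U0 hQ hqW').1 (by rw [hcan]; exact hq')
    rcases lt_or_gt_of_ne i1 with j1 | j1 <;> rcases lt_or_gt_of_ne i2 with j2 | j2
    · rw [same_sign hQ (Or.inr rfl) ⟨j1, hqW⟩ ⟨j2, hqW'⟩ σ hσ]; exact Eqv.refl _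
    · have := opp_sign hQ h0 h1 (hH x0 hQ) ⟨j2, hqW'⟩ ⟨j1, hqW⟩ σ.symm (fun t => hσ _)
      have := this.symm.mul (mk σ)
      rw [mk_symm, cancel_right'] at this
      exact this
    · exact opp_sign hQ h0 h1 (hH x0 hQ) ⟨j1, hqW⟩ ⟨j2, hqW'⟩ σ hσ
    · rw [same_sign hQ (Or.inl rfl) ⟨j1, hqW⟩ ⟨j2, hqW'⟩ σ hσ]; exact Eqv.refl _

theorem Tf (z x : ℂ) : f (z • (x, (0:ℂ))) = x ^ 6 * z ^ 6 := by
  simp [f]; ring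

theorem YQ_UU {x : ℂ} (h : x ∈ YQ) : ((x, 0) : ℂ × ℂ) ∈ UU := by
  show f (x, 0) ∉ ({4, 4 * Complex.I} : Set ℂ)
  simp only [Set.mem_insert_iff, Set.mem_singleton_iff, not_or]
  simpa [f, YQ] using h
theorem UU_YQ {x : ℂ} (h : ((x, 0) : ℂ × ℂ) ∈ UU) : x ∈ YQ := by
  have h : f (x, 0) ∉ ({4, 4 * Complex.I} : Set ℂ) := h
  simp only [Set.mem_insert_iff, Set.mem_singleton_iff, not_or] at h
  simpa [f, YQ] using h

def inc0 : C(YQ, UU) := ⟨fun x => ⟨(x, 0), YQ_UU x.2⟩, by fun_prop⟩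

theorem start : ∃ a b : FundamentalGroup UU o, (∀ w, act a (pt 0 oD w) = pt 0 oD ((gg 0)⁻¹ * w)) ∧
    (∀ w, act b (pt 0 oD w) = pt 0 oD (gg 1 * w)) ∧ ∀ γ : Path o o, (∀ t, (γ t : ℂ × ℂ).2 = 0) → lp (mk γ) ∈ Subgroup.closure {a, b} := by
  have hfin : {ξ : ℂ | ξ ^ 6 = 1}.Finite := by
    have : (Polynomial.X ^ 6 - Polynomial.C (1:ℂ)) ≠ 0 := Polynomial.X_pow_sub_C_ne_zero (by norm_num) _
    refine ((Polynomial.X ^ 6 - Polynomial.C (1:ℂ)).roots.toFinset.finite_toSet).subset fun x hx => ?_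
    simp only [Finset.mem_coe, Multiset.mem_toFinset, Polynomial.mem_roots this]
    have hx : x ^ 6 = 1 := hx
    simp [hx]
  have hev : ∀ᶠ ε in 𝓝[>] (0 : ℝ), ∀ ξ ∈ {ξ : ℂ | ξ ^ 6 = 1}, ∃ h1 h2 h3 h4, mk (kl ε (r6, 0) h1) = mk (kl ε (ξ * r6, 0) h2) ∧
      mk (kl ε (Th (r6, 0)) h3) = mk (kl ε (Th (ξ * r6, 0)) h4) := by
    rw [Filter.eventually_all_finite hfin]
    intro ξ hξ
    exact rel (jall ξ hξ)
  have hmem : Set.Ioo (0:ℝ) 0.01 ∈ 𝓝[>] (0 : ℝ) := Ioo_mem_nhdsGT (by norm_num)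
  obtain ⟨ε, hε, he⟩ := (hev.and hmem).exists
  obtain ⟨h1, h2, h3, h4, -⟩ := hε 1 (by simp)
  have hr0 : r6 ≠ 0 := by intro h; have := r66; rw [h] at this; norm_num at this
  have hom0 : om ≠ 0 := Complex.exp_ne_zero _
  have hI : (4 : ℂ) ≠ 4 * Complex.I := by
    intro h; have := congrArg Complex.re h; simp at this
  have hTh : ∀ x : ℂ, Th (x, 0) = (om * conj x, 0) := fun x => by simp [Th]
  refine ⟨lp (mk (kl ε (r6, 0) h1)), lp (mk (kl ε (Th (r6, 0)) h3)), ?_, ?_, ?_⟩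
  · intro w
    have := act_kl he.1 he.2 h1 (b := 4) (fun z => by rw [Tf, r66]) (Or.inl rfl) w
    rw [if_pos rfl] at this
    exact this
  · intro w
    have := act_kl he.1 he.2 h3 (b := 4 * Complex.I) (fun z => by
      rw [hTh, Tf, mul_pow, ← map_pow, r66, om6, Complex.conj_ofNat]; ring) (Or.inr rfl) w
    rw [if_neg hI.symm] at this
    exact this
  · set H := Subgroup.closure {lp (mk (kl ε (r6, 0) h1)), lp (mk (kl ε (Th (r6, 0)) h3))} with hH
    have key : ∀ x0 : ℂ, (x0 ^ 6 = 4 ∨ x0 ^ 6 = 4 * Complex.I) → ∃ h, lp (mk (kl ε (x0, 0) h)) ∈ H := by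
      rintro x0 (hx | hx)
      · obtain ⟨a1, a2, a3, a4, e1, e2⟩ := hε (x0 / r6) (by simp [div_pow, hx, r66])
        rw [div_mul_cancel₀ _ hr0] at a2
        refine ⟨a2, ?_⟩
        have : mk (kl ε (x0, 0) a2) = mk (kl ε (r6, 0) a1) := by
          rw [e1]
          congr 3
          rw [div_mul_cancel₀ _ hr0]
        rw [this]
        exact Subgroup.subset_closure (Or.inl rfl)
      · obtain ⟨x1, hx1⟩ : ∃ x1 : ℂ, x1 = conj (x0 / om) := ⟨_, rfl⟩
        have hx16 : x1 ^ 6 = 4 := by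
          rw [hx1, ← map_pow, div_pow, hx, om6, mul_div_cancel_right₀ _ Complex.I_ne_zero, Complex.conj_ofNat]
        have e : Th (x1 / r6 * r6, 0) = (x0, 0) := by
          rw [hTh, div_mul_cancel₀ _ hr0, hx1, Complex.conj_conj, mul_div_cancel₀ _ hom0]
        obtain ⟨a1, a2, a3, a4, e1, e2⟩ := hε (x1 / r6) (by simp [div_pow, hx16, r66])
        refine ⟨by rw [← e]; exact a4, ?_⟩
        have : mk (kl ε (x0, 0) (by rw [← e]; exact a4)) = mk (kl ε (Th (r6, 0)) a3) := by
          rw [e2]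
          congr 2
          exact e.symm
        rw [this]
        exact Subgroup.subset_closure (Or.inr rfl)
    intro γ hγ
    let γ' : Path oY oY := ⟨⟨fun t => ⟨(γ t : ℂ × ℂ).1, UU_YQ (by
      rw [← hγ t]; exact (γ t).2)⟩, by fun_prop⟩, Subtype.ext (by show (γ 0 : ℂ × ℂ).1 = 0; rw [γ.source]; rfl), Subtype.ext (by show (γ 1 : ℂ × ℂ).1 = 0; rw [γ.target]; rfl)⟩
    have := line_gen he.1 he.2 (H := H.comap (FundamentalGroup.map inc0 oY)) (by
      intro x0 hx0 δ hδ
      obtain ⟨h, hh⟩ := key x0 hx0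
      show lp (mk (δ.map inc0.continuous)) ∈ H
      have : (δ.map inc0.continuous) = kl ε (x0, 0) h := by
        apply Path.ext; funext t
        apply Subtype.ext
        show ((δ t : ℂ), (0 : ℂ)) = _
        rw [hδ]
        show _ = kap ε t • (x0, (0:ℂ))
        simp
      rw [this]
      exact hh) (mk γ')
    have e : γ'.map inc0.continuous = γ := by
      apply Path.ext; funext t
      apply Subtype.ext
      apply Prod.ext
      · rfl
      · exact (hγ t).symm
    rw [← e]
    exact this

end line0

section pencil

noncomputable def FF (p : ℂ × ℂ) : ℂ := (f (p.2, p.1 * p.2) - 4) * (f (p.2, p.1 * p.2) - 4 * Complex.I)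

theorem FF_iff {l x : ℂ} : ((x, l * x) : ℂ × ℂ) ∈ UU ↔ FF (l, x) ≠ 0 := by
  show f (x, l * x) ∉ ({4, 4 * Complex.I} : Set ℂ) ↔ _
  simp only [Set.mem_insert_iff, Set.mem_singleton_iff, FF, ne_eq, mul_eq_zero, sub_eq_zero]

noncomputable def PP (l : ℂ) : Polynomial ℂ :=
  (Polynomial.C (1 + l ^ 6) * Polynomial.X ^ 6 + Polynomial.C (6 * l) * Polynomial.X ^ 2 - Polynomial.C 4) *
  (Polynomial.C (1 + l ^ 6) * Polynomial.X ^ 6 + Polynomial.C (6 * l) * Polynomial.X ^ 2 - Polynomial.C (4 * Complex.I))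

theorem PP_eval (l x : ℂ) : (PP l).eval x = FF (l, x) := by
  simp [PP, FF, f]; ring

theorem PP_deg (l : ℂ) (h : l ^ 12 ≠ 1) : (PP l).natDegree = 12 := by
  have hc : 1 + l ^ 6 ≠ 0 := by
    intro hh; apply h; linear_combination (l ^ 6 - 1) * hh
  have e : ∀ b : ℂ, (Polynomial.C (1 + l ^ 6) * Polynomial.X ^ 6 + Polynomial.C (6 * l) * Polynomial.X ^ 2 - Polynomial.C b).natDegree = 6 := by
    intro b; compute_degree!
  have e0 : ∀ b : ℂ, (Polynomial.C (1 + l ^ 6) * Polynomial.X ^ 6 + Polynomial.C (6 * l) * Polynomial.X ^ 2 - Polynomial.C b) ≠ 0 := by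
    intro b hb
    have := e b
    rw [hb] at this
    simp at this
  rw [PP, Polynomial.natDegree_mul (e0 _) (e0 _), e, e]

theorem PP_ne (l : ℂ) (h : l ^ 12 ≠ 1) : PP l ≠ 0 := by
  intro hh
  have := PP_deg l h
  rw [hh] at this
  simp at this

theorem PP_der (l : ℂ) (h : l ^ 12 ≠ 1) {x : ℂ} (hx : (PP l).eval x = 0) : (PP l).derivative.eval x ≠ 0 := by
  have hI : (4 : ℂ) - 4 * Complex.I ≠ 0 := by
    intro h; have := congrArg Complex.re h; simp at this
  have hI2 : Complex.I ^ 2 = -1 := Complex.I_sq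
  have key : ∀ b : ℂ, b ≠ 0 → (1 + l ^ 6) * b ^ 2 ≠ - 32 * l ^ 3 → (1 + l ^ 6) * x ^ 6 + 6 * l * x ^ 2 = b →
      6 * (1 + l ^ 6) * x ^ 5 + 2 * (6 * l) * x ≠ 0 := by
    intro b hb hb2 e1 e2
    have hx0 : x ≠ 0 := by rintro rfl; apply hb; rw [← e1]; ring
    have e3 : (1 + l ^ 6) * x ^ 4 + 2 * l = 0 := by
      have : 6 * x * ((1 + l ^ 6) * x ^ 4 + 2 * l) = 0 := by linear_combination e2
      rcases mul_eq_zero.1 this with h | h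
      · exfalso; apply hx0; linear_combination h / 6
      · exact h
    have e4 : b = 4 * l * x ^ 2 := by linear_combination -e1 + x ^ 2 * e3
    apply hb2
    rw [e4]
    linear_combination 16 * l ^ 2 * e3
  have h1 : (1 + l ^ 6) * 4 ^ 2 ≠ - 32 * l ^ 3 := by
    intro hh
    have : (1 + l ^ 3) * (1 + l ^ 3) = 0 := by linear_combination hh / 16
    apply h
    rcases mul_self_eq_zero.1 this with h
    linear_combination (l ^ 9 - l ^ 6 + l ^ 3 - 1) * h
  have h2 : (1 + l ^ 6) * (4 * Complex.I) ^ 2 ≠ - 32 * l ^ 3 := by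
    intro hh
    have : (1 - l ^ 3) * (1 - l ^ 3) = 0 := by linear_combination -hh / 16 + (1 + l ^ 6) * hI2
    apply h
    rcases mul_self_eq_zero.1 this with h
    linear_combination -(l ^ 9 + l ^ 6 + l ^ 3 + 1) * h
  have hx' := hx
  simp [PP] at hx
  have ed : (PP l).derivative.eval x = (6 * (1 + l ^ 6) * x ^ 5 + 2 * (6 * l) * x) *
    (((1 + l ^ 6) * x ^ 6 + 6 * l * x ^ 2 - 4) + ((1 + l ^ 6) * x ^ 6 + 6 * l * x ^ 2 - 4 * Complex.I)) := by
    rw [PP]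
    generalize 1 + l ^ 6 = c
    generalize 6 * l = d
    simp; ring
  rw [ed]
  rcases hx with hx | hx
  · refine mul_ne_zero (key 4 (by norm_num) h1 (by linear_combination hx)) ?_
    intro hh; apply hI; linear_combination hh - 2 * hx
  · refine mul_ne_zero (key (4 * Complex.I) (by simp) h2 (by linear_combination hx)) ?_
    intro hh; apply hI; linear_combination -hh + 2 * hx

theorem PP_card (l : ℂ) (h : l ^ 12 ≠ 1) : (PP l).roots.toFinset.card = 12 := by
  have hnd : (PP l).roots.Nodup := by
    rw [Multiset.nodup_iff_count_le_one]
    intro a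
    rw [Polynomial.count_roots]
    by_contra hh
    push Not at hh
    rw [Polynomial.one_lt_rootMultiplicity_iff_isRoot (PP_ne l h)] at hh
    exact PP_der l h hh.1 hh.2
  rw [Multiset.toFinset_card_of_nodup hnd, (Polynomial.splits_iff_card_roots).1 (IsAlgClosed.splits (PP l)), PP_deg l h]

theorem root_fn {F : ℂ × ℂ → ℂ} (hF : ContDiff ℂ 1 F) {l0 x0 d : ℂ} (hF0 : F (l0, x0) = 0)
    (hd : HasDerivAt (fun x => F (l0, x)) d x0) (hd0 : d ≠ 0) :
    ∃ q : ℂ → ℂ, q l0 = x0 ∧ ∀ᶠ l in 𝓝 l0, ContinuousAt q l ∧ F (l, q l) = 0 := by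
  have cdf : ContDiffAt ℂ 1 F (l0, x0) := hF.contDiffAt
  have hfd : HasFDerivAt F (fderiv ℂ F (l0, x0)) (l0, x0) := (cdf.differentiableAt (by norm_num)).hasFDerivAt
  have e : (fderiv ℂ F (l0, x0) ∘L .inr ℂ ℂ ℂ) 1 = d := by
    have h1 : HasDerivAt (fun x : ℂ => (l0, x)) ((0 : ℂ), (1 : ℂ)) x0 := (hasDerivAt_const _ _).prodMk (hasDerivAt_id _)
    have h2 := HasFDerivAt.comp_hasDerivAt x0 hfd h1
    exact h2.unique hd
  have hinv : (fderiv ℂ F (l0, x0) ∘L .inr ℂ ℂ ℂ).IsInvertible := by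
    refine ⟨ContinuousLinearEquiv.unitsEquivAut ℂ (Units.mk0 d hd0), ?_⟩
    ext
    simp at e ⊢
    exact e.symm
  refine ⟨cdf.implicitFunction one_ne_zero hinv, cdf.implicitFunction_apply_self one_ne_zero hinv, ?_⟩
  have h1 := cdf.eventually_apply_implicitFunction one_ne_zero hinv
  have h2 := (cdf.contDiffAt_implicitFunction one_ne_zero hinv).eventually (by simp)
  filter_upwards [h1, h2] with l a b
  exact ⟨b.continuousAt, by rw [a, hF0]⟩


def Lin (H : Subgroup (FundamentalGroup UU o)) (l : ℂ) : Prop :=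
  ∀ γ : Path o o, (∀ t, (γ t : ℂ × ℂ).2 = l * (γ t : ℂ × ℂ).1) → lp (mk γ) ∈ H

theorem lin_step (H : Subgroup (FundamentalGroup UU o)) {ι : Type*} [Fintype ι] (Q : ι → 𝕀 → ℂ) (L : 𝕀 → ℂ)
    (hQ : ∀ i, Continuous (Q i)) (hL : Continuous L) {r : ℝ} (hr : 0 < r) (h0 : ∀ i, r ≤ ‖Q i 0‖)
    (hij : ∀ i j, i ≠ j → r ≤ ‖Q i 0 - Q j 0‖) (hs : ∀ s, ∑ i, ‖Q i s - Q i 0‖ < r)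
    (hroots : ∀ s x, FF (L s, x) = 0 ↔ ∃ i, x = Q i s) (h1 : Lin H (L 1)) : Lin H (L 0) := by
  classical
  intro γ hγ
  set c : ι → ℂ → ℝ := fun i x => max (1 - ‖x - Q i 0‖ / r) 0 with hc
  set Φ : 𝕀 → ℂ → ℂ := fun s x => x + ∑ i, (c i x : ℂ) * (Q i s - Q i 0) with hΦ
  have hcc : ∀ i, Continuous (c i) := by intro i; simp only [hc]; fun_prop
  have hcl : ∀ i x y, |c i x - c i y| ≤ ‖x - y‖ / r := by
    intro i x y
    refine (abs_max_sub_max_le_abs _ _ _).trans ?_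
    rw [show (1 - ‖x - Q i 0‖ / r) - (1 - ‖y - Q i 0‖ / r) = (‖y - Q i 0‖ - ‖x - Q i 0‖) / r by ring, abs_div, abs_of_pos hr]
    gcongr
    refine (abs_norm_sub_norm_le _ _).trans ?_
    rw [norm_sub_rev x y]
    simp
  have hinj : ∀ s x y, Φ s x = Φ s y → x = y := by
    intro s x y h
    by_contra hne
    have hp : 0 < ‖x - y‖ := norm_pos_iff.2 (sub_ne_zero.2 hne)
    have e : x - y = ∑ i, ((c i y - c i x : ℝ) : ℂ) * (Q i s - Q i 0) := by
      have e1 : ∑ i, ((c i y - c i x : ℝ) : ℂ) * (Q i s - Q i 0) = ∑ i, (c i y : ℂ) * (Q i s - Q i 0) - ∑ i, (c i x : ℂ) * (Q i s - Q i 0) := by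
        rw [← Finset.sum_sub_distrib]
        refine Finset.sum_congr rfl fun i _ => ?_
        push_cast; ring
      rw [e1]
      simp only [hΦ] at h
      linear_combination h
    have : ‖x - y‖ ≤ ∑ i, ‖x - y‖ / r * ‖Q i s - Q i 0‖ := by
      conv_lhs => rw [e]
      refine (norm_sum_le _ _).trans (Finset.sum_le_sum fun i _ => ?_)
      rw [norm_mul, Complex.norm_real, Real.norm_eq_abs]
      gcongr
      rw [norm_sub_rev x y]
      exact hcl i y x
    rw [← Finset.mul_sum] at this
    have h2 : ‖x - y‖ / r * ∑ i, ‖Q i s - Q i 0‖ < ‖x - y‖ / r * r := by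
      have := hs s
      gcongr
    rw [div_mul_cancel₀ _ hr.ne'] at h2
    linarith
  have hz : ∀ s, Φ s 0 = 0 := by
    intro s
    simp only [hΦ]
    rw [zero_add]
    refine Finset.sum_eq_zero fun i _ => ?_
    have : c i 0 = 0 := by
      simp only [hc]
      apply max_eq_right
      have := h0 i
      rw [zero_sub, norm_neg, sub_nonpos, le_div_iff₀ hr, one_mul]
      exact this
    rw [this]; simp
  have hq : ∀ s j, Φ s (Q j 0) = Q j s := by
    intro s j
    simp only [hΦ]
    rw [Finset.sum_eq_single j]
    · have : c j (Q j 0) = 1 := by simp [hc]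
      rw [this]; push_cast; ring
    · intro i _ hi
      have : c i (Q j 0) = 0 := by
        simp only [hc]
        apply max_eq_right
        have := hij j i (Ne.symm hi)
        rw [sub_nonpos, le_div_iff₀ hr, one_mul]
        exact this
      rw [this]; simp
    · simp
  have hid : ∀ x, Φ 0 x = x := by intro x; simp [hΦ]
  have hmem : ∀ t s, (Φ s (γ t : ℂ × ℂ).1, L s * Φ s (γ t : ℂ × ℂ).1) ∈ UU := by
    intro t s
    rw [FF_iff]
    intro h
    obtain ⟨i, hi⟩ := (hroots _ _).1 h
    rw [← hq s i] at hi
    have e := hinj _ _ _ hi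
    have h3 := (γ t).2
    have e2 : (γ t : ℂ × ℂ) = ((γ t : ℂ × ℂ).1, L 0 * (γ t : ℂ × ℂ).1) := Prod.ext rfl (hγ t)
    rw [e2, FF_iff] at h3
    exact h3 ((hroots _ _).2 ⟨i, e⟩)
  have hcont : Continuous fun p : 𝕀 × 𝕀 => Φ p.2 (γ p.1 : ℂ × ℂ).1 := by
    simp only [hΦ]
    have := γ.continuous
    fun_prop
  have hS : (γ 0 : ℂ × ℂ) = (0, 0) := by rw [γ.source]; rfl
  have hT : (γ 1 : ℂ × ℂ) = (0, 0) := by rw [γ.target]; rfl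
  let h : 𝕀 × 𝕀 → UU := fun p => ⟨(Φ p.2 (γ p.1 : ℂ × ℂ).1, L p.2 * Φ p.2 (γ p.1 : ℂ × ℂ).1), hmem _ _⟩
  have hh : Continuous h := by
    apply Continuous.subtype_mk
    exact hcont.prodMk ((hL.comp continuous_snd).mul hcont)
  have hz0 : ∀ s, h (0, s) = o := by
    intro s; apply Subtype.ext
    show (_, _) = ((0:ℂ), (0:ℂ))
    simp only [hS, hz, mul_zero]
  have hz1 : ∀ s, h (1, s) = o := by
    intro s; apply Subtype.ext
    show (_, _) = ((0:ℂ), (0:ℂ))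
    simp only [hT, hz, mul_zero]
  let γ' : Path o o := ⟨⟨fun t => h (t, 1), by fun_prop⟩, hz0 1, hz1 1⟩
  have e : mk γ = mk γ' := by
    refine hom_fix h hh γ γ' ?_ (fun t => rfl) hz0 hz1
    intro t
    apply Subtype.ext
    show _ = (_, _)
    apply Prod.ext
    · simp only [hid]
    · simp only [hid]; exact hγ t
  rw [e]
  exact h1 γ' fun t => rfl

theorem FF_cd : ContDiff ℂ 1 FF := by
  unfold FF f
  fun_prop

theorem lin_loc (l0 : ℂ) (hl0 : l0 ^ 12 ≠ 1) : ∃ N ∈ 𝓝 l0, ∀ H : Subgroup (FundamentalGroup UU o), ∀ l1 ∈ N, ∀ l2 ∈ N, Lin H l1 → Lin H l2 := by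
  classical
  set S := (PP l0).roots.toFinset with hS
  have hroot : ∀ i : S, FF (l0, i) = 0 := by
    intro i
    obtain ⟨i, this⟩ := i
    rw [hS, Multiset.mem_toFinset, Polynomial.mem_roots (PP_ne l0 hl0)] at this
    rw [← PP_eval]; exact this
  have hqex : ∀ i : S, ∃ q : ℂ → ℂ, q l0 = i ∧ ∀ᶠ l in 𝓝 l0, ContinuousAt q l ∧ FF (l, q l) = 0 := by
    intro i
    refine root_fn FF_cd (hroot i) (d := (PP l0).derivative.eval i) ?_ ?_
    · have := (PP l0).hasDerivAt (i : ℂ)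
      simpa only [PP_eval] using this
    · exact PP_der l0 hl0 (by rw [PP_eval]; exact hroot i)
  choose q hq0 hq using hqex
  have hxi : ∀ i : S, (i : ℂ) ≠ 0 := by
    intro i h
    have := hroot i
    rw [h] at this
    simp [FF, f] at this
  have hrex : ∀ᶠ r : ℝ in 𝓝[>] 0, (0 < r) ∧ (∀ i : S, 2 * r ≤ ‖(i : ℂ)‖) ∧ ∀ i j : S, i ≠ j → 2 * r ≤ ‖(i : ℂ) - j‖ := by
    have key : ∀ a : ℝ, 0 < a → ∀ᶠ r : ℝ in 𝓝[>] 0, 2 * r ≤ a := by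
      intro a ha
      filter_upwards [Ioo_mem_nhdsGT (show (0:ℝ) < a / 2 by positivity)] with r hr
      have := hr.2
      linarith
    refine (eventually_mem_nhdsWithin).and ((eventually_all.2 fun i => key _ (norm_pos_iff.2 (hxi i))).and ?_)
    refine eventually_all.2 fun i => eventually_all.2 fun j => ?_
    by_cases hij : i = j
    · exact Eventually.of_forall fun _ h => absurd hij h
    · filter_upwards [key _ (norm_pos_iff.2 (sub_ne_zero.2 fun h => hij (Subtype.ext h)))] with r hr _
      exact hr
  obtain ⟨r, hr, hr0, hrij⟩ := hrex.exists
  set η : ℝ := r / 100 with hη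
  have hηp : 0 < η := by positivity
  have hev : ∀ᶠ l in 𝓝 l0, l ^ 12 ≠ 1 ∧ ∀ i : S, (ContinuousAt (q i) l ∧ FF (l, q i l) = 0) ∧ ‖q i l - i‖ < η := by
    have ho : ∀ᶠ l in 𝓝 l0, l ^ 12 ≠ 1 :=
      (isOpen_ne_fun (f := fun l : ℂ => l ^ 12) (g := fun _ => 1) (by fun_prop) continuous_const).mem_nhds hl0
    refine ho.and (eventually_all.2 fun i => (hq i).and ?_)
    have hc : ContinuousAt (q i) l0 := (hq i).self_of_nhds.1
    have := Metric.tendsto_nhds.1 hc.tendsto η hηp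
    filter_upwards [this] with l hl
    rwa [hq0, dist_eq_norm] at hl
  obtain ⟨ε, hε, hball⟩ := Metric.eventually_nhds_iff_ball.1 hev
  refine ⟨Metric.ball l0 ε, Metric.ball_mem_nhds _ hε, ?_⟩
  intro H l1 hl1 l2 hl2
  have hm : ∀ s, Path.segment l2 l1 s ∈ Metric.ball l0 ε := seg_mem (convex_ball _ _) hl2 hl1
  have hcard : Fintype.card S = 12 := by
    rw [Fintype.card_coe]; exact PP_card l0 hl0
  have hd : ∀ l ∈ Metric.ball l0 ε, ∀ i j : S, i ≠ j → r ≤ ‖q i l - q j l‖ := by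
    intro l hl i j hij
    have h1 := ((hball l hl).2 i).2
    have h2 := ((hball l hl).2 j).2
    have h3 := hrij i j hij
    have h4 : ‖(i : ℂ) - j‖ ≤ ‖q i l - i‖ + ‖q i l - q j l‖ + ‖q j l - j‖ := by
      have : (i : ℂ) - j = - (q i l - i) + (q i l - q j l) + (q j l - j) := by ring
      rw [this]
      refine (norm_add_le _ _).trans ?_
      gcongr
      refine (norm_add_le _ _).trans ?_
      rw [norm_neg]
    linarith
  intro hL
  have := lin_step H (ι := S) (fun i s => q i (Path.segment l2 l1 s)) (fun s => Path.segment l2 l1 s) ?_ (Path.segment l2 l1).continuous hr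
    ?_ ?_ ?_ ?_ (by simpa using hL)
  · simpa using this
  · intro i
    rw [continuous_iff_continuousAt]
    intro s
    exact ContinuousAt.comp (f := fun s => Path.segment l2 l1 s) ((hball _ (hm s)).2 i).1.1 (Path.segment l2 l1).continuous.continuousAt
  · intro i
    have h1 := ((hball _ (hm 0)).2 i).2
    have h2 := hr0 i
    have h3 := norm_sub_norm_le (i : ℂ) (i - q i (Path.segment l2 l1 0))
    rw [norm_sub_rev (i : ℂ), sub_sub_cancel] at h3
    linarith
  · intro i j hij
    exact hd _ (hm 0) i j hij
  · intro s
    have : ∀ i : S, ‖q i (Path.segment l2 l1 s) - q i (Path.segment l2 l1 0)‖ ≤ 2 * η := by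
      intro i
      have h1 := ((hball _ (hm s)).2 i).2
      have h2 := ((hball _ (hm 0)).2 i).2
      have := norm_sub_le (q i (Path.segment l2 l1 s) - i) (q i (Path.segment l2 l1 0) - i)
      rw [sub_sub_sub_cancel_right] at this
      linarith
    refine (Finset.sum_le_sum fun i _ => this i).trans_lt ?_
    rw [Finset.sum_const, Finset.card_univ, hcard, nsmul_eq_mul]
    push_cast
    linarith
  · intro s x
    have hg := hball _ (hm s)
    set l := Path.segment l2 l1 s with hl
    constructor
    · intro hx
      have hsub : Finset.univ.image (fun i : S => q i l) ⊆ (PP l).roots.toFinset := by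
        intro y hy
        obtain ⟨i, _, rfl⟩ := Finset.mem_image.1 hy
        rw [Multiset.mem_toFinset, Polynomial.mem_roots (PP_ne l hg.1)]
        show (PP l).eval _ = 0
        rw [PP_eval]; exact (hg.2 i).1.2
      have heq := Finset.eq_of_subset_of_card_le hsub (by
        rw [PP_card l hg.1, Finset.card_image_of_injective, Finset.card_univ, hcard]
        intro i j hij
        by_contra hne
        have := hd l (hm s) i j hne
        simp only at hij
        rw [hij, sub_self, norm_zero] at this
        linarith)
      have : x ∈ (PP l).roots.toFinset := by
        rw [Multiset.mem_toFinset, Polynomial.mem_roots (PP_ne l hg.1)]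
        show (PP l).eval _ = 0
        rw [PP_eval]; exact hx
      rw [← heq] at this
      obtain ⟨i, _, hi⟩ := Finset.mem_image.1 this
      exact ⟨i, hi.symm⟩
    · rintro ⟨i, rfl⟩
      exact (hg.2 i).1.2

theorem lin_all (H : Subgroup (FundamentalGroup UU o)) (h0 : Lin H 0) (l : ℂ) (hl : l ^ 12 ≠ 1) : Lin H l := by
  have hpc : IsPathConnected {l : ℂ | l ^ 12 ≠ 1} := by
    have := pc_poly (Polynomial.X ^ 12 - Polynomial.C 1) (Polynomial.X_pow_sub_C_ne_zero (by norm_num) _)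
    convert this using 1
    ext x
    simp [sub_eq_zero]
  obtain ⟨p, hp⟩ := hpc.joinedIn 0 (by simp) l hl
  have := I_ind (fun t => Lin H (p t)) (fun t => by
    obtain ⟨N, hN, h⟩ := lin_loc (p t) (hp t)
    filter_upwards [p.continuous.continuousAt hN] with s hs
    exact ⟨h H _ (mem_of_mem_nhds hN) _ hs, h H _ hs _ (mem_of_mem_nhds hN)⟩) 0 1
  simp only [p.source, p.target] at this
  exact this h0

end pencil

section final

def GS : Set (ℂ × ℂ) := {w | w.1 ≠ 0 ∧ w.2 ^ 12 ≠ w.1 ^ 12}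

theorem bad_fin {a : ℂ × ℂ} (b : ℂ × ℂ) (ha : a ∈ GS) : {z : ℂ | a + z • (b - a) ∉ GS}.Finite := by
  let Q1 : Polynomial ℂ := Polynomial.C a.1 + Polynomial.X * Polynomial.C (b.1 - a.1)
  let Q2 : Polynomial ℂ := Polynomial.C a.2 + Polynomial.X * Polynomial.C (b.2 - a.2)
  let Q := Q1 * (Q2 ^ 12 - Q1 ^ 12)
  have hev : ∀ z, Q.eval z = (a.1 + z * (b.1 - a.1)) * ((a.2 + z * (b.2 - a.2)) ^ 12 - (a.1 + z * (b.1 - a.1)) ^ 12) := by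
    intro z; simp [Q, Q1, Q2]
  have hQ : Q ≠ 0 := by
    intro h
    have := hev 0
    rw [h] at this
    simp only [Polynomial.eval_zero, zero_mul, add_zero] at this
    rcases mul_eq_zero.1 this.symm with h | h
    · exact ha.1 h
    · exact ha.2 (sub_eq_zero.1 h)
  refine (Q.roots.toFinset.finite_toSet).subset fun z hz => ?_
  simp only [Finset.mem_coe, Multiset.mem_toFinset, Polynomial.mem_roots hQ]
  show Q.eval z = 0
  rw [hev]
  by_contra hne
  apply hz
  rw [mul_eq_zero, not_or] at hne
  exact ⟨hne.1, fun h => hne.2 (sub_eq_zero.2 h)⟩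

theorem GS_dense : Dense GS := by
  intro b
  have ha : ((1, 0) : ℂ × ℂ) ∈ GS := by constructor <;> simp
  have hd := (bad_fin b ha).countable.dense_compl ℝ
  have h1 := map_mem_closure (t := GS) (f := fun z : ℂ => ((1, 0) : ℂ × ℂ) + z • (b - (1, 0))) (by fun_prop) (hd 1)
    (fun z hz => not_not.1 hz)
  simpa using h1

theorem arc {V : Set (ℂ × ℂ)} (hV : IsOpen V) (hVc : Convex ℝ V) {a b : ℂ × ℂ} (ha : a ∈ GS) (hb : b ∈ GS) (haV : a ∈ V) (hbV : b ∈ V) :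
    ∃ p : Path a b, ∀ t, p t ∈ V ∧ p t ∈ GS := by
  let z : ℝ → 𝕀 → ℂ := fun ε t => ⟨t, ε * (t * (1 - t))⟩
  have hzc : Continuous fun p : ℝ × 𝕀 => z p.1 p.2 := by
    have : (fun p : ℝ × 𝕀 => z p.1 p.2) = fun p => ((p.2 : ℝ) : ℂ) + ((p.1 * (p.2 * (1 - p.2)) : ℝ) : ℂ) * Complex.I := by
      funext p; apply Complex.ext <;> simp [z]
    rw [this]; fun_prop
  have h1 : ∀ᶠ ε in 𝓝 (0 : ℝ), ∀ t ∈ (Set.univ : Set 𝕀), a + z ε t • (b - a) ∈ V := by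
    refine isCompact_univ.eventually_forall_of_forall_eventually (P := fun ε t => a + z ε t • (b - a) ∈ V) fun t _ => ?_
    have hc : Continuous fun p : ℝ × 𝕀 => a + z p.1 p.2 • (b - a) := by fun_prop
    refine hc.continuousAt (hV.mem_nhds ?_)
    have : a + z 0 t • (b - a) = a + (t : ℝ) • (b - a) := by
      have : z 0 t = ((t : ℝ) : ℂ) := by apply Complex.ext <;> simp [z]
      rw [this, Complex.coe_smul]
    show a + z 0 t • (b - a) ∈ V
    rw [this]
    exact hVc.add_smul_sub_mem haV hbV t.2
  have hbad : {ε : ℝ | ∃ w ∈ {z : ℂ | a + z • (b - a) ∉ GS}, ε = w.im / (w.re * (1 - w.re))}.Finite := by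
    refine ((bad_fin b ha).image fun w => w.im / (w.re * (1 - w.re))).subset ?_
    rintro ε ⟨w, hw, rfl⟩
    exact ⟨w, hw, rfl⟩
  have h2 : ∃ ε, (∀ t ∈ (Set.univ : Set 𝕀), a + z ε t • (b - a) ∈ V) ∧
      ε ∈ {ε : ℝ | ∃ w ∈ {z : ℂ | a + z • (b - a) ∉ GS}, ε = w.im / (w.re * (1 - w.re))}ᶜ := by
    have := (hbad.countable.dense_compl ℝ).inter_nhds_nonempty h1
    obtain ⟨ε, h, h'⟩ := this
    exact ⟨ε, h', h⟩
  obtain ⟨ε, hε, hε'⟩ := h2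
  have hz0 : z ε 0 = 0 := by apply Complex.ext <;> simp [z]
  have hz1 : z ε 1 = 1 := by apply Complex.ext <;> simp [z]
  refine ⟨⟨⟨fun t => a + z ε t • (b - a), ?_⟩, ?_, ?_⟩, fun t => ⟨hε t trivial, ?_⟩⟩
  · have : Continuous fun t => z ε t := hzc.comp (by fun_prop : Continuous fun t : 𝕀 => (ε, t))
    fun_prop
  · simp only [hz0]; simp
  · simp only [hz1]; simp
  · show a + z ε t • (b - a) ∈ GS
    by_contra hne
    by_cases ht0 : t = 0
    · rw [ht0, hz0] at hne; simp at hne; exact hne ha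
    by_cases ht1 : t = 1
    · rw [ht1, hz1] at hne; simp at hne; exact hne hb
    have h3 : (t : ℝ) ≠ 0 := fun h => ht0 (Subtype.ext h)
    have h4 : (1 - (t : ℝ)) ≠ 0 := fun h => ht1 (Subtype.ext (by show (t : ℝ) = 1; linarith))
    apply hε'
    refine ⟨z ε t, hne, ?_⟩
    show ε = ε * (t * (1 - t)) / (t * (1 - t))
    field_simp

/-- classes of paths inside the complex line through `w` -/
def LC (w : UU) (c : PQ o w) : Prop :=
  ∃ δ : Path o w, mk δ = c ∧ ∀ t, (w : ℂ × ℂ).1 * (δ t : ℂ × ℂ).2 = (w : ℂ × ℂ).2 * (δ t : ℂ × ℂ).1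

theorem LC_ex (w : UU) : ∃ c, LC w c := by
  obtain ⟨⟨x, y⟩, hw⟩ := w
  let Q : ℂ → Polynomial ℂ := fun b =>
    Polynomial.C (x ^ 6 + y ^ 6) * Polynomial.X ^ 6 + Polynomial.C (6 * x * y) * Polynomial.X ^ 2 - Polynomial.C b
  have hev : ∀ z, (Q 4 * Q (4 * Complex.I)).eval z = (f (z * x, z * y) - 4) * (f (z * x, z * y) - 4 * Complex.I) := by
    intro z; simp [Q, f]; ring
  have hmem : ∀ z, (z * x, z * y) ∈ UU ↔ (Q 4 * Q (4 * Complex.I)).eval z ≠ 0 := by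
    intro z
    rw [hev]
    show f (z * x, z * y) ∉ ({4, 4 * Complex.I} : Set ℂ) ↔ _
    simp only [Set.mem_insert_iff, Set.mem_singleton_iff, ne_eq, mul_eq_zero, sub_eq_zero]
  have h0 : (Q 4 * Q (4 * Complex.I)).eval 0 ≠ 0 := by
    rw [hev]; simp [f]
  have hne : Q 4 * Q (4 * Complex.I) ≠ 0 := by
    intro h; apply h0; rw [h]; simp
  obtain ⟨p, hp⟩ := (pc_poly _ hne).joinedIn 0 h0 1 ((hmem 1).1 (by simpa using hw))
  let δ : Path o (⟨(x, y), hw⟩ : UU) := ⟨⟨fun t => ⟨(p t * x, p t * y), (hmem _).2 (hp t)⟩, by fun_prop⟩,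
    Subtype.ext (by show (_, _) = ((0:ℂ), (0:ℂ)); simp), Subtype.ext (by show (_, _) = (x, y); simp)⟩
  refine ⟨mk δ, δ, rfl, fun t => ?_⟩
  show x * (p t * y) = y * (p t * x)
  ring

variable {H : Subgroup (FundamentalGroup UU o)}

theorem LC_eqv (hH : ∀ l : ℂ, l ^ 12 ≠ 1 → Lin H l) {w : UU} (hw : (w : ℂ × ℂ) ∈ GS) {c c' : PQ o w} (hc : LC w c) (hc' : LC w c') : Eqv H c c' := by
  obtain ⟨δ, rfl, h⟩ := hc
  obtain ⟨δ', rfl, h'⟩ := hc'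
  have hl : ((w : ℂ × ℂ).2 / (w : ℂ × ℂ).1) ^ 12 ≠ 1 := by
    rw [div_pow, Ne, div_eq_one_iff_eq (pow_ne_zero _ hw.1)]
    exact hw.2
  have := hH _ hl (δ.trans δ'.symm) (by
    have hw1 := hw.1
    refine trans_mem δ δ'.symm (V := {q : UU | (q : ℂ × ℂ).2 = (w : ℂ × ℂ).2 / (w : ℂ × ℂ).1 * (q : ℂ × ℂ).1}) ?_ ?_
    · intro t
      show (δ t : ℂ × ℂ).2 = _
      field_simp
      linear_combination h t
    · intro t
      rw [Path.symm_apply, Function.comp_apply]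
      show (δ' _ : ℂ × ℂ).2 = _
      field_simp
      linear_combination h' _)
  rw [mk_trans, mk_symm] at this
  exact this

theorem LC_near {w0 : UU} (hw0 : (w0 : ℂ × ℂ) ∈ GS) {c : PQ o w0} (hc : LC w0 c) :
    ∃ V ∈ 𝓝 w0, ∀ w, ∀ σ : Path w0 w, (∀ t, σ t ∈ V) → LC w (c.trans (mk σ)) := by
  obtain ⟨δ, rfl, h⟩ := hc
  let T : UU → 𝕀 → ℂ × ℂ := fun w u => ((δ u : ℂ × ℂ).1 / (w0 : ℂ × ℂ).1) • (w : ℂ × ℂ)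
  have hT : Continuous fun p : UU × 𝕀 => T p.1 p.2 := by
    have := δ.continuous
    simp only [T]
    fun_prop
  have hT0 : ∀ u, T w0 u = δ u := by
    intro u
    have := hw0.1
    have hh := h u
    apply Prod.ext
    · simp only [T, Prod.smul_fst, smul_eq_mul]; field_simp
    · simp only [T, Prod.smul_snd, smul_eq_mul]; field_simp; linear_combination -hh
  have hopen : IsOpen UU := by
    have : UU = f ⁻¹' ({4, 4 * Complex.I} : Set ℂ)ᶜ := rfl
    rw [this]
    exact (Set.toFinite _).isClosed.isOpen_compl.preimage f_cont
  have hV : ∀ᶠ w in 𝓝 w0, ∀ u ∈ (Set.univ : Set 𝕀), T w u ∈ UU := by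
    refine isCompact_univ.eventually_forall_of_forall_eventually (P := fun w u => T w u ∈ UU) fun u _ => ?_
    refine hT.continuousAt (hopen.mem_nhds ?_)
    show T w0 u ∈ UU
    rw [hT0]; exact (δ u).2
  refine ⟨_, hV, fun w σ hσ => ?_⟩
  let g : 𝕀 × 𝕀 → UU := fun p => ⟨T (σ p.2) p.1, hσ p.2 p.1 trivial⟩
  have hg : Continuous g := by
    apply Continuous.subtype_mk
    exact hT.comp (by fun_prop : Continuous fun p : 𝕀 × 𝕀 => (σ p.2, p.1))
  have hg0 : ∀ t, g (0, t) = o := by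
    intro t; apply Subtype.ext
    show T _ 0 = ((0:ℂ), (0:ℂ))
    simp only [T, δ.source]
    simp [o]
    rfl
  have hg1 : ∀ t, g (1, t) = σ t := by
    intro t; apply Subtype.ext
    show T _ 1 = _
    simp only [T, δ.target]
    rw [div_self hw0.1, one_smul]
  let δ' : Path o w := ⟨⟨fun t => g (t, 1), by fun_prop⟩, hg0 1, (hg1 1).trans σ.target⟩
  have := square g hg δ σ (Path.refl o) δ' (fun t => Subtype.ext (by show _ = T (σ 0) t; rw [σ.source, hT0]))
    (fun t => (hg1 t).symm) (fun t => (hg0 t).symm) (fun t => rfl)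
  refine ⟨δ', ?_, ?_⟩
  · rw [this]
    exact (Path.Homotopic.Quotient.refl_trans _).symm
  · intro t
    show _ * (T (σ 1) t).2 = _ * (T (σ 1) t).1
    rw [σ.target]
    simp only [T, Prod.smul_snd, Prod.smul_fst, smul_eq_mul]
    ring

theorem LC_path (hH : ∀ l : ℂ, l ^ 12 ≠ 1 → Lin H l) {y z : UU} (γ : Path y z) (hγ : ∀ t, (γ t : ℂ × ℂ) ∈ GS) {c : PQ o y} {c' : PQ o z}
    (hc : LC y c) (hc' : LC z c') : Eqv H (c.trans (mk γ)) c' := by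
  refine path_rel γ LC ?_ (fun t => LC_ex _) hc hc'
  intro t
  obtain ⟨c0, hc0⟩ := LC_ex (γ t)
  obtain ⟨V, hV, h⟩ := LC_near (hγ t) hc0
  filter_upwards [subpath_near γ t hV] with s hs c c' hc hc'
  exact ((LC_eqv hH (hγ t) hc hc0).mul _).trans (LC_eqv hH (hγ s) (h _ _ hs) hc')

theorem isOpen_UU : IsOpen UU := by
  have : UU = f ⁻¹' ({4, 4 * Complex.I} : Set ℂ)ᶜ := rfl
  rw [this]
  exact (Set.toFinite _).isClosed.isOpen_compl.preimage f_cont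

theorem all_mem (hH : ∀ l : ℂ, l ^ 12 ≠ 1 → Lin H l) (g : PQ o o) : lp g ∈ H := by
  have : LocallyPathConnectedSpace UU := isOpen_UU.locallyPathConnectedSpace
  have hdense : Dense ((fun q : UU => (q : ℂ × ℂ)) ⁻¹' GS) := GS_dense.preimage isOpen_UU.isOpenMap_subtype_val
  have hball : ∀ p : UU, ∃ ε > 0, Metric.ball (p : ℂ × ℂ) ε ⊆ UU := fun p => Metric.isOpen_iff.1 isOpen_UU p p.2
  refine lemG hdense (fun q => (LC_ex q).choose) ?_ ?_ g
  · obtain ⟨ε, hε, hb⟩ := hball o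
    refine ⟨(fun q : UU => (q : ℂ × ℂ)) ⁻¹' Metric.ball (o : ℂ × ℂ) ε,
      continuous_subtype_val.continuousAt (Metric.ball_mem_nhds _ hε), fun q hq σ hσ => ?_⟩
    have := sc_convex (convex_ball (o : ℂ × ℂ) ε) ⟨_, Metric.mem_ball_self hε⟩
    have hqb : (q : ℂ × ℂ) ∈ Metric.ball (o : ℂ × ℂ) ε := by have := hσ 1; rwa [σ.target] at this
    have hseg := seg_mem (convex_ball (o : ℂ × ℂ) ε) (Metric.mem_ball_self hε) hqb
    have e := sc_hom' hb σ (lft (Path.segment (o : ℂ × ℂ) q) fun t => hb (hseg t)) hσ hseg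
    rw [e]
    refine LC_eqv hH hq ⟨_, rfl, fun t => ?_⟩ (LC_ex q).choose_spec
    rw [lft_coe, seg_apply]
    simp [o]
    ring
  · intro p
    obtain ⟨ε, hε, hb⟩ := hball p
    refine ⟨(fun q : UU => (q : ℂ × ℂ)) ⁻¹' Metric.ball (p : ℂ × ℂ) ε,
      continuous_subtype_val.continuousAt (Metric.ball_mem_nhds _ hε), fun q hq q' hq' σ hσ => ?_⟩
    have := sc_convex (convex_ball (p : ℂ × ℂ) ε) ⟨_, Metric.mem_ball_self hε⟩
    have hqb : (q : ℂ × ℂ) ∈ Metric.ball (p : ℂ × ℂ) ε := by have := hσ 0; rwa [σ.source] at this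
    have hqb' : (q' : ℂ × ℂ) ∈ Metric.ball (p : ℂ × ℂ) ε := by have := hσ 1; rwa [σ.target] at this
    obtain ⟨τ, hτ⟩ := arc Metric.isOpen_ball (convex_ball (p : ℂ × ℂ) ε) hq hq' hqb hqb'
    have e := sc_hom' hb σ (lft τ fun t => hb (hτ t).1) hσ fun t => (hτ t).1
    rw [e]
    exact LC_path hH _ (fun t => (hτ t).2) (LC_ex q).choose_spec (LC_ex q').choose_spec

theorem main (x : UU) : Nonempty (FundamentalGroup UU x ≃* FreeGroup (Fin 2)) := by
  have : PathConnectedSpace UU := by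
    refine ⟨⟨o⟩, fun a b => ?_⟩
    obtain ⟨_, p, _⟩ := LC_ex a
    obtain ⟨_, q, _⟩ := LC_ex b
    exact ⟨p.symm.trans q⟩
  obtain ⟨a, b, ha, hb, hgen⟩ := start
  obtain ⟨e⟩ := free_of_gen a b ha hb fun g => by
    refine all_mem (H := Subgroup.closure {a, b}) (lin_all _ ?_) g
    intro γ hγ
    exact hgen γ fun t => by rw [hγ t, zero_mul]
  exact ⟨(FundamentalGroup.fundamentalGroupMulEquivOfPathConnected x o).trans e⟩

end final

end FG

/-- For `B₂ = {4, 4i}`, the fundamental group of `U_{B₂}` (at any basepoint) is free of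
rank 2. -/
theorem stmt0 (x : U ({4, 4 * Complex.I} : Set ℂ)) :
    Nonempty (FundamentalGroup (U ({4, 4 * Complex.I} : Set ℂ)) x ≃* FreeGroup (Fin 2)) := by
  exact FG.main x
end

section
/- Let B₁ = {4, −4} ⊂ ℂ. The fundamental group π₁(U_{B₁}) of the complement in ℂ² of the curve F_{B₁} = f⁻¹({4, −4}) is not a free group. -/
open Complex

/-- quartic -/
noncomputable def Qf (e : (ℂ × ℂ) × ℂ) : ℂ :=
  e.2 ^ 4 - 12 * (e.1.1 * e.1.2) * e.2 ^ 2 - 16 * (e.1.1 ^ 3 + e.1.2 ^ 3) * e.2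
    + 48 - 12 * (e.1.1 * e.1.2) ^ 2

noncomputable def Qd (e : (ℂ × ℂ) × ℂ) : ℂ :=
  4 * e.2 ^ 3 - 24 * (e.1.1 * e.1.2) * e.2 - 16 * (e.1.1 ^ 3 + e.1.2 ^ 3)

lemma Qd_ne {e : (ℂ × ℂ) × ℂ} (h : Qf e = 0) (hU : e.1 ∈ U ({4, -4} : Set ℂ)) : Qd e ≠ 0 := by
  obtain ⟨⟨x, y⟩, z⟩ := e
  intro h'
  simp only [Qf, Qd] at h h'
  apply hU
  have hu : x ^ 3 + y ^ 3 = (z ^ 3 - 6 * (x * y) * z) / 4 := by linear_combination -h' / 16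
  have hs : (z ^ 2 - 2 * (x * y) - 4) * (z ^ 2 - 2 * (x * y) + 4) = 0 := by
    rw [hu] at h
    linear_combination -h / 3
  have hf : f (x, y) = (x ^ 3 + y ^ 3) ^ 2 - 2 * (x * y) ^ 3 + 6 * (x * y) := by
    simp only [f]; ring
  rw [hu] at hf
  simp only [Set.mem_insert_iff, Set.mem_singleton_iff]
  rcases mul_eq_zero.1 hs with h1 | h1
  · left
    have hz : z ^ 2 = 2 * (x * y) + 4 := by linear_combination h1
    have : f (x, y) = z ^ 2 * (z ^ 2 - 6 * (x * y)) ^ 2 / 16 - 2 * (x * y) ^ 3 + 6 * (x * y) := by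
      rw [hf]; ring
    rw [this, hz]; ring
  · right
    have hz : z ^ 2 = 2 * (x * y) - 4 := by linear_combination h1
    have : f (x, y) = z ^ 2 * (z ^ 2 - 6 * (x * y)) ^ 2 / 16 - 2 * (x * y) ^ 3 + 6 * (x * y) := by
      rw [hf]; ring
    rw [this, hz]; ring

lemma Qf_cd : ContDiff ℂ 1 Qf := by unfold Qf; fun_prop

lemma Qf_cont : Continuous Qf := Qf_cd.continuous

lemma Qf_deriv (e : (ℂ × ℂ) × ℂ) : fderiv ℂ Qf e (0, 1) = Qd e := by
  have h1 : HasDerivAt (fun t : ℂ => Qf (e.1, t)) (fderiv ℂ Qf e (0, 1)) e.2 := by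
    have h2 : HasFDerivAt Qf (fderiv ℂ Qf e) (e.1, e.2) :=
      (Qf_cd.differentiable (by norm_num) e).hasFDerivAt
    exact h2.comp_hasDerivAt e.2 ((hasDerivAt_const e.2 e.1).prodMk (hasDerivAt_id e.2))
  refine h1.unique ?_
  simp only [Qf, Qd]
  have := (((((hasDerivAt_pow 4 e.2).sub ((hasDerivAt_pow 2 e.2).const_mul (12 * (e.1.1 * e.1.2)))).sub
    ((hasDerivAt_id e.2).const_mul (16 * (e.1.1 ^ 3 + e.1.2 ^ 3)))).add_const 48).sub_const
    (12 * (e.1.1 * e.1.2) ^ 2))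
  have h3 := this.congr_deriv (g' := 4 * e.2 ^ 3 - 24 * (e.1.1 * e.1.2) * e.2 -
    16 * (e.1.1 ^ 3 + e.1.2 ^ 3)) (by norm_num; ring)
  exact h3

def EE : Set ((ℂ × ℂ) × ℂ) := {e | Qf e = 0}

def pp : EE → ℂ × ℂ := fun e => e.1.1

lemma pp_cont : Continuous pp := by unfold pp; fun_prop

lemma pp_locHomeo : IsLocalHomeomorphOn pp (pp ⁻¹' (U ({4, -4} : Set ℂ))) := by
  apply IsLocalHomeomorphOn.mk
  rintro ⟨e, he⟩ hU
  have hd : Qd e ≠ 0 := Qd_ne he hU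
  set c := Qd e
  set L := fderiv ℂ Qf e
  have hL : ∀ v : (ℂ × ℂ) × ℂ, L v = L (v.1, 0) + v.2 * c := by
    intro v
    have : v = (v.1, 0) + v.2 • ((0 : ℂ × ℂ), (1 : ℂ)) := by ext <;> simp
    conv_lhs => rw [this]
    rw [map_add, map_smul, Qf_deriv, smul_eq_mul]
  let Φ : (ℂ × ℂ) × ℂ → (ℂ × ℂ) × ℂ := fun v => (v.1, Qf v)
  let DΦ : ((ℂ × ℂ) × ℂ) →L[ℂ] ((ℂ × ℂ) × ℂ) := (ContinuousLinearMap.fst ℂ (ℂ × ℂ) ℂ).prod L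
  let DI : ((ℂ × ℂ) × ℂ) →L[ℂ] ((ℂ × ℂ) × ℂ) := (ContinuousLinearMap.fst ℂ (ℂ × ℂ) ℂ).prod
    (c⁻¹ • (ContinuousLinearMap.snd ℂ (ℂ × ℂ) ℂ -
      L.comp ((ContinuousLinearMap.inl ℂ (ℂ × ℂ) ℂ).comp (ContinuousLinearMap.fst ℂ (ℂ × ℂ) ℂ))))
  let DE : ((ℂ × ℂ) × ℂ) ≃L[ℂ] ((ℂ × ℂ) × ℂ) := ContinuousLinearEquiv.equivOfInverse DΦ DI
    (by
      intro v
      refine Prod.ext rfl ?_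
      change c⁻¹ * (L v - L (v.1, 0)) = v.2
      rw [hL v]; field_simp; ring)
    (by
      intro v
      refine Prod.ext rfl ?_
      change L (v.1, c⁻¹ * (v.2 - L (v.1, 0))) = v.2
      rw [hL]; field_simp; ring)
  have hΦ : HasStrictFDerivAt Φ (DE : ((ℂ × ℂ) × ℂ) →L[ℂ] ((ℂ × ℂ) × ℂ)) e := by
    have : HasStrictFDerivAt Qf L e := Qf_cd.contDiffAt.hasStrictFDerivAt (by norm_num)
    exact hasStrictFDerivAt_fst.prodMk this
  let φ := hΦ.toOpenPartialHomeomorph Φ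
  have hφ : ∀ v, φ v = (v.1, Qf v) := fun v => rfl
  have hes : e ∈ φ.source := hΦ.mem_toOpenPartialHomeomorph_source
  have hinv : ∀ v : ℂ × ℂ, (v, (0:ℂ)) ∈ φ.target → Qf (φ.symm (v, 0)) = 0 ∧ (φ.symm (v, 0)).1 = v := by
    intro v hv
    have := φ.right_inv hv
    rw [hφ] at this
    exact ⟨congrArg Prod.snd this, congrArg Prod.fst this⟩
  classical
  let g : ℂ × ℂ → EE := fun v => if h : (v, (0:ℂ)) ∈ φ.target then ⟨φ.symm (v, 0), (hinv v h).1⟩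
    else ⟨e, he⟩
  have hg : ∀ v, (v, (0:ℂ)) ∈ φ.target → (g v : (ℂ × ℂ) × ℂ) = φ.symm (v, 0) := by
    intro v h; simp only [g, dif_pos h]
  have hpt : ∀ z : EE, φ z = (pp z, 0) := by
    intro z; rw [hφ]; exact Prod.ext rfl z.2
  refine ⟨⟨⟨⟨pp, g, {z | (z : (ℂ × ℂ) × ℂ) ∈ φ.source}, {v | (v, (0:ℂ)) ∈ φ.target}, ?_, ?_, ?_, ?_⟩,
    ?_, ?_⟩, ?_, ?_⟩, hes, fun _ _ => rfl⟩
  · intro z hz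
    have := φ.map_source hz
    rwa [hpt] at this
  · intro v hv
    change ((g v : EE) : (ℂ × ℂ) × ℂ) ∈ φ.source
    rw [hg v hv]; exact φ.map_target hv
  · intro z hz
    have h1 := φ.map_source hz
    rw [hpt] at h1
    apply Subtype.ext
    rw [hg _ h1, ← hpt]; exact φ.left_inv hz
  · intro v hv
    change ((g v : EE) : (ℂ × ℂ) × ℂ).1 = v
    rw [hg v hv]; exact (hinv v hv).2
  · exact pp_cont.continuousOn
  · rw [Topology.IsInducing.subtypeVal.continuousOn_iff]
    refine ContinuousOn.congr (f := fun v => φ.symm (v, 0)) ?_ (fun v hv => hg v hv)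
    exact φ.continuousOn_symm.comp (by fun_prop) (fun v hv => hv)
  · exact φ.open_source.preimage continuous_subtype_val
  · exact φ.open_target.preimage (f := fun v : ℂ × ℂ => (v, (0:ℂ))) (by fun_prop)

lemma root_bound {a b c z : ℂ} (h : z ^ 4 - a * z ^ 2 - b * z + c = 0) :
    ‖z‖ ≤ 1 + ‖a‖ + ‖b‖ + ‖c‖ := by
  by_contra! hlt
  have h1 : ‖z‖ ^ 4 ≤ ‖a‖ * ‖z‖ ^ 2 + ‖b‖ * ‖z‖ + ‖c‖ := by
    have : z ^ 4 = a * z ^ 2 + b * z - c := by linear_combination h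
    calc ‖z‖ ^ 4 = ‖a * z ^ 2 + b * z - c‖ := by rw [← this, norm_pow]
      _ ≤ _ := (norm_sub_le _ _).trans (by
        gcongr
        refine (norm_add_le _ _).trans ?_
        simp)
  have ha := norm_nonneg a
  have hb := norm_nonneg b
  have hc := norm_nonneg c
  set r := ‖z‖
  have hr : 1 < r := by linarith
  have h2 : r ≤ r ^ 3 := by nlinarith [sq_nonneg (r-1), mul_pos (by linarith : (0:ℝ) < r) (by nlinarith : (0:ℝ) < r^2-1)]
  have h3 : r ^ 2 ≤ r ^ 3 := by nlinarith [sq_nonneg r]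
  have h4 : 1 ≤ r ^ 3 := by linarith
  have h5 : r ^ 4 ≤ (‖a‖ + ‖b‖ + ‖c‖) * r ^ 3 := by
    nlinarith [mul_le_mul_of_nonneg_left h2 hb, mul_le_mul_of_nonneg_left h3 ha, mul_le_mul_of_nonneg_left h4 hc]
  have h6 : (‖a‖ + ‖b‖ + ‖c‖) * r ^ 3 < r * r ^ 3 := by
    apply mul_lt_mul_of_pos_right <;> linarith
  nlinarith

lemma pp_fiber_finite (x : ℂ × ℂ) : (pp ⁻¹' {x}).Finite := by
  let P : Polynomial ℂ := .X ^ 4 - .C (12 * (x.1 * x.2)) * .X ^ 2 - .C (16 * (x.1 ^ 3 + x.2 ^ 3)) * .X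
    + .C (48 - 12 * (x.1 * x.2) ^ 2)
  have hP : P ≠ 0 := by
    intro h
    have := congrArg (fun p => Polynomial.coeff p 4) h
    simp only [P, Polynomial.coeff_add, Polynomial.coeff_sub, Polynomial.coeff_C_mul,
      Polynomial.coeff_X_pow, Polynomial.coeff_X, Polynomial.coeff_C, Polynomial.coeff_zero] at this
    norm_num at this
  refine Set.Finite.of_finite_image (f := fun e : EE => e.1.2) ((P.finite_setOfPred_isRoot hP).subset ?_) ?_
  · rintro _ ⟨⟨⟨v, z⟩, he⟩, hx, rfl⟩
    have hx : v = x := hx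
    subst hx
    have : Qf (v, z) = 0 := he
    simp only [Qf] at this
    simp only [Set.mem_ofPred_eq, Polynomial.IsRoot, P, Polynomial.eval_add, Polynomial.eval_sub, Polynomial.eval_mul, Polynomial.eval_pow, Polynomial.eval_X, Polynomial.eval_C]
    linear_combination this
  · intro a ha b hb hab
    exact Subtype.ext (Prod.ext ((show pp a = x from ha).trans (show pp b = x from hb).symm) hab)

lemma pp_closed : IsClosedMap pp := by
  apply IsProperMap.isClosedMap
  rw [isProperMap_iff_isCompact_preimage]
  refine ⟨pp_cont, fun K hK => ?_⟩
  obtain ⟨R, hR⟩ : ∃ R : ℝ, ∀ v ∈ K, 1 + ‖12 * (v.1 * v.2)‖ + ‖16 * (v.1 ^ 3 + v.2 ^ 3)‖ +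
      ‖48 - 12 * (v.1 * v.2) ^ 2‖ ≤ R := by
    obtain ⟨R, hR⟩ := (hK.image (f := fun v : ℂ × ℂ => 1 + ‖12 * (v.1 * v.2)‖ + ‖16 * (v.1 ^ 3 + v.2 ^ 3)‖ +
      ‖48 - 12 * (v.1 * v.2) ^ 2‖) (by fun_prop)).bddAbove
    exact ⟨R, fun v hv => hR ⟨v, hv, rfl⟩⟩
  have hEc : IsClosed EE := isClosed_singleton.preimage Qf_cont
  rw [Topology.IsInducing.subtypeVal.isCompact_iff]
  have h1 : IsCompact ((K ×ˢ Metric.closedBall (0:ℂ) R) ∩ EE) :=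
    (hK.prod (isCompact_closedBall 0 R)).inter_right hEc
  convert h1 using 1
  ext ⟨v, z⟩
  constructor
  · rintro ⟨⟨e, he⟩, hx, rfl⟩
    refine ⟨⟨hx, ?_⟩, he⟩
    rw [mem_closedBall_zero_iff]
    refine le_trans (root_bound ?_) (hR v hx)
    have : Qf (v, z) = 0 := he
    simp only [Qf] at this
    linear_combination this
  · rintro ⟨⟨h1, h2⟩, h3⟩
    exact ⟨⟨_, h3⟩, h1, rfl⟩

lemma pp_covOn : IsCoveringMapOn pp (U ({4, -4} : Set ℂ)) :=
  pp_closed.isCoveringMapOn_of_isLocalHomeomorphOn (fun x _ => pp_fiber_finite x) pp_locHomeo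

lemma pp_cov : IsCoveringMap ((U ({4, -4} : Set ℂ)).restrictPreimage pp) :=
  pp_covOn.isCoveringMap_restrictPreimage

lemma U_path : IsPathConnected (U ({4, -4} : Set ℂ)) := by
  rw [isPathConnected_iff]
  refine ⟨⟨(0, 0), by simp [U, f]⟩, ?_⟩
  intro p hp q hq
  let ℓ : ℂ → ℂ × ℂ := fun t => (p.1 + t * (q.1 - p.1), p.2 + t * (q.2 - p.2))
  let X : Polynomial ℂ := .C p.1 + .X * .C (q.1 - p.1)
  let Y : Polynomial ℂ := .C p.2 + .X * .C (q.2 - p.2)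
  let P : Polynomial ℂ := (X ^ 6 + Y ^ 6 + 6 * X * Y) ^ 2 - 16
  have hPe : ∀ t, P.eval t = f (ℓ t) ^ 2 - 16 := by
    intro t
    simp [P, X, Y, ℓ, f]
  have hmem : ∀ v, v ∈ U ({4, -4} : Set ℂ) ↔ f v ^ 2 - 16 ≠ 0 := by
    intro v
    have : f v ^ 2 - 16 = (f v - 4) * (f v + 4) := by ring
    rw [this, mul_ne_zero_iff, sub_ne_zero, ← sub_neg_eq_add, sub_ne_zero]
    simp [U]
  have h0 : ℓ 0 = p := by simp [ℓ]
  have h1 : ℓ 1 = q := by simp [ℓ]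
  have hP : P ≠ 0 := by
    intro h
    have := hPe 0
    rw [h, h0] at this
    exact (hmem p).1 hp (by simpa using this.symm)
  have hc : {t | P.IsRoot t}.Countable := (P.finite_setOfPred_isRoot hP).countable
  have hpc := hc.isPathConnected_compl_of_one_lt_rank (by rw [Complex.rank_real_complex]; norm_num)
  have hj := hpc.joinedIn 0 (by
    simp only [Set.mem_compl_iff, Set.mem_ofPred_eq, Polynomial.IsRoot, hPe, h0]; exact (hmem p).1 hp) 1 (by
    simp only [Set.mem_compl_iff, Set.mem_ofPred_eq, Polynomial.IsRoot, hPe, h1]; exact (hmem q).1 hq)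
  have hℓ : Continuous ℓ := by fun_prop
  have := hj.map hℓ
  rw [h0, h1] at this
  refine this.mono ?_
  rintro _ ⟨t, ht, rfl⟩
  simp only [Set.mem_compl_iff, Set.mem_ofPred_eq, Polynomial.IsRoot, hPe] at ht
  exact (hmem _).2 ht

lemma free_comm {G : Type} [Group G] [IsFreeGroup G] (a b : G) (h : a * b = b * a) :
    ∃ d : G, a ∈ Subgroup.zpowers d ∧ b ∈ Subgroup.zpowers d := by
  let H := Subgroup.closure ({a, b} : Set G)
  have hcomm : ∀ x y : H, x * y = y * x := by
    have := Subgroup.isMulCommutative_closure (k := ({a, b} : Set G)) (by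
      rintro x (rfl | rfl) y (rfl | rfl) <;> first | rfl | exact h | exact h.symm)
    intro x y
    exact this.is_comm.comm x y
  have hs : Subsingleton (IsFreeGroup.Generators H) := by
    constructor
    intro x y
    by_contra hxy
    classical
    have h1 := hcomm (IsFreeGroup.of x) (IsFreeGroup.of y)
    let φ : H →* Equiv.Perm (Fin 3) := IsFreeGroup.lift (fun z => if z = x then Equiv.swap 0 1 else Equiv.swap 1 2)
    have h2 := congrArg φ h1
    simp only [φ, map_mul, IsFreeGroup.lift_of, if_true, if_neg (Ne.symm hxy)] at h2
    revert h2; decide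
  have hcyc : IsCyclic H := by
    have e := IsFreeGroup.toFreeGroup H
    rcases isEmpty_or_nonempty (IsFreeGroup.Generators H) with hE | ⟨⟨x⟩⟩
    · exact isCyclic_of_surjective e.symm e.symm.surjective
    · have : Unique (IsFreeGroup.Generators H) := ⟨⟨x⟩, fun y => Subsingleton.elim _ _⟩
      exact isCyclic_of_surjective e.symm e.symm.surjective
  obtain ⟨d, hd⟩ := hcyc.exists_generator
  refine ⟨d, ?_, ?_⟩
  · obtain ⟨k, hk⟩ := hd ⟨a, Subgroup.subset_closure (by simp)⟩
    exact ⟨k, by simpa using congrArg Subtype.val hk⟩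
  · obtain ⟨k, hk⟩ := hd ⟨b, Subgroup.subset_closure (by simp)⟩
    exact ⟨k, by simpa using congrArg Subtype.val hk⟩

lemma cyc_invol {G : Type} [Group G] (d A B : G) (hA : A ∈ Subgroup.zpowers d)
    (hB : B ∈ Subgroup.zpowers d) (hA2 : A * A = 1) (hB2 : B * B = 1) (hA1 : A ≠ 1) (hB1 : B ≠ 1) :
    A = B := by
  obtain ⟨j, rfl⟩ := hA
  obtain ⟨k, rfl⟩ := hB
  simp only [← zpow_add] at hA2 hB2
  rw [← orderOf_dvd_iff_zpow_eq_one] at hA2 hB2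
  rw [Ne, ← orderOf_dvd_iff_zpow_eq_one] at hA1 hB1
  obtain ⟨p, hp⟩ := hA2
  obtain ⟨q, hq⟩ := hB2
  have hpo : ¬ Even p := by
    rintro ⟨r, rfl⟩
    exact hA1 ⟨r, by linarith⟩
  have hqo : ¬ Even q := by
    rintro ⟨r, rfl⟩
    exact hB1 ⟨r, by linarith⟩
  obtain ⟨r, hr⟩ : Even (p - q) := by
    rw [Int.even_sub]; tauto
  have : (j - k) = orderOf d * r := by
    have : 2 * (j - k) = orderOf d * (p - q) := by linarith
    rw [hr] at this; linarith
  simp only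
  rw [← mul_inv_eq_one, ← zpow_neg, ← zpow_add, ← orderOf_dvd_iff_zpow_eq_one]
  exact ⟨r, by linarith⟩

/-- local parametrisation -/
lemma torus_param : ∃ η : ℝ, 0 < η ∧ η ≤ 1 ∧ ∃ x y m : ℂ × ℂ → ℂ,
    ContinuousOn x (Metric.closedBall 0 η) ∧ ContinuousOn y (Metric.closedBall 0 η) ∧
    ContinuousOn m (Metric.closedBall 0 η) ∧
    ∀ v ∈ Metric.closedBall (0 : ℂ × ℂ) η, m v ≠ 0 ∧ ∃ N : ℂ, N ^ 2 = 576 - 12 * (v.1 * v.2) ∧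
      m v ^ 2 = (v.1 + v.2 + N) / 4 ∧ x v * y v = (N + 3 * (v.1 + v.2)) / 24 ∧
      x v ^ 3 + y v ^ 3 = m v * (v.1 - v.2) / 8 := by
  let N : ℂ × ℂ → ℂ := fun v => 24 * (1 - v.1 * v.2 / 48) ^ (((2:ℕ) : ℂ)⁻¹)
  let m : ℂ × ℂ → ℂ := fun v => ((v.1 + v.2 + N v) / 4) ^ (((2:ℕ) : ℂ)⁻¹)
  let s : ℂ × ℂ → ℂ := fun v => (N v + 3 * (v.1 + v.2)) / 24
  let u : ℂ × ℂ → ℂ := fun v => m v * (v.1 - v.2) / 8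
  let r : ℂ × ℂ → ℂ := fun v => (s v ^ 3 - u v ^ 2 / 4) ^ (((2:ℕ) : ℂ)⁻¹)
  let x : ℂ × ℂ → ℂ := fun v => I * (r v + I * u v / 2) ^ (((3:ℕ) : ℂ)⁻¹)
  let y : ℂ × ℂ → ℂ := fun v => s v / x v
  have N0 : N 0 = 24 := by simp [N]
  have m0' : (((0 : ℂ × ℂ).1 + (0 : ℂ × ℂ).2 + N 0) / 4) = 6 := by rw [N0]; norm_num
  have s0 : s 0 = 1 := by simp [s, N0]
  have u0 : u 0 = 0 := by simp [u]
  have r0 : r 0 = 1 := by simp [r, s0, u0]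
  have x0 : x 0 = I := by simp [x, r0, u0]
  have m0 : m 0 ≠ 0 := by
    intro h
    have := cpow_nat_inv_pow ((((0 : ℂ × ℂ).1 + (0 : ℂ × ℂ).2 + N 0) / 4)) (two_ne_zero)
    change m 0 ^ 2 = _ at this
    rw [h, m0'] at this; norm_num at this
  have aN : AnalyticAt ℂ N 0 := by
    refine analyticAt_const.mul (AnalyticAt.cpow ?_ analyticAt_const ?_)
    · fun_prop
    · simp
  have am : AnalyticAt ℂ m 0 := by
    refine AnalyticAt.cpow ?_ analyticAt_const ?_
    · exact ((analyticAt_fst.add analyticAt_snd).add aN).div analyticAt_const (by norm_num)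
    · rw [m0']; simp [slitPlane]
  have as : AnalyticAt ℂ s 0 := by
    exact (aN.add (analyticAt_const.mul (analyticAt_fst.add analyticAt_snd))).div analyticAt_const (by norm_num)
  have au : AnalyticAt ℂ u 0 := by
    exact (am.mul (analyticAt_fst.sub analyticAt_snd)).div analyticAt_const (by norm_num)
  have ar : AnalyticAt ℂ r 0 := by
    refine AnalyticAt.cpow ?_ analyticAt_const ?_
    · fun_prop (disch := norm_num)
    · simp [s0, u0]
  have ax : AnalyticAt ℂ x 0 := by
    refine analyticAt_const.mul (AnalyticAt.cpow ?_ analyticAt_const ?_)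
    · fun_prop (disch := norm_num)
    · simp [r0, u0]
  have ay : AnalyticAt ℂ y 0 := as.div ax (by rw [x0]; exact I_ne_zero)
  have hx0 : ∀ᶠ v in nhds (0 : ℂ × ℂ), x v ≠ 0 :=
    ax.continuousAt.eventually_ne (by rw [x0]; exact I_ne_zero)
  have hm0 : ∀ᶠ v in nhds (0 : ℂ × ℂ), m v ≠ 0 := am.continuousAt.eventually_ne m0
  obtain ⟨ε, hε, hb⟩ := Metric.nhds_basis_closedBall.eventually_iff.1
    (((ax.eventually_analyticAt.and ay.eventually_analyticAt).and am.eventually_analyticAt).and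
      (hx0.and hm0))
  have hsub : Metric.closedBall (0 : ℂ × ℂ) (min ε 1) ⊆ Metric.closedBall 0 ε :=
    Metric.closedBall_subset_closedBall (min_le_left _ _)
  refine ⟨min ε 1, by positivity, min_le_right _ _, x, y, m,
    fun v hv => (hb (hsub hv)).1.1.1.continuousAt.continuousWithinAt,
    fun v hv => (hb (hsub hv)).1.1.2.continuousAt.continuousWithinAt,
    fun v hv => (hb (hsub hv)).1.2.continuousAt.continuousWithinAt, ?_⟩
  intro v hv
  obtain ⟨hxv, hmv⟩ := (hb (hsub hv)).2
  have hN : N v ^ 2 = 576 - 12 * (v.1 * v.2) := by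
    simp only [N]; rw [mul_pow, cpow_nat_inv_pow _ two_ne_zero]; ring
  have hm : m v ^ 2 = (v.1 + v.2 + N v) / 4 := cpow_nat_inv_pow _ two_ne_zero
  have hxy : x v * y v = s v := by simp only [y]; field_simp
  have hr : r v ^ 2 = s v ^ 3 - u v ^ 2 / 4 := cpow_nat_inv_pow _ two_ne_zero
  have hx3 : x v ^ 3 = u v / 2 - I * r v := by
    simp only [x]; rw [mul_pow, cpow_nat_inv_pow _ three_ne_zero, I_pow_three]
    linear_combination (-u v / 2) * I_sq
  refine ⟨hmv, N v, hN, hm, hxy, ?_⟩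
  change _ = u v
  have h3 : x v ^ 3 * (x v ^ 3 + y v ^ 3 - u v) = 0 := by
    have : x v ^ 3 * y v ^ 3 = s v ^ 3 := by rw [← mul_pow, hxy]
    have h4 : (x v ^ 3) ^ 2 - u v * x v ^ 3 + s v ^ 3 = 0 := by
      rw [hx3]
      linear_combination -hr + (r v) ^ 2 * I_sq
    linear_combination h4 + this
  have := (mul_eq_zero.1 h3).resolve_left (pow_ne_zero _ hxv)
  linear_combination this

abbrev U4 : Set (ℂ × ℂ) := U ({4, -4} : Set ℂ)

abbrev qq : (pp ⁻¹' U4) → U4 := U4.restrictPreimage pp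

def fval {p : U4} (e : qq ⁻¹' {p}) : ℂ := e.1.1.1.2

lemma fval_root {p : U4} (e : qq ⁻¹' {p}) : Qf (p.1, fval e) = 0 := by
  obtain ⟨⟨⟨⟨v, z⟩, h⟩, hv⟩, hp⟩ := e
  have : v = p.1 := congrArg Subtype.val hp
  subst this
  exact h

lemma fval_inj {p : U4} (e e' : qq ⁻¹' {p}) (h : fval e = fval e') : e = e' := by
  obtain ⟨⟨⟨⟨v, z⟩, h1⟩, hv⟩, hp⟩ := e
  obtain ⟨⟨⟨⟨v', z'⟩, h1'⟩, hv'⟩, hp'⟩ := e'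
  have : v = p.1 := congrArg Subtype.val hp
  have : v' = p.1 := congrArg Subtype.val hp'
  have : z = z' := h
  subst_vars
  rfl

lemma fval_ex {p : U4} (z : ℂ) (h : Qf (p.1, z) = 0) : ∃ e : qq ⁻¹' {p}, fval e = z :=
  ⟨⟨⟨⟨(p.1, z), h⟩, p.2⟩, rfl⟩, rfl⟩

lemma mono_val {p : U4} (γ : Path p p) (z : unitInterval → ℂ) (hz : Continuous z)
    (hQ : ∀ t, Qf ((γ t).1, z t) = 0) (e : qq ⁻¹' {p}) (he : fval e = z 0) :
    fval (pp_cov.monodromy (Path.Homotopic.Quotient.mk γ) e) = z 1 := by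
  let Γ : C(unitInterval, (pp ⁻¹' U4)) :=
    ⟨fun t => ⟨⟨((γ t).1, z t), hQ t⟩, (γ t).2⟩, by fun_prop⟩
  have hs : (γ : C(unitInterval, U4)) 0 = qq e.1 := γ.source.trans e.2.symm
  have h := (pp_cov.eq_liftPath_iff' (γ := γ) (e := e.1) hs (Γ := Γ)).2 ⟨by ext t <;> rfl, by
    have h0 : e = ⟨Γ 0, by
        change (⟨(γ 0).1, (γ 0).2⟩ : U4) = p
        exact γ.source⟩ := fval_inj _ _ he
    rw [h0]⟩
  change (pp_cov.liftPath γ e.1 hs 1).1.1.2 = z 1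
  rw [← h]
  rfl

lemma fact_id {x y m D E N : ℂ} (hN : N ^ 2 = 576 - 12 * (D * E)) (hm : m ^ 2 = (D + E + N) / 4)
    (hs : x * y = (N + 3 * (D + E)) / 24) (hu : x ^ 3 + y ^ 3 = m * (D - E) / 8) (z : ℂ) :
    Qf ((x, y), z) = ((z - m) ^ 2 - D) * ((z + m) ^ 2 - E) := by
  simp only [Qf]
  rw [hs, hu]
  linear_combination (2 * z ^ 2 + (D + E) - (m ^ 2 + (D + E + N) / 4)) * hm - hN / 12

lemma mem_U {x y m D E N : ℂ} (hN : N ^ 2 = 576 - 12 * (D * E)) (hm : m ^ 2 = (D + E + N) / 4)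
    (hs : x * y = (N + 3 * (D + E)) / 24) (hu : x ^ 3 + y ^ 3 = m * (D - E) / 8)
    (hD : D ≠ 0) (hE : E ≠ 0) (hDE : D * E ≠ 36) : (x, y) ∈ U4 := by
  have hf : f (x, y) = (x ^ 3 + y ^ 3) ^ 2 - 2 * (x * y) ^ 3 + 6 * (x * y) := by
    simp only [f]; ring
  have hf1 : f (x, y) = N * (12 - D * E) / 72 := by
    rw [hf, hs, hu]
    linear_combination (D - E) ^ 2 / 64 * hm - (N + 9 * (D + E)) / 6912 * hN
  have hf2 : f (x, y) ^ 2 - 16 = - (D * E) * (36 - D * E) ^ 2 / 432 := by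
    rw [hf1]
    linear_combination (12 - D * E) ^ 2 / 5184 * hN
  have hne : f (x, y) ^ 2 - 16 ≠ 0 := by
    rw [hf2]
    have : 36 - D * E ≠ 0 := sub_ne_zero.2 hDE.symm
    simp [hD, hE, this]
  rintro (h | h)
  · apply hne; rw [h]; norm_num
  · apply hne; rw [h]; norm_num

noncomputable def ell : Path (1 : Circle) 1 where
  toFun t := Circle.exp (2 * Real.pi * t)
  continuous_toFun := by fun_prop
  source' := by simp
  target' := by simp

lemma torus_comm {X : Type} [TopologicalSpace X] (τ : C(Circle × Circle, X)) :
    ∃ a b : FundamentalGroup X (τ (1, 1)), a * b = b * a ∧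
      a = Path.Homotopic.Quotient.mk ((ell.prod (Path.refl 1)).map τ.continuous) ∧
      b = Path.Homotopic.Quotient.mk (((Path.refl 1).prod ell).map τ.continuous) := by
  let a' : FundamentalGroup (Circle × Circle) (1, 1) :=
    Path.Homotopic.Quotient.mk (ell.prod (Path.refl 1))
  let b' : FundamentalGroup (Circle × Circle) (1, 1) :=
    Path.Homotopic.Quotient.mk ((Path.refl 1).prod ell)
  have h : a' * b' = b' * a' := by
    rw [FundamentalGroup.mul_def, FundamentalGroup.mul_def]
    change Path.Homotopic.Quotient.trans (Path.Homotopic.prod (.mk (Path.refl 1)) (.mk ell))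
        (Path.Homotopic.prod (.mk ell) (.mk (Path.refl 1))) =
      Path.Homotopic.Quotient.trans (Path.Homotopic.prod (.mk ell) (.mk (Path.refl 1)))
        (Path.Homotopic.prod (.mk (Path.refl 1)) (.mk ell))
    rw [Path.Homotopic.comp_prod_eq_prod_comp, Path.Homotopic.comp_prod_eq_prod_comp]
    have h1 : (Path.Homotopic.Quotient.mk (Path.refl (1 : Circle))) = .refl 1 := rfl
    rw [h1]
    simp
  refine ⟨FundamentalGroup.map τ (1, 1) a', FundamentalGroup.map τ (1, 1) b', ?_, rfl, rfl⟩
  rw [← map_mul, h, map_mul]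

lemma perm_facts {α : Type} (g : α → ℂ) (ginj : ∀ e e', g e = g e' → e = e') (σ : Equiv.Perm α)
    (m c : ℂ) (hroot : ∀ e, g e = m + c ∨ g e = m - c ∨ g e = -m + c ∨ g e = -m - c)
    (h1 : ∀ e, g e = m + c → g (σ e) = m - c) (h2 : ∀ e, g e = m - c → g (σ e) = m + c)
    (h3 : ∀ e, g e = -m + c → g (σ e) = -m + c) (h4 : ∀ e, g e = -m - c → g (σ e) = -m - c) :
    σ * σ = 1 := by
  ext e
  apply ginj
  change g (σ (σ e)) = g e
  rcases hroot e with h | h | h | h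
  · rw [h2 _ (h1 _ h), h]
  · rw [h1 _ (h2 _ h), h]
  · rw [h3 _ (h3 _ h), h]
  · rw [h4 _ (h4 _ h), h]

lemma key : ∃ p : U4, ∃ a b : FundamentalGroup U4 p, a * b = b * a ∧
    ∃ ρ : FundamentalGroup U4 p →* Equiv.Perm (qq ⁻¹' {p}),
      ρ a * ρ a = 1 ∧ ρ b * ρ b = 1 ∧ ρ a ≠ 1 ∧ ρ b ≠ 1 ∧ ρ a ≠ ρ b := by
  obtain ⟨η, hη, hη1, x, y, m, hx, hy, hm, H⟩ := torus_param
  let V : Circle × Circle → ℂ × ℂ := fun w => (η * w.1, η * w.2)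
  have hVc : Continuous V := by fun_prop
  have hVb : ∀ w, V w ∈ Metric.closedBall (0 : ℂ × ℂ) η := by
    intro w
    rw [mem_closedBall_zero_iff, Prod.norm_def]
    simp [V, abs_of_pos hη, Circle.norm_coe]
  have hηc : (η : ℂ) ≠ 0 := by exact_mod_cast hη.ne'
  have hV1 : ∀ w, (V w).1 ≠ 0 := fun w => mul_ne_zero hηc (Circle.coe_ne_zero _)
  have hV2 : ∀ w, (V w).2 ≠ 0 := fun w => mul_ne_zero hηc (Circle.coe_ne_zero _)
  have hV36 : ∀ w, (V w).1 * (V w).2 ≠ 36 := by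
    intro w h
    have := congrArg norm h
    simp [V, abs_of_pos hη, Circle.norm_coe] at this
    nlinarith
  have hmem : ∀ w, (x (V w), y (V w)) ∈ U4 := by
    intro w
    obtain ⟨-, N, h1, h2, h3, h4⟩ := H _ (hVb w)
    exact mem_U h1 h2 h3 h4 (hV1 w) (hV2 w) (hV36 w)
  have hfac : ∀ w z, Qf ((x (V w), y (V w)), z) =
      ((z - m (V w)) ^ 2 - (V w).1) * ((z + m (V w)) ^ 2 - (V w).2) := by
    intro w z
    obtain ⟨-, N, h1, h2, h3, h4⟩ := H _ (hVb w)
    exact fact_id h1 h2 h3 h4 z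
  have hxc : Continuous fun w => x (V w) := hx.comp_continuous hVc hVb
  have hyc : Continuous fun w => y (V w) := hy.comp_continuous hVc hVb
  have hmc : Continuous fun w => m (V w) := hm.comp_continuous hVc hVb
  let τ : C(Circle × Circle, U4) := ⟨fun w => ⟨(x (V w), y (V w)), hmem w⟩, (hxc.prodMk hyc).subtype_mk _⟩
  obtain ⟨a, b, hab, ha, hb⟩ := torus_comm τ
  let c : ℂ := (Real.sqrt η : ℝ)
  have hc2 : c ^ 2 = η := by
    simp only [c]; rw [← ofReal_pow, Real.sq_sqrt hη.le]
  have hc0 : c ≠ 0 := by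
    intro h; rw [h] at hc2; exact hηc (by rw [← hc2]; simp)
  let M := m (V (1, 1))
  have hM0 : M ≠ 0 := (H _ (hVb (1,1))).1
  let ρ := pp_cov.monodromyPerm (τ (1, 1))
  let h : unitInterval → ℂ := fun t => exp (Real.pi * (t : ℝ) * I)
  have hh : Continuous h := by fun_prop
  have hh2 : ∀ t, h t ^ 2 = (ell t : ℂ) := by
    intro t
    change exp _ ^ 2 = ((Circle.exp (2 * Real.pi * (t : ℝ)) : Circle) : ℂ)
    rw [Circle.coe_exp, ← exp_nat_mul]
    congr 1
    push_cast; ring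
  have hh0 : h 0 = 1 := by simp [h]
  have hh1 : h 1 = -1 := by simp [h]
  have hca : Continuous fun t => m (V (ell t, 1)) :=
    hmc.comp (f := fun t : unitInterval => (ell t, (1 : Circle))) (by fun_prop)
  have hcb : Continuous fun t => m (V (1, ell t)) :=
    hmc.comp (f := fun t : unitInterval => ((1 : Circle), ell t)) (by fun_prop)
  -- lifts of a
  have A1 : ∀ ε : ℂ, ε ^ 2 = 1 → ∀ e : qq ⁻¹' {τ (1, 1)}, fval e = M + ε * c →
      fval (ρ a e) = M - ε * c := by
    intro ε hε e he
    have := mono_val ((ell.prod (Path.refl 1)).map τ.continuous)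
      (fun t => m (V (ell t, 1)) + ε * c * h t) (hca.add (continuous_const.mul hh)) (by
        intro t
        change Qf ((x (V (ell t, 1)), y (V (ell t, 1))), _) = 0
        rw [hfac]
        apply mul_eq_zero_of_left
        change _ - (η : ℂ) * (ell t) = 0
        rw [← hh2, ← hc2]
        linear_combination c ^ 2 * h t ^ 2 * hε) e (by simp [hh0, he, M])
    rw [← ha] at this
    refine this.trans ?_
    simp [hh1, M]; ring
  have A2 : ∀ ε : ℂ, ε ^ 2 = 1 → ∀ e : qq ⁻¹' {τ (1, 1)}, fval e = -M + ε * c →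
      fval (ρ a e) = -M + ε * c := by
    intro ε hε e he
    have := mono_val ((ell.prod (Path.refl 1)).map τ.continuous)
      (fun t => -m (V (ell t, 1)) + ε * c) (hca.neg.add continuous_const) (by
        intro t
        change Qf ((x (V (ell t, 1)), y (V (ell t, 1))), _) = 0
        rw [hfac]
        apply mul_eq_zero_of_right
        change _ - (η : ℂ) * ((1 : Circle) : ℂ) = 0
        rw [← hc2, Circle.coe_one]
        linear_combination c ^ 2 * hε) e (by simp [he, M])
    rw [← ha] at this
    refine this.trans ?_
    simp [M]
  have B1 : ∀ ε : ℂ, ε ^ 2 = 1 → ∀ e : qq ⁻¹' {τ (1, 1)}, fval e = M + ε * c →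
      fval (ρ b e) = M + ε * c := by
    intro ε hε e he
    have := mono_val (((Path.refl 1).prod ell).map τ.continuous)
      (fun t => m (V (1, ell t)) + ε * c) (hcb.add continuous_const) (by
        intro t
        change Qf ((x (V (1, ell t)), y (V (1, ell t))), _) = 0
        rw [hfac]
        apply mul_eq_zero_of_left
        change _ - (η : ℂ) * ((1 : Circle) : ℂ) = 0
        rw [← hc2, Circle.coe_one]
        linear_combination c ^ 2 * hε) e (by simp [he, M])
    rw [← hb] at this
    refine this.trans ?_
    simp [M]
  have B2 : ∀ ε : ℂ, ε ^ 2 = 1 → ∀ e : qq ⁻¹' {τ (1, 1)}, fval e = -M + ε * c →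
      fval (ρ b e) = -M - ε * c := by
    intro ε hε e he
    have := mono_val (((Path.refl 1).prod ell).map τ.continuous)
      (fun t => -m (V (1, ell t)) + ε * c * h t) (hcb.neg.add (continuous_const.mul hh)) (by
        intro t
        change Qf ((x (V (1, ell t)), y (V (1, ell t))), _) = 0
        rw [hfac]
        apply mul_eq_zero_of_right
        change _ - (η : ℂ) * (ell t) = 0
        rw [← hh2, ← hc2]
        linear_combination c ^ 2 * h t ^ 2 * hε) e (by simp [hh0, he, M])
    rw [← hb] at this
    refine this.trans ?_
    simp [hh1, M]; ring
  have hfac1 : ∀ z, Qf ((τ (1, 1)).1, z) = ((z - M) ^ 2 - c ^ 2) * ((z + M) ^ 2 - c ^ 2) := by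
    intro z
    have h1 : (V (1, 1)).1 = c ^ 2 := by simp [V, hc2]
    have h2 : (V (1, 1)).2 = c ^ 2 := by simp [V, hc2]
    have := hfac (1, 1) z
    rw [h1, h2] at this
    exact this
  have hroot : ∀ e : qq ⁻¹' {τ (1, 1)}, fval e = M + c ∨ fval e = M - c ∨ fval e = -M + c ∨
      fval e = -M - c := by
    intro e
    have h0 := fval_root e
    rw [hfac1, mul_eq_zero, sub_eq_zero, sub_eq_zero, sq_eq_sq_iff_eq_or_eq_neg,
      sq_eq_sq_iff_eq_or_eq_neg] at h0
    rcases h0 with (h0 | h0) | (h0 | h0)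
    · left; linear_combination h0
    · right; left; linear_combination h0
    · right; right; left; linear_combination h0
    · right; right; right; linear_combination h0
  obtain ⟨e1, he1⟩ := fval_ex (p := τ (1, 1)) (M + c) (by rw [hfac1]; ring)
  obtain ⟨e3, he3⟩ := fval_ex (p := τ (1, 1)) (-M + c) (by rw [hfac1]; ring)
  have A1p := fun e (he : fval e = M + c) => A1 1 (by norm_num) e (by rw [he]; ring)
  have A1m := fun e (he : fval e = M - c) => A1 (-1) (by norm_num) e (by rw [he]; ring)
  have A2p := fun e (he : fval e = -M + c) => A2 1 (by norm_num) e (by rw [he]; ring)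
  have A2m := fun e (he : fval e = -M - c) => A2 (-1) (by norm_num) e (by rw [he]; ring)
  have B1p := fun e (he : fval e = M + c) => B1 1 (by norm_num) e (by rw [he]; ring)
  have B1m := fun e (he : fval e = M - c) => B1 (-1) (by norm_num) e (by rw [he]; ring)
  have B2p := fun e (he : fval e = -M + c) => B2 1 (by norm_num) e (by rw [he]; ring)
  have B2m := fun e (he : fval e = -M - c) => B2 (-1) (by norm_num) e (by rw [he]; ring)
  refine ⟨τ (1, 1), a, b, hab, ρ, ?_, ?_, ?_, ?_, ?_⟩
  · refine perm_facts fval fval_inj (ρ a) M c hroot ?_ ?_ ?_ ?_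
    · intro e he; rw [A1p e he]; ring
    · intro e he; rw [A1m e he]; ring
    · intro e he; rw [A2p e he]; ring
    · intro e he; rw [A2m e he]; ring
  · refine perm_facts fval fval_inj (ρ b) (-M) c ?_ ?_ ?_ ?_ ?_
    · intro e; rw [neg_neg]; have := hroot e; tauto
    · intro e he; rw [B2p e he]; ring
    · intro e he; rw [B2m e he]; ring
    · intro e he; rw [neg_neg] at *; rw [B1p e he]; ring
    · intro e he; rw [neg_neg] at *; rw [B1m e he]; ring
  · intro hE
    have := A1p e1 he1
    rw [hE, Equiv.Perm.one_apply, he1] at this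
    apply hc0; linear_combination this / 2
  · intro hE
    have := B2p e3 he3
    rw [hE, Equiv.Perm.one_apply, he3] at this
    apply hc0; linear_combination this / 2
  · intro hE
    have h1 := A1p e1 he1
    rw [hE, B1p e1 he1] at h1
    apply hc0; linear_combination h1 / 2

/-- For `B₁ = {4, -4}`, the fundamental group of `U_{B₁}` (at any basepoint) is not a free
group: it is not isomorphic to the free group on any set. -/
theorem stmt2 (x : U ({4, -4} : Set ℂ)) :
    ¬ ∃ S : Type, Nonempty (FundamentalGroup (U ({4, -4} : Set ℂ)) x ≃* FreeGroup S) := by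
  rintro ⟨S, ⟨φ⟩⟩
  obtain ⟨p, a, b, hab, ρ, hA2, hB2, hA1, hB1, hAB⟩ := key
  have : PathConnectedSpace (U ({4, -4} : Set ℂ)) := isPathConnected_iff_pathConnectedSpace.1 U_path
  let ψ : FundamentalGroup (U ({4, -4} : Set ℂ)) p ≃* FreeGroup S :=
    (FundamentalGroup.fundamentalGroupMulEquivOfPathConnected p x).trans φ
  have : IsFreeGroup (FundamentalGroup (U ({4, -4} : Set ℂ)) p) :=
    IsFreeGroup.ofMulEquiv ψ.symm
  obtain ⟨d, ⟨j, hj⟩, ⟨k, hk⟩⟩ := free_comm a b hab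
  refine hAB (cyc_invol (ρ d) (ρ a) (ρ b) ⟨j, ?_⟩ ⟨k, ?_⟩ hA2 hB2 hA1 hB1)
  · rw [← hj]; simp
  · rw [← hk]; simp
end
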